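/- Let f(X) = X^{p²} + f_1X^{p²−1} + ⋯ + f_{p²−1}X + f_{p²} be an Eisenstein polynomial of degree p² over K and L = K(π) for a root π of f. Then L/K is a cyclic Galois extension (of degree p²) if and only if: (1) v_p(f_p) = 1 and v_p(f_{pi}) ≥ 2 for all i ∈ 𝕀(2,p−1); (2) v_p(f_i) ≥ 2 for all i ∈ 𝕀(1,p−1), v_p(f_{p+1}) = 2, and v_p(f_i) ≥ 3 for all i ∈ 𝕀(p+2,p²−1); and, setting F_p = (f_p/p)‾, F_{p²} = (f_{p²}/p)‾ and G_i = (f_i/p²)‾ for i ≠ p, p² (well defined given (1) and (2)): (3) −F_p/F_{p²} ∈ (κ_K^×)^{p−1}; (4) G_{p+1}^p = −F_p^{p+1}; (5) G_{pℓ} = F_{p²}·(G_ℓ/F_p)^p for every ℓ ∈ 𝕀(3,p−1); (6) G_{2p} = F_{p²}·(G_2/F_p)^p + (1/2)·F_p·(F_p − F_{p²}^{1/p}); (7) for one (equivalently, for every) θ ∈ 𝒪_K whose reduction satisfies θ̄^{p(p−1)} = −F_p/F_{p²}, the polynomial F_{p²}X^p + F_pX − ((f_{p²}θ^{p²} + f_pθ^p)/p²)‾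 − G_1·θ̄ has a root in κ_K. -/

import Mathlib

open Polynomial IntermediateField

/-- The composite algebra structure `ℤ_[p] → ℚ_[p] → K`. -/
noncomputable instance zpAlgebra (p : ℕ) [Fact (Nat.Prime p)] (K : Type) [Field K]
    [Algebra ℚ_[p] K] : Algebra ℤ_[p] K :=
  ((algebraMap ℚ_[p] K).comp (algebraMap ℤ_[p] ℚ_[p])).toAlgebra

namespace CyclicEisenstein

open Finset

section Ring

variable {R S : Type*} [CommRing R] [CommRing S] {p : ℕ}

/-- The polynomial `((1 + x) ^ p - 1 - x ^ p) / p`, a truncated logarithm modulo `p`. -/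
def truncLog (p : ℕ) (x : R) : R :=
  ∑ k ∈ Ico 1 p, ((p.choose k / p : ℕ) : R) * x ^ k

theorem map_truncLog (φ : R →+* S) (x : R) : φ (truncLog p x) = truncLog p (φ x) := by
  simp [truncLog]

theorem one_add_pow_prime (hp : p.Prime) (x : R) :
    (1 + x) ^ p = 1 + x ^ p + p * truncLog p x := by
  rw [add_comm 1 x, add_pow, sum_range_succ, range_eq_Ico, sum_eq_sum_Ico_succ_bot hp.pos,
    truncLog, mul_sum]
  have : ∑ k ∈ Ico (0 + 1) p, x ^ k * 1 ^ (p - k) * (p.choose k : R) =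
      ∑ k ∈ Ico 1 p, (p : R) * (((p.choose k / p : ℕ) : R) * x ^ k) := by
    refine sum_congr rfl fun k hk => ?_
    rw [mem_Ico] at hk
    have h := Nat.mul_div_cancel' (hp.dvd_choose_self (by omega) hk.2)
    conv_lhs => rw [← h]
    push_cast
    ring
  rw [this]
  simp
  ring

theorem truncLog_eq_add (hp : p.Prime) (x : R) : ∃ y, truncLog p x = x + x ^ 2 * y := by
  refine ⟨∑ k ∈ Ico 2 p, ((p.choose k / p : ℕ) : R) * x ^ (k - 2), ?_⟩
  rw [truncLog, sum_eq_sum_Ico_succ_bot hp.one_lt, mul_sum]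
  congr 1
  · simp [Nat.div_self hp.pos]
  · refine sum_congr rfl fun k hk => ?_
    rw [mem_Ico] at hk
    obtain ⟨m, rfl⟩ := Nat.exists_eq_add_of_le hk.1
    simp only [Nat.add_sub_cancel_left]
    ring

theorem dvd_truncLog (x : R) : x ∣ truncLog p x :=
  dvd_sum fun k hk => Dvd.dvd.mul_left (dvd_pow_self x (by rw [mem_Ico] at hk; omega)) _

theorem sub_dvd_truncLog_sub (x y : R) : x - y ∣ truncLog p x - truncLog p y := by
  rw [truncLog, truncLog, ← sum_sub_distrib]
  refine dvd_sum fun k _ => ?_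
  rw [← mul_sub]
  exact Dvd.dvd.mul_left (sub_dvd_pow_sub_pow x y k) _

section Frobenius

variable {ϖ : R}

theorem add_mul_pow_prime (hp : p.Prime) (h : (p : R) * ϖ = 0) (x y : R) :
    (x + ϖ * y) ^ p = x ^ p + ϖ ^ p * y ^ p := by
  obtain ⟨r, hr⟩ := exists_add_pow_prime_eq hp x (ϖ * y)
  rw [hr, mul_pow]
  linear_combination x * y * r * h

theorem sum_mul_pow_prime (hp : p.Prime) (h : (p : R) * ϖ = 0) {ι : Type*} (s : Finset ι)
    (x : ι → R) : (∑ i ∈ s, ϖ * x i) ^ p = ∑ i ∈ s, ϖ ^ p * x i ^ p := by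
  classical
  induction s using Finset.induction_on with
  | empty => simp [hp.ne_zero]
  | insert i s hi ih =>
    rw [sum_insert hi, sum_insert hi, add_comm, add_mul_pow_prime hp h, ih, add_comm]

theorem natCast_pow_mul (hp : p.Prime) (h : (p : R) * ϖ = 0) (m : ℕ) :
    (m : R) ^ p * ϖ = m * ϖ := by
  have := Fact.mk hp
  have h1 : (p : ℤ) ∣ (m : ℤ) ^ p - m :=
    (ZMod.intCast_zmod_eq_zero_iff_dvd _ p).1 (by push_cast; rw [ZMod.pow_card, sub_self])
  obtain ⟨c, hc⟩ := h1
  have h2 : (m : R) ^ p - m = p * (c : R) := by exact_mod_cast congrArg (Int.cast : ℤ → R) hc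
  linear_combination ϖ * h2 + c * h

theorem truncLog_pow_prime (hp : p.Prime) (h : (p : R) * ϖ = 0) (x : R) :
    truncLog p (ϖ * x) ^ p = truncLog p (ϖ ^ p * x ^ p) := by
  have h1 : truncLog p (ϖ * x) =
      ∑ k ∈ Ico 1 p, ϖ * (((p.choose k / p : ℕ) : R) * ϖ ^ (k - 1) * x ^ k) := by
    refine sum_congr rfl fun k hk => ?_
    rw [mem_Ico] at hk
    obtain ⟨m, rfl⟩ := Nat.exists_eq_add_of_le hk.1
    simp only [Nat.add_sub_cancel_left]
    ring
  rw [h1, sum_mul_pow_prime hp h, truncLog]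
  refine sum_congr rfl fun k hk => ?_
  rw [mem_Ico] at hk
  obtain ⟨m, rfl⟩ := Nat.exists_eq_add_of_le hk.1
  obtain ⟨q, rfl⟩ := Nat.exists_eq_add_of_le hp.pos
  simp only [Nat.add_sub_cancel_left]
  have := natCast_pow_mul hp h ((1 + q).choose (1 + m) / (1 + q))
  linear_combination (ϖ ^ q * ϖ ^ (m * (1 + q)) * x ^ ((1 + m) * (1 + q))) * this

theorem one_add_pow_sub_one_pow_prime (hp : p.Prime) (h : (p : R) * ϖ = 0) (x : R) (l : ℕ) :
    ((1 + ϖ * x) ^ l - 1) ^ p = (1 + ϖ ^ p * x ^ p) ^ l - 1 := by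
  obtain ⟨y, hy⟩ : ϖ ∣ (1 + ϖ * x) ^ l - 1 := by
    have := sub_dvd_pow_sub_pow (1 + ϖ * x) 1 l
    rw [one_pow] at this
    exact (Dvd.intro x (by ring)).trans this
  have h1 := add_mul_pow_prime hp h 1 y
  have h2 := add_mul_pow_prime hp h 1 x
  rw [one_pow] at h1 h2
  rw [← h2, hy, mul_pow, ← pow_mul, mul_comm p l, pow_mul, ← sub_eq_iff_eq_add'.2 h1, ← hy]
  ring

end Frobenius

/-- The terms of the ramification equation that are `p`-th powers modulo `p`. -/
def frobPart (p : ℕ) (ϖ a b : R) (g : ℕ → R) (s s' : R) : R :=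
  -(a * b * ϖ ^ p * s' ^ p) + b * truncLog p (ϖ ^ p * s ^ p) +
    ∑ k ∈ Ico 2 p, g (p * k) * ϖ ^ (p * (p - k)) * ((1 + ϖ ^ p * s ^ p) ^ k - 1)

/-- The remaining terms of the ramification equation, divided by `ϖ ^ (p * (p - 1))`. -/
def tailPart (p : ℕ) (ϖ a : R) (g : ℕ → R) (s s' : R) : R :=
  a * truncLog p (ϖ * s) + ∑ l ∈ Ico 2 p, g l * ϖ ^ (p - l) * ((1 + ϖ * s) ^ l - 1) +
    g (p + 1) * (ϖ * s' + s ^ p * ϖ ^ (p - 1) * (1 + ϖ * s))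

/-- The ramification equation modulo `p * ϖ`. -/
def ramEq (p : ℕ) (ϖ a b : R) (g : ℕ → R) (s : R) : R :=
  -(b + a * ϖ ^ (p * (p - 1))) * (b * s ^ p ^ 2 + a * s ^ p) + b * truncLog p (ϖ ^ p * s ^ p) +
    ∑ k ∈ Ico 2 p, g (p * k) * ϖ ^ (p * (p - k)) * ((1 + ϖ ^ p * s ^ p) ^ k - 1) +
    ϖ ^ (p * (p - 1)) * (a * truncLog p (ϖ * s) +
      ∑ l ∈ Ico 1 p, g l * ϖ ^ (p - l) * ((1 + ϖ * s) ^ l - 1) +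
      g (p + 1) * (s + s ^ p * ϖ ^ (p - 1) * (1 + ϖ * s)))

theorem map_frobPart (φ : R →+* S) (ϖ a b : R) (g : ℕ → R) (s s' : R) :
    φ (frobPart p ϖ a b g s s') = frobPart p (φ ϖ) (φ a) (φ b) (φ ∘ g) (φ s) (φ s') := by
  simp [frobPart, map_truncLog]

theorem map_tailPart (φ : R →+* S) (ϖ a : R) (g : ℕ → R) (s s' : R) :
    φ (tailPart p ϖ a g s s') = tailPart p (φ ϖ) (φ a) (φ ∘ g) (φ s) (φ s') := by
  simp [tailPart, map_truncLog]

theorem map_ramEq (φ : R →+* S) (ϖ a b : R) (g : ℕ → R) (s : R) :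
    φ (ramEq p ϖ a b g s) = ramEq p (φ ϖ) (φ a) (φ b) (φ ∘ g) (φ s) := by
  simp [ramEq, map_truncLog]

section Quotient

variable {ϖ a b c θ s' : R} {g : ℕ → R}

theorem ramEq_eq (hp : p.Prime) (h : (p : R) * ϖ = 0) (hϖ : ϖ ^ p ^ 2 = -(p * b))
    (hc : b * θ ^ p ^ 2 + a * θ ^ p = p * c) :
    ramEq p ϖ a b g (θ + ϖ * s') =
      ϖ ^ p ^ 2 * (c + g 1 * θ - b ^ 2 * s' ^ p ^ 2 - a ^ 2 * s' ^ p) +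
      frobPart p ϖ a b g (θ + ϖ * s') s' +
      ϖ ^ (p * (p - 1)) * (g (p + 1) * θ + tailPart p ϖ a g (θ + ϖ * s') s') := by
  have hs := add_mul_pow_prime hp h θ s'
  have hs2 : (θ + ϖ * s') ^ p ^ 2 = θ ^ p ^ 2 + ϖ ^ p ^ 2 * s' ^ p ^ 2 := by
    have h' : (p : R) * ϖ ^ p = 0 := by
      obtain ⟨y, hy⟩ := dvd_pow_self ϖ hp.ne_zero
      rw [hy]
      linear_combination y * h
    rw [sq, pow_mul, hs, add_mul_pow_prime hp h', ← pow_mul, ← pow_mul, ← pow_mul]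
  have hz : ϖ ^ p ^ 2 * ϖ = 0 := by rw [hϖ]; linear_combination (-b) * h
  have hn : ϖ ^ (p * (p - 1)) * ϖ ^ p = ϖ ^ p ^ 2 := by
    rw [← pow_add]
    congr 1
    obtain ⟨q, rfl⟩ := Nat.exists_eq_add_of_le hp.one_le
    simp only [Nat.add_sub_cancel_left]
    ring
  obtain ⟨y, hy⟩ : ϖ ∣ ϖ ^ (p * (p - 1)) :=
    dvd_pow_self _ (Nat.mul_ne_zero hp.ne_zero (Nat.sub_ne_zero_of_lt hp.one_lt))
  have hl : ϖ ^ (p * (p - 1)) * ϖ ^ (p - 1) * ϖ = ϖ ^ p ^ 2 := by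
    rw [mul_assoc, ← pow_succ, Nat.sub_add_cancel hp.one_le, hn]
  rw [ramEq, frobPart, tailPart, sum_eq_sum_Ico_succ_bot hp.one_lt]
  set X := ∑ k ∈ Ico 2 p, g (p * k) * ϖ ^ (p * (p - k)) *
    ((1 + ϖ ^ p * (θ + ϖ * s') ^ p) ^ k - 1)
  set Y := ∑ l ∈ Ico (1 + 1) p, g l * ϖ ^ (p - l) * ((1 + ϖ * (θ + ϖ * s')) ^ l - 1)
  have e1 : b * (θ + ϖ * s') ^ p ^ 2 + a * (θ + ϖ * s') ^ p =
      p * c + b * ϖ ^ p ^ 2 * s' ^ p ^ 2 + a * ϖ ^ p * s' ^ p := by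
    rw [hs, hs2]; linear_combination hc
  rw [e1]
  have e2 : ϖ ^ (p * (p - 1)) * (p * c) = 0 := by rw [hy]; linear_combination y * c * h
  have e3 : ϖ ^ (p * (p - 1)) * ϖ ^ p ^ 2 = 0 := by rw [hy]; linear_combination y * hz
  linear_combination (-a) * e2 - a * b * s' ^ p ^ 2 * e3 - a ^ 2 * s' ^ p * hn
    - c * hϖ + g 1 * (θ + ϖ * s') * hl + g 1 * s' * hz

theorem tailPart_pow (hp : p.Prime) (h : (p : R) * ϖ = 0) (s : R) (hp2 : 2 < p) :
    tailPart p ϖ a g s s' ^ p = a ^ p * truncLog p (ϖ ^ p * s ^ p) +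
      ∑ l ∈ Ico 2 p, g l ^ p * ϖ ^ (p * (p - l)) * ((1 + ϖ ^ p * s ^ p) ^ l - 1) +
      g (p + 1) ^ p * (ϖ ^ p * s' ^ p + s ^ p ^ 2 * ϖ ^ (p * (p - 1)) * (1 + ϖ ^ p * s ^ p)) := by
  obtain ⟨y, hy⟩ : ϖ ∣ truncLog p (ϖ * s) := (Dvd.intro s rfl).trans (dvd_truncLog _)
  have hY : ∑ l ∈ Ico 2 p, g l * ϖ ^ (p - l) * ((1 + ϖ * s) ^ l - 1) =
      ∑ l ∈ Ico 2 p, ϖ * (g l * ϖ ^ (p - l - 1) * ((1 + ϖ * s) ^ l - 1)) := by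
    refine sum_congr rfl fun l hl => ?_
    rw [mem_Ico] at hl
    obtain ⟨m, hm⟩ := Nat.exists_eq_add_of_lt hl.2
    rw [show p - l = m + 1 by omega, Nat.add_sub_cancel]
    ring
  have e1 := one_add_pow_sub_one_pow_prime hp h s
  have e2 : (1 + ϖ * s) ^ p = 1 + ϖ ^ p * s ^ p := by
    simpa using add_mul_pow_prime hp h 1 s
  obtain ⟨m, hm⟩ := Nat.exists_eq_add_of_lt hp2
  rw [tailPart, hY, ← mul_sum, hy, show a * (ϖ * y) +
      ϖ * ∑ l ∈ Ico 2 p, g l * ϖ ^ (p - l - 1) * ((1 + ϖ * s) ^ l - 1) +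
      g (p + 1) * (ϖ * s' + s ^ p * ϖ ^ (p - 1) * (1 + ϖ * s)) =
      ϖ * (a * y) + ϖ * (∑ l ∈ Ico 2 p, g l * ϖ ^ (p - l - 1) * ((1 + ϖ * s) ^ l - 1)) +
      ϖ * (g (p + 1) * s') + ϖ * (g (p + 1) * s ^ p * ϖ ^ (p - 2) * (1 + ϖ * s)) by
    rw [show p - 1 = (p - 2) + 1 by omega]; ring]
  rw [add_mul_pow_prime hp h, add_mul_pow_prime hp h, add_mul_pow_prime hp h,
    ← mul_pow ϖ (Finset.sum _ _),
    mul_sum, sum_mul_pow_prime hp h, ← truncLog_pow_prime hp h, hy]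
  have hX : ∑ i ∈ Ico 2 p, ϖ ^ p * (g i * ϖ ^ (p - i - 1) * ((1 + ϖ * s) ^ i - 1)) ^ p =
      ∑ l ∈ Ico 2 p, g l ^ p * ϖ ^ (p * (p - l)) * ((1 + ϖ ^ p * s ^ p) ^ l - 1) := by
    refine sum_congr rfl fun l hl => ?_
    rw [mem_Ico] at hl
    rw [← e1]
    obtain ⟨m, hm⟩ := Nat.exists_eq_add_of_lt hl.2
    rw [show p - l = m + 1 by omega, Nat.add_sub_cancel, mul_comm p (m + 1), pow_mul,
      mul_pow (_ * _), mul_pow]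
    ring
  have e3 : ϖ ^ (p * (p - 1)) = ϖ ^ p * (ϖ ^ (p - 2)) ^ p := by
    rw [← pow_mul, ← pow_add]
    congr 1
    rw [show p - 1 = (p - 2) + 1 by omega]
    ring
  rw [hX, e3, sq p, pow_mul s, mul_pow, mul_pow (_ * _) (1 + _), e2]
  ring

theorem pow_mul_frobPart (hp : p.Prime) (hp2 : 2 < p) (h : (p : R) * ϖ = 0) (s : R) :
    a ^ p * frobPart p ϖ a b g s s' = b * tailPart p ϖ a g s s' ^ p -
      b * (g (p + 1) ^ p + a ^ (p + 1)) * ϖ ^ p * s' ^ p +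
      ∑ k ∈ Ico 2 p, (a ^ p * g (p * k) - b * g k ^ p) * ϖ ^ (p * (p - k)) *
        ((1 + ϖ ^ p * s ^ p) ^ k - 1) -
      b * g (p + 1) ^ p * s ^ p ^ 2 * ϖ ^ (p * (p - 1)) * (1 + ϖ ^ p * s ^ p) := by
  rw [tailPart_pow hp h s hp2, frobPart]
  simp only [sub_mul, sum_sub_distrib, mul_assoc, ← mul_sum]
  ring

end Quotient

end Ring

theorem natCast_dvd_algebraMap {A B : Type*} [CommRing A] [CommRing B] [Algebra A B] {p : ℕ} {c : A}
    (h : (p : A) ∣ c) : (p : B) ∣ algebraMap A B c := by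
  simpa using map_dvd (algebraMap A B) h

/-- `B` behaves like a totally ramified extension of degree `p ^ 2`, with uniformizer `ϖ`, of an
unramified `p`-adic ring `A` with residue map `ρ`. -/
structure IsTotRamified (p : ℕ) {A B κ : Type*} [CommRing A] [CommRing B] [IsDomain B] [Algebra A B]
    [Field κ] (ρ : A →+* κ) (r : B →+* κ) (ϖ : B) : Prop where
  prime : p.Prime
  two_lt : 2 < p
  map_algebraMap : ∀ x, r (algebraMap A B x) = ρ x
  surjective : Function.Surjective ρ
  ker : ∀ x, ρ x = 0 ↔ (p : A) ∣ x
  dvd_iff : ∀ x, r x = 0 ↔ ϖ ∣ x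
  isUnit : ∀ x, r x ≠ 0 → IsUnit x
  associated : Associated (p : B) (ϖ ^ p ^ 2)
  ne_zero : ϖ ≠ 0
  exists_eq : ∀ x, x ≠ 0 → ∃ k u, r u ≠ 0 ∧ x = ϖ ^ k * u

namespace IsTotRamified

variable {p : ℕ} {A B κ : Type*} [CommRing A] [CommRing B] [IsDomain B] [Algebra A B] [Field κ]
  {ρ : A →+* κ} {r : B →+* κ} {ϖ : B} (H : IsTotRamified p ρ r ϖ)

include H

theorem pow_add_dvd_iff (k j : ℕ) (x : B) : ϖ ^ (k + j) ∣ ϖ ^ k * x ↔ ϖ ^ j ∣ x := by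
  rw [pow_add, mul_dvd_mul_iff_left (pow_ne_zero _ H.ne_zero)]

theorem pow_succ_dvd_iff (k : ℕ) (x : B) : ϖ ^ (k + 1) ∣ ϖ ^ k * x ↔ r x = 0 := by
  rw [H.pow_add_dvd_iff, pow_one, H.dvd_iff]

theorem map_uniformizer : r ϖ = 0 := (H.dvd_iff _).2 dvd_rfl

theorem prime_dvd_iff (x : B) : (p : B) ∣ x ↔ ϖ ^ p ^ 2 ∣ x := H.associated.dvd_iff_dvd_left

theorem prime_mul_dvd_iff (k : ℕ) (x : B) : (p : B) * ϖ ^ k ∣ x ↔ ϖ ^ (p ^ 2 + k) ∣ x := by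
  rw [pow_add]
  exact (H.associated.mul_right _).dvd_iff_dvd_left

theorem natCast_ne_zero : (p : B) ≠ 0 :=
  fun h => pow_ne_zero (p ^ 2) H.ne_zero (H.associated.eq_zero_iff.1 h)

theorem map_prime : ρ (p : A) = 0 := (H.ker _).2 dvd_rfl

theorem charP : CharP κ p := by
  have h : ((p : ℕ) : κ) = 0 := by simpa using H.map_prime
  exact ringChar.of_eq (CharP.ringChar_of_prime_eq_zero H.prime h)

theorem dvd_algebraMap_iff (c : A) : ϖ ∣ algebraMap A B c ↔ (p : A) ∣ c := by
  rw [← H.dvd_iff, H.map_algebraMap, H.ker]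

theorem exists_algebraMap (x : B) : ∃ (c : A) (y : B), x = algebraMap A B c + ϖ * y := by
  obtain ⟨c, hc⟩ := H.surjective (r x)
  obtain ⟨y, hy⟩ := (H.dvd_iff (x - algebraMap A B c)).1 (by
    rw [map_sub, H.map_algebraMap, hc, sub_self])
  exact ⟨c, y, by linear_combination hy⟩

theorem eq_zero_of_forall_dvd {x : B} (h : ∀ m, ϖ ^ m ∣ x) : x = 0 := by
  by_contra hx
  obtain ⟨k, u, hu, rfl⟩ := H.exists_eq x hx
  exact hu ((H.pow_succ_dvd_iff k u).1 (h _))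

theorem pow_dvd_of_pow_dvd_pow {m : ℕ} {y : B} (h : ϖ ^ (p * m + 1) ∣ y ^ p) :
    ϖ ^ (m + 1) ∣ y := by
  by_cases hy : y = 0
  · simp [hy]
  obtain ⟨k, u, hu, rfl⟩ := H.exists_eq y hy
  by_contra hk
  have hk : k ≤ m := by
    by_contra hk'
    exact hk ((pow_dvd_pow _ (by omega)).trans (dvd_mul_right _ _))
  rw [mul_pow, ← pow_mul] at h
  have h1 : ϖ ^ (k * p + 1) ∣ ϖ ^ (k * p) * u ^ p :=
    (pow_dvd_pow _ (by rw [mul_comm]; gcongr)).trans h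
  rw [H.pow_succ_dvd_iff, map_pow] at h1
  exact hu (pow_eq_zero_iff H.prime.ne_zero |>.1 h1)

/-- Modulo `p`, a `p`-th power has order a multiple of `p`. -/
theorem prime_dvd_of_frobenius {x y : B} (h : (p : B) ∣ x - y ^ p)
    (hx : ϖ ^ (p * (p - 1) + 1) ∣ x) : (p : B) ∣ x := by
  rw [H.prime_dvd_iff] at h ⊢
  have h1 : ϖ ^ (p * (p - 1) + 1) ∣ y ^ p := by
    have h2 : ϖ ^ (p * (p - 1) + 1) ∣ x - y ^ p := (pow_dvd_pow _ (by
      obtain ⟨q, rfl⟩ := Nat.exists_eq_add_of_le H.prime.two_le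
      simp only [show 2 + q - 1 = q + 1 by omega]
      nlinarith)).trans h
    simpa using dvd_sub hx h2
  have h3 := H.pow_dvd_of_pow_dvd_pow h1
  rw [Nat.sub_add_cancel H.prime.one_le] at h3
  have h4 := pow_dvd_pow_of_dvd h3 p
  rw [← pow_mul, ← sq] at h4
  simpa using dvd_add h h4

/-- A polynomial in `Y`, of order `p`, with small order has coefficients divisible by `p`. -/
theorem prime_dvd_of_sum {m : ℕ} (hm : 1 ≤ m) {c : ℕ → A} {y : B} (hy : r y ≠ 0)
    (h : ϖ ^ (p * (p - m) + p + 1) ∣ ∑ k ∈ Ico m p, algebraMap A B (c k) * ϖ ^ (p * (p - k)) *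
      ((1 + ϖ ^ p * y) ^ k - 1)) (k : ℕ) (hk : m ≤ k) (hkp : k < p) : (p : A) ∣ c k := by
  have hY (k : ℕ) : ϖ ^ p ∣ (1 + ϖ ^ p * y) ^ k - 1 := by
    have := sub_dvd_pow_sub_pow (1 + ϖ ^ p * y) 1 k
    rw [one_pow] at this
    exact (Dvd.intro y (by ring)).trans this
  induction hd : p - k using Nat.strong_induction_on generalizing k with
  | _ d ih =>
  have hdvd : ∀ j ∈ (Ico m p).erase k, ϖ ^ (p * (p - k) + p + 1) ∣
      algebraMap A B (c j) * ϖ ^ (p * (p - j)) * ((1 + ϖ ^ p * y) ^ j - 1) := by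
    intro j hj
    rw [mem_erase, mem_Ico] at hj
    obtain ⟨hjk, hmj, hjp⟩ := hj
    obtain hjk | hjk := Nat.lt_or_gt_of_ne hjk
    · have h1 : ϖ ^ (p * (p - k) + p + 1) ∣ ϖ ^ (p * (p - j)) * ϖ ^ p := by
        rw [← pow_add]
        refine pow_dvd_pow _ ?_
        have : p * (p - k + 1) ≤ p * (p - j) := Nat.mul_le_mul_left _ (by omega)
        have := H.two_lt
        rw [mul_add] at *
        omega
      refine h1.trans ?_
      rw [mul_assoc]
      exact Dvd.dvd.mul_left (mul_dvd_mul_left _ (hY j)) _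
    · have h1 := natCast_dvd_algebraMap (B := B) (ih (p - j) (by omega) j hmj hjp rfl)
      rw [H.prime_dvd_iff] at h1
      have h2 : ϖ ^ (p * (p - k) + p + 1) ∣ ϖ ^ p ^ 2 * ϖ ^ p := by
        rw [← pow_add]
        refine pow_dvd_pow _ ?_
        have : p * (p - k + 1) ≤ p * p := Nat.mul_le_mul_left _ (by omega)
        have := H.two_lt
        rw [mul_add] at *
        rw [sq]
        omega
      refine h2.trans ?_
      rw [mul_assoc]
      exact mul_dvd_mul h1 (Dvd.dvd.mul_left (hY j) _)
  have h1 := dvd_sum hdvd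
  have h2 : ϖ ^ (p * (p - k) + p + 1) ∣ ∑ k ∈ Ico m p,
      algebraMap A B (c k) * ϖ ^ (p * (p - k)) * ((1 + ϖ ^ p * y) ^ k - 1) :=
    (pow_dvd_pow _ (by gcongr)).trans h
  rw [← add_sum_erase _ _ (mem_Ico.2 ⟨hk, hkp⟩), dvd_add_left h1] at h2
  obtain ⟨z, hz⟩ : ∃ z, (1 + ϖ ^ p * y) ^ k - 1 = ϖ ^ p * (k * y + ϖ * z) := by
    obtain ⟨z, hz⟩ := powAddExpansion 1 (ϖ ^ p * y) k
    obtain ⟨w, hw⟩ := dvd_pow_self ϖ H.prime.ne_zero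
    refine ⟨z * y ^ 2 * w, ?_⟩
    rw [hz]
    simp only [one_pow, mul_one]
    linear_combination z * ϖ ^ p * y ^ 2 * hw
  rw [hz, show algebraMap A B (c k) * ϖ ^ (p * (p - k)) * (ϖ ^ p * (k * y + ϖ * z)) =
    ϖ ^ (p * (p - k) + p) * (algebraMap A B (c k) * (k * y + ϖ * z)) by ring,
    H.pow_succ_dvd_iff] at h2
  simp only [map_mul, map_add, H.map_algebraMap, map_natCast, H.map_uniformizer, zero_mul,
    add_zero, mul_eq_zero, hy, or_false] at h2
  have := H.charP
  rw [CharP.cast_eq_zero_iff κ p, or_iff_left (Nat.not_dvd_of_pos_of_lt (by omega) hkp),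
    H.ker] at h2
  exact h2

end IsTotRamified

section Ring

variable {R S : Type*} [CommRing R] [CommRing S] {p : ℕ}

/-- The indices in `[p + 2, p ^ 2 - 1]` which are prime to `p`. -/
def highIndices (p : ℕ) : Finset ℕ := {i ∈ Ico (p + 2) (p ^ 2) | ¬p ∣ i}

theorem mem_highIndices {i : ℕ} : i ∈ highIndices p ↔ p + 2 ≤ i ∧ i < p ^ 2 ∧ ¬p ∣ i := by
  simp [highIndices, and_assoc]

theorem sum_Icc_sq {M : Type*} [AddCommMonoid M] (hp2 : 2 < p) (F : ℕ → M) :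
    ∑ i ∈ Icc 1 (p ^ 2), F i = ∑ l ∈ Ico 1 p, F l + F p + F (p + 1) +
      ∑ k ∈ Ico 2 p, F (p * k) + F (p ^ 2) + ∑ i ∈ highIndices p, F i := by
  have h1 : p + 2 ≤ p ^ 2 := by nlinarith
  have h2 : ∑ i ∈ Ico (p + 2) (p ^ 2), F i =
      ∑ k ∈ Ico 2 p, F (p * k) + ∑ i ∈ highIndices p, F i := by
    rw [highIndices, ← sum_filter_add_sum_filter_not _ (p ∣ ·)]
    congr 1
    rw [← sum_image (s := Ico 2 p) (g := (p * ·)) (f := F)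
      (fun x _ y _ h => Nat.eq_of_mul_eq_mul_left (by omega) h)]
    refine sum_congr ?_ fun _ _ => rfl
    ext i
    simp only [mem_filter, mem_Ico, mem_image]
    constructor
    · rintro ⟨⟨h3, h4⟩, k, rfl⟩
      refine ⟨k, ⟨?_, ?_⟩, rfl⟩
      · by_contra hk
        have : p * k ≤ p * 1 := Nat.mul_le_mul_left _ (by omega)
        omega
      · rw [sq] at h4
        exact Nat.lt_of_mul_lt_mul_left h4
    · rintro ⟨k, ⟨h3, h4⟩, rfl⟩
      refine ⟨⟨?_, ?_⟩, dvd_mul_right _ _⟩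
      · nlinarith
      · rw [sq]
        exact Nat.mul_lt_mul_of_pos_left h4 (by omega)
  rw [← Ico_insert_right (Nat.one_le_pow _ _ (by omega)), sum_insert (by simp),
    ← sum_Ico_consecutive F (show 1 ≤ p + 2 by omega) h1, sum_Ico_succ_top (by omega),
    sum_Ico_succ_top (by omega), h2]
  abel

/-- For `f = X ^ n + ∑ f i * X ^ (n - i)` with `n = p ^ 2` and `f(ϖ) = 0`, this is
`w ^ n * f (ϖ / w)` with `w = 1 + ϖ * s`. -/
def shiftSum (p : ℕ) (ϖ : R) (f : ℕ → R) (s : R) : R :=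
  ∑ i ∈ Icc 1 (p ^ 2), f i * ϖ ^ (p ^ 2 - i) * ((1 + ϖ * s) ^ i - 1)

theorem map_shiftSum (φ : R →+* S) (ϖ : R) (f : ℕ → R) (s : R) :
    φ (shiftSum p ϖ f s) = shiftSum p (φ ϖ) (φ ∘ f) (φ s) := by
  simp [shiftSum]

section

variable {ϖ a b : R} {f g : ℕ → R}

theorem one_add_pow_mul_prime (hp : p.Prime) (s : R) : ∃ y, ∀ k, ∃ z,
    (1 + ϖ * s) ^ (p * k) = (1 + ϖ ^ p * s ^ p + p * ϖ * y) ^ k ∧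
    (1 + ϖ * s) ^ (p * k) = (1 + ϖ ^ p * s ^ p) ^ k + p * ϖ * z ∧
    truncLog p (ϖ * s) = ϖ * y := by
  obtain ⟨y, hy⟩ : ϖ ∣ truncLog p (ϖ * s) := (Dvd.intro s rfl).trans (dvd_truncLog _)
  refine ⟨y, fun k => ?_⟩
  have h1 : (1 + ϖ * s) ^ (p * k) = (1 + ϖ ^ p * s ^ p + p * ϖ * y) ^ k := by
    rw [pow_mul, one_add_pow_prime hp, hy, mul_pow, mul_assoc]
  obtain ⟨z, hz⟩ := sub_dvd_pow_sub_pow (1 + ϖ ^ p * s ^ p + p * ϖ * y) (1 + ϖ ^ p * s ^ p) k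
  refine ⟨y * z, h1, ?_, hy⟩
  rw [h1]
  linear_combination hz

theorem pow_sub_mul_dvd {i : ℕ} (hi : i < p ^ 2) : ϖ ∣ ϖ ^ (p ^ 2 - i) :=
  dvd_pow_self _ (by omega)

theorem shiftSum_eq (hp : p.Prime) (hp2 : 2 < p) (h : (p : R) ^ 3 * ϖ = 0)
    (hϖ : ϖ ^ p ^ 2 = -∑ i ∈ Icc 1 (p ^ 2), f i * ϖ ^ (p ^ 2 - i))
    (ha : f p = p * a) (hb : f (p ^ 2) = p * b)
    (hg : ∀ i, 1 ≤ i → i < p ^ 2 → i ≠ p → f i = p ^ 2 * g i)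
    (hg' : ∀ i ∈ highIndices p, (p : R) ∣ g i) (s : R) :
    shiftSum p ϖ f s = p ^ 2 * ramEq p ϖ a b g s := by
  have h1 : p + 2 ≤ p ^ 2 := by nlinarith
  have hpk {k : ℕ} (hk : k ∈ Ico 2 p) : 1 ≤ p * k ∧ p * k < p ^ 2 ∧ p * k ≠ p := by
    rw [mem_Ico] at hk
    exact ⟨by nlinarith, by nlinarith, by nlinarith⟩
  have hsub (k : ℕ) : p ^ 2 - p * k = p * (p - k) := by rw [sq, Nat.mul_sub]
  have hsub1 : p ^ 2 - p = p * (p - 1) := by simpa using hsub 1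
  have hl {l : ℕ} (hl : l ∈ Ico 1 p) : 1 ≤ l ∧ l < p ^ 2 ∧ l ≠ p ∧
      p ^ 2 - l = p * (p - 1) + (p - l) := by
    rw [mem_Ico] at hl
    rw [← hsub1]
    omega
  have hϖ' : p * ϖ ^ p ^ 2 = -(p ^ 2 * (b + a * ϖ ^ (p * (p - 1)))) := by
    have hz {i : ℕ} (h1 : 1 ≤ i) (h2 : i < p ^ 2) (h3 : i ≠ p) :
        p * (f i * ϖ ^ (p ^ 2 - i)) = 0 := by
      obtain ⟨y, hy⟩ := pow_sub_mul_dvd (ϖ := ϖ) h2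
      rw [hg i h1 h2 h3, hy]
      linear_combination (g i * y) * h
    rw [hϖ, sum_Icc_sq hp2, mul_neg, mul_add, mul_add, mul_add, mul_add, mul_add, mul_sum,
      mul_sum, mul_sum, sum_eq_zero fun i hi => hz (hl hi).1 (hl hi).2.1 (hl hi).2.2.1,
      hz (i := p + 1) (by omega) (by omega) (by omega),
      sum_eq_zero fun i hi => hz (hpk hi).1 (hpk hi).2.1 (hpk hi).2.2,
      sum_eq_zero fun i hi => hz _ _ _, ha, hb, hsub1, Nat.sub_self, pow_zero]
    · ring
    all_goals
      intro i hi
      rw [mem_highIndices] at hi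
      omega
  obtain ⟨y, hy⟩ := one_add_pow_mul_prime (ϖ := ϖ) hp s
  have hΛ : truncLog p (ϖ * s) = ϖ * y := (hy 0).choose_spec.2.2
  have hw : (1 + ϖ * s) ^ p = 1 + ϖ ^ p * s ^ p + p * ϖ * y := by
    simpa using (hy 1).choose_spec.1
  have e1 : ∑ l ∈ Ico 1 p, f l * ϖ ^ (p ^ 2 - l) * ((1 + ϖ * s) ^ l - 1) =
      p ^ 2 * ϖ ^ (p * (p - 1)) * ∑ l ∈ Ico 1 p, g l * ϖ ^ (p - l) * ((1 + ϖ * s) ^ l - 1) := by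
    rw [mul_sum]
    refine sum_congr rfl fun l hl' => ?_
    obtain ⟨h1, h2, h3, h4⟩ := hl hl'
    rw [hg l h1 h2 h3, h4]
    ring
  have e2 : ∑ k ∈ Ico 2 p, f (p * k) * ϖ ^ (p ^ 2 - p * k) * ((1 + ϖ * s) ^ (p * k) - 1) =
      p ^ 2 * ∑ k ∈ Ico 2 p, g (p * k) * ϖ ^ (p * (p - k)) * ((1 + ϖ ^ p * s ^ p) ^ k - 1) := by
    rw [mul_sum]
    refine sum_congr rfl fun k hk => ?_
    obtain ⟨h1, h2, h3⟩ := hpk hk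
    obtain ⟨z, -, hz, -⟩ := hy k
    rw [hg _ h1 h2 h3, hsub, hz]
    linear_combination (g (p * k) * ϖ ^ (p * (p - k)) * z) * h
  have e3 : ∑ i ∈ highIndices p, f i * ϖ ^ (p ^ 2 - i) * ((1 + ϖ * s) ^ i - 1) = 0 := by
    refine sum_eq_zero fun i hi => ?_
    obtain ⟨z, hz⟩ := hg' i hi
    rw [mem_highIndices] at hi
    obtain ⟨y, hy⟩ := pow_sub_mul_dvd (ϖ := ϖ) hi.2.1
    rw [hg i (by omega) hi.2.1 (by omega), hy, hz]
    linear_combination (z * y * ((1 + ϖ * s) ^ i - 1)) * h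
  have e4 : (p : R) * ((1 + ϖ * s) ^ p ^ 2 - 1) =
      p * ϖ ^ p ^ 2 * s ^ p ^ 2 + p ^ 2 * truncLog p (ϖ ^ p * s ^ p) := by
    obtain ⟨z, hz⟩ := exists_add_pow_prime_eq hp (1 + ϖ ^ p * s ^ p) (p * ϖ * y)
    have hq : (p * ϖ * y) ^ p = p ^ 3 * ϖ * (ϖ ^ 2 * y ^ 3 * (p * ϖ * y) ^ (p - 3)) := by
      conv_lhs => rw [show p = p - 3 + 3 by omega, pow_add]
      rw [← show p = p - 3 + 3 by omega]
      ring
    rw [sq p, pow_mul, hw, hz, hq, h, one_add_pow_prime hp, mul_pow (ϖ ^ p), ← pow_mul, ← pow_mul]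
    linear_combination ((1 + ϖ ^ p * s ^ p) * y * z) * h
  have e5 : ϖ ^ (p * (p - 1)) = ϖ ^ (p ^ 2 - (p + 1)) * ϖ := by
    rw [← pow_succ, ← hsub1]; congr 1; omega
  have e6 : ϖ ^ (p * (p - 1)) * ϖ ^ p = ϖ ^ p ^ 2 := by
    rw [← pow_add, ← hsub1]; congr 1; omega
  have e7 : ϖ ^ p = ϖ ^ (p - 1) * ϖ := by rw [← pow_succ]; congr 1; omega
  rw [shiftSum, sum_Icc_sq hp2, e1, e2, e3, ha, hb, hg (p + 1) (by omega) (by omega) (by omega),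
    pow_succ (1 + ϖ * s) p, hw, hsub1, Nat.sub_self, pow_zero, ramEq, hΛ]
  linear_combination b * e4 + a * p * s ^ p * e6 + (b * s ^ p ^ 2 + a * s ^ p) * hϖ' +
    p ^ 2 * g (p + 1) * (1 + ϖ * s) * s ^ p *
      (ϖ ^ (p ^ 2 - (p + 1)) * e7 - ϖ ^ (p - 1) * e5) - p ^ 2 * g (p + 1) * s * e5 +
    ϖ ^ (p ^ 2 - (p + 1)) * y * g (p + 1) * (1 + ϖ * s) * h

end

end Ring

section Ring

variable {R : Type*} [CommRing R] {p : ℕ} {ϖ a b c θ s' q β : R} {g : ℕ → R}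

theorem two_mul_pow_mul_ramEq (hp : p.Prime) (hp2 : 2 < p) (h : (p : R) * ϖ = 0)
    (hϖ : ϖ ^ p ^ 2 = -(p * b)) (hc : b * θ ^ p ^ 2 + a * θ ^ p = p * c)
    (h4 : (p : R) ∣ g (p + 1) ^ p + a ^ (p + 1))
    (h5 : ∀ k ∈ Ico 3 p, (p : R) ∣ a ^ p * g (p * k) - b * g k ^ p)
    (h6 : (p : R) ∣ 2 * (a ^ p * g (p * 2) - b * g 2 ^ p) - a ^ (p + 1) * (a - β))
    (hθ : (p : R) ∣ g (p + 1) * θ - a * β * θ ^ p)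
    (hq : tailPart p ϖ a g (θ + ϖ * s') s' = ϖ ^ p * q) :
    2 * a ^ p * ramEq p ϖ a b g (θ + ϖ * s') = ϖ ^ p ^ 2 *
      (2 * a ^ p * (c + g 1 * θ - b ^ 2 * s' ^ p ^ 2) - 2 * a ^ (p + 1) * β * s' ^ p -
        a ^ (p + 1) * (a + β) * θ ^ (2 * p) + 2 * a ^ p * q + 2 * b * q ^ p) := by
  have hs := add_mul_pow_prime hp h θ s'
  obtain ⟨y, hy⟩ := dvd_pow_self ϖ hp.ne_zero
  have h' : (p : R) * ϖ ^ p = 0 := by rw [hy]; linear_combination y * h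
  have hs2 : (θ + ϖ * s') ^ p ^ 2 = θ ^ p ^ 2 + ϖ ^ p ^ 2 * s' ^ p ^ 2 := by
    rw [sq, pow_mul, hs, add_mul_pow_prime hp h', ← pow_mul, ← pow_mul, ← pow_mul]
  have hz : ϖ ^ p ^ 2 * ϖ ^ p = 0 := by rw [hϖ]; linear_combination (-b) * h'
  obtain ⟨t', ht'⟩ : ϖ ∣ ϖ ^ (p * (p - 1)) :=
    dvd_pow_self _ (Nat.mul_ne_zero hp.ne_zero (Nat.sub_ne_zero_of_lt hp.one_lt))
  have ht : (p : R) * ϖ ^ (p * (p - 1)) = 0 := by rw [ht']; linear_combination t' * h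
  have hn : ϖ ^ (p * (p - 1)) * ϖ ^ p = ϖ ^ p ^ 2 := by
    rw [← pow_add]
    congr 1
    obtain ⟨q, rfl⟩ := Nat.exists_eq_add_of_le hp.one_le
    simp only [Nat.add_sub_cancel_left]
    ring
  have hn2 : ϖ ^ (p * (p - 2)) * ϖ ^ p = ϖ ^ (p * (p - 1)) := by
    rw [← pow_add]
    congr 1
    obtain ⟨q, rfl⟩ := Nat.exists_eq_add_of_lt hp2
    simp only [show 2 + q + 1 - 2 = q + 1 by omega, show 2 + q + 1 - 1 = q + 2 by omega]
    ring
  have e5 : ∑ k ∈ Ico 3 p, (a ^ p * g (p * k) - b * g k ^ p) * ϖ ^ (p * (p - k)) *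
      ((1 + ϖ ^ p * (θ + ϖ * s') ^ p) ^ k - 1) = 0 := by
    refine sum_eq_zero fun k hk => ?_
    obtain ⟨z, hz⟩ := h5 k hk
    obtain ⟨x, hx⟩ : ϖ ^ p ∣ (1 + ϖ ^ p * (θ + ϖ * s') ^ p) ^ k - 1 := by
      have := sub_dvd_pow_sub_pow (1 + ϖ ^ p * (θ + ϖ * s') ^ p) 1 k
      rw [one_pow] at this
      exact (Dvd.intro ((θ + ϖ * s') ^ p) (by ring)).trans this
    rw [hz, hx]
    linear_combination z * ϖ ^ (p * (p - k)) * x * h'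
  obtain ⟨d0, h4⟩ := h4
  obtain ⟨d2, h6⟩ := h6
  obtain ⟨d1, hθ⟩ := hθ
  have key := pow_mul_frobPart (ϖ := ϖ) (a := a) (b := b) (s' := s') (g := g) hp hp2 h (θ + ϖ * s')
  rw [sum_eq_sum_Ico_succ_bot hp2, e5] at key
  rw [ramEq_eq hp h hϖ hc, mul_add, mul_add, mul_assoc 2 (a ^ p) (frobPart ..), key, hq]
  have htn : ϖ ^ (p * (p - 1)) * ϖ ^ p ^ 2 = 0 := by
    rw [← hn2]; linear_combination ϖ ^ (p * (p - 2)) * hz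
  have hq' : (ϖ ^ p * q) ^ p = ϖ ^ p ^ 2 * q ^ p := by rw [mul_pow, ← pow_mul, sq]
  have h2 : θ ^ (2 * p) = (θ ^ p) ^ 2 := by rw [← pow_mul, mul_comm]
  rw [hq', hs, hs2, h2, pow_succ a p] at *
  set u := θ ^ p + ϖ ^ p * s' ^ p with hu
  set S := θ ^ p ^ 2 + ϖ ^ p ^ 2 * s' ^ p ^ 2 with hS
  linear_combination (-2 * b * ϖ ^ p * s' ^ p -
      2 * b * S * ϖ ^ (p * (p - 1)) * (1 + ϖ ^ p * u)) * h4 - 2 * b * d0 * s' ^ p * h' +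
    (-2 * b * d0 * S * (1 + ϖ ^ p * u) + d2 * (2 * u + ϖ ^ p * u ^ 2) + 2 * a ^ p * d1 +
      2 * a ^ p * a * c * (1 + ϖ ^ p * u)) * ht +
    2 * (a ^ p * g (p * 2) - b * g 2 ^ p) * (2 * u + ϖ ^ p * u ^ 2) * hn2 +
    (2 * u + ϖ ^ p * u ^ 2) * ϖ ^ (p * (p - 1)) * h6 +
    (2 * a ^ p * q + a ^ p * a * (a - β) * (2 * s' ^ p + u ^ 2) -
      2 * a ^ p * a ^ 2 * θ ^ p * u) * hn + 2 * a ^ p * ϖ ^ (p * (p - 1)) * hθ +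
    2 * a ^ p * a * ϖ ^ (p * (p - 1)) * (1 + ϖ ^ p * u) * hc +
    2 * a ^ p * a * b * s' ^ p ^ 2 * (1 + ϖ ^ p * u) * htn +
    a ^ p * a * ((a - β) * (2 * θ ^ p * s' ^ p + ϖ ^ p * (s' ^ p) ^ 2) -
      2 * a * θ ^ p * s' ^ p) * hz

end Ring

section Ring

variable {R : Type*} [CommRing R] {p : ℕ} {ϖ a : R} {g : ℕ → R}

theorem sq_dvd_tailPart_sub (hp : p.Prime) (hp2 : 2 < p) (θ s' : R) :
    ϖ ^ 2 ∣ tailPart p ϖ a g (θ + ϖ * s') s' - ϖ * (a * θ + g (p + 1) * s') := by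
  obtain ⟨y, hy⟩ := truncLog_eq_add hp (ϖ * (θ + ϖ * s'))
  have h1 : ϖ ^ 2 ∣ ∑ l ∈ Ico 2 p, g l * ϖ ^ (p - l) * ((1 + ϖ * (θ + ϖ * s')) ^ l - 1) := by
    refine dvd_sum fun l hl => ?_
    rw [mem_Ico] at hl
    rw [sq]
    refine mul_dvd_mul (Dvd.dvd.mul_left (dvd_pow_self _ (by omega)) _) ?_
    have := sub_dvd_pow_sub_pow (1 + ϖ * (θ + ϖ * s')) 1 l
    rw [one_pow] at this
    exact (Dvd.intro (θ + ϖ * s') (by ring)).trans this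
  obtain ⟨x, hx⟩ := h1
  obtain ⟨z, hz⟩ := pow_dvd_pow ϖ (show 2 ≤ p - 1 by omega)
  rw [tailPart, hy, hx, hz]
  refine ⟨a * s' + a * (θ + ϖ * s') ^ 2 * y + x + g (p + 1) * (θ + ϖ * s') ^ p * z *
    (1 + ϖ * (θ + ϖ * s')), ?_⟩
  ring

theorem dvd_tailPart_sub (hp2 : 2 < p) (θ s' z : R) :
    ϖ ^ 2 * z ∣ tailPart p ϖ a g (θ + ϖ * (s' + z)) (s' + z) -
      tailPart p ϖ a g (θ + ϖ * s') s' - ϖ * (g (p + 1) * z) := by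
  set s := θ + ϖ * s' with hs
  rw [show θ + ϖ * (s' + z) = s + ϖ * z by rw [hs]; ring]
  have h0 : ϖ * (s + ϖ * z) - ϖ * s = ϖ ^ 2 * z := by ring
  have h1 := sub_dvd_truncLog_sub (p := p) (ϖ * (s + ϖ * z)) (ϖ * s)
  rw [h0] at h1
  have h2 : ϖ ^ 2 * z ∣ ∑ l ∈ Ico 2 p, g l * ϖ ^ (p - l) * ((1 + ϖ * (s + ϖ * z)) ^ l - 1) -
      ∑ l ∈ Ico 2 p, g l * ϖ ^ (p - l) * ((1 + ϖ * s) ^ l - 1) := by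
    rw [← sum_sub_distrib]
    refine dvd_sum fun l _ => ?_
    rw [← mul_sub, sub_sub_sub_cancel_right]
    have := sub_dvd_pow_sub_pow (1 + ϖ * (s + ϖ * z)) (1 + ϖ * s) l
    rw [add_sub_add_left_eq_sub, h0] at this
    exact Dvd.dvd.mul_left this _
  have h3 : ϖ ^ 2 * z ∣ ((s + ϖ * z) ^ p - s ^ p) * ϖ ^ (p - 1) := by
    have := sub_dvd_pow_sub_pow (s + ϖ * z) s p
    rw [add_sub_cancel_left] at this
    rw [show ϖ ^ 2 * z = (ϖ * z) * ϖ by ring]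
    exact mul_dvd_mul this (dvd_pow_self _ (by omega))
  obtain ⟨x1, h1⟩ := h1
  obtain ⟨x2, h2⟩ := h2
  obtain ⟨x3, h3⟩ := h3
  refine ⟨a * x1 + x2 + g (p + 1) * (x3 * (1 + ϖ * s) + (s + ϖ * z) ^ p * ϖ ^ (p - 1)), ?_⟩
  rw [tailPart, tailPart]
  linear_combination a * h1 + h2 + g (p + 1) * (1 + ϖ * s) * h3

theorem dvd_shiftSum_sub {b : R} {f : ℕ → R} (hp : p.Prime) (hp2 : 2 < p)
    (hϖ : ϖ ^ p ^ 2 = -∑ i ∈ Icc 1 (p ^ 2), f i * ϖ ^ (p ^ 2 - i))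
    (ha : f p = p * a) (hb : f (p ^ 2) = p * b)
    (hg : ∀ i, 1 ≤ i → i < p ^ 2 → i ≠ p → f i = p ^ 2 * g i)
    (hg' : ∀ i ∈ highIndices p, (p : R) ∣ g i) (s : R) :
    (p : R) ^ 3 * ϖ ∣ shiftSum p ϖ f s - p ^ 2 * ramEq p ϖ a b g s := by
  let φ := Ideal.Quotient.mk (Ideal.span {(p : R) ^ 3 * ϖ})
  rw [← Ideal.mem_span_singleton, ← Ideal.Quotient.eq, map_mul, map_pow, map_natCast]
  change φ _ = p ^ 2 * φ _
  rw [map_shiftSum, map_ramEq]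
  refine shiftSum_eq hp hp2 ?_ ?_ ?_ ?_ ?_ ?_ _
  · rw [← map_natCast φ, ← map_pow, ← map_mul, Ideal.Quotient.eq_zero_iff_mem]
    exact Ideal.mem_span_singleton_self _
  · simp [← map_pow, hϖ]
  · simp [ha]
  · simp [hb]
  · intro i h1 h2 h3
    simp [hg i h1 h2 h3]
  · intro i hi
    simpa using map_dvd φ (hg' i hi)

theorem dvd_pow_add_mul {b : R} {f : ℕ → R} (hp2 : 2 < p)
    (hϖ : ϖ ^ p ^ 2 = -∑ i ∈ Icc 1 (p ^ 2), f i * ϖ ^ (p ^ 2 - i))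
    (hf : ∀ i ∈ Icc 1 (p ^ 2), (p : R) ∣ f i) (hb : f (p ^ 2) = p * b) :
    (p : R) * ϖ ∣ ϖ ^ p ^ 2 + p * b := by
  have h1 : 1 ≤ p ^ 2 := Nat.one_le_pow _ _ (by omega)
  rw [← Ico_insert_right h1, sum_insert (by simp), hb, Nat.sub_self, pow_zero] at hϖ
  rw [hϖ, show -(p * b * 1 + ∑ x ∈ Ico 1 (p ^ 2), f x * ϖ ^ (p ^ 2 - x)) + p * b =
    -∑ x ∈ Ico 1 (p ^ 2), f x * ϖ ^ (p ^ 2 - x) by ring, dvd_neg]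
  refine dvd_sum fun i hi => mul_dvd_mul (hf i ?_) (pow_sub_mul_dvd ?_)
  all_goals
    simp only [mem_Icc, mem_Ico] at *
    omega

end Ring

theorem residue_identity {κ : Type*} [Field κ] {p : ℕ} [Fact p.Prime] [CharP κ p] (hp2 : 2 < p)
    {α β θ a b c g₁ g s' q x : κ} (hα : α ^ p = a) (hβ : β ^ p = b) (ha : a ≠ 0) (hb : b ≠ 0)
    (h3 : b * θ ^ p ^ 2 + a * θ ^ p = 0) (h4 : g ^ p = -a ^ (p + 1))
    (hs : a * θ + g * s' = 0) (hx : x = -(q / a) - α * θ / a + α ^ 2 * θ ^ 2 / (2 * β)) :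
    2 * a ^ p * (c + g₁ * θ - b ^ 2 * s' ^ p ^ 2) - 2 * a ^ (p + 1) * β * s' ^ p -
        a ^ (p + 1) * (a + β) * θ ^ (2 * p) + 2 * a ^ p * q + 2 * b * q ^ p =
      -(2 * a ^ p) * (b * x ^ p + a * x - c - g₁ * θ) := by
  have hp : p.Prime := Fact.out
  have h20 : (2 : κ) ≠ 0 := by
    have : ((2 : ℕ) : κ) ≠ 0 := by
      rw [Ne, CharP.cast_eq_zero_iff κ p]
      exact Nat.not_dvd_of_pos_of_lt (by omega) hp2
    simpa using this
  have h2p : (2 : κ) ^ p = 2 := by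
    have := congrArg (ZMod.castHom (dvd_refl p) κ) (ZMod.pow_card (2 : ZMod p))
    rwa [map_pow, map_ofNat] at this
  have hβ0 : β ≠ 0 := by rintro rfl; rw [zero_pow hp.ne_zero] at hβ; exact hb hβ.symm
  have hα0 : α ≠ 0 := by rintro rfl; rw [zero_pow hp.ne_zero] at hα; exact ha hα.symm
  have hodd : Odd p := hp.odd_of_ne_two (by omega)
  have hg : g = -(a * α) := by
    apply frobenius_inj κ p
    simp only [frobenius_def]
    rw [h4, hodd.neg_pow, mul_pow, hα, pow_succ]
  have hαβ : α * θ = -(β * θ ^ p) := by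
    apply frobenius_inj κ p
    simp only [frobenius_def]
    rw [hodd.neg_pow, mul_pow, mul_pow, hα, hβ, ← pow_mul, ← sq]
    linear_combination h3
  have hs' : s' = θ / α := by
    rw [eq_div_iff hα0]
    apply mul_left_cancel₀ ha
    rw [hg] at hs
    linear_combination -hs
  have e1 : s' ^ p = θ ^ p / a := by rw [hs', div_pow, hα]
  have e2 : s' ^ p ^ 2 = -(θ ^ p / (a ^ p * b)) * a := by
    rw [sq, pow_mul, e1, div_pow, ← pow_mul, ← sq]
    field_simp
    linear_combination h3
  have e3 : x ^ p = -(q ^ p / a ^ p) - a * θ ^ p / a ^ p + a ^ 2 * (θ ^ p) ^ 2 / (2 * b) := by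
    rw [hx, add_pow_char, sub_pow_char, hodd.neg_pow, div_pow, div_pow, div_pow, mul_pow, mul_pow,
      mul_pow, h2p, hβ, hα, ← pow_mul α, mul_comm 2 p, pow_mul, hα, ← pow_mul θ, mul_comm 2 p,
      pow_mul θ]
  rw [e2, e1, e3, hx, pow_succ, mul_comm 2 p, pow_mul θ, ← mul_pow α, hαβ]
  field_simp
  ring

namespace IsTotRamified

variable {p : ℕ} {A B κ : Type*} [CommRing A] [CommRing B] [IsDomain B] [Algebra A B] [Field κ]
  {ρ : A →+* κ} {r : B →+* κ} {ϖ : B} (H : IsTotRamified p ρ r ϖ)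

include H

theorem prime_dvd_of_map_eq_zero {x : A} (h : ρ x = 0) : (p : B) ∣ algebraMap A B x :=
  natCast_dvd_algebraMap ((H.ker _).1 h)

theorem prime_mul_uniformizer_dvd_iff (x : B) : (p : B) * ϖ ∣ x ↔ ϖ ^ (p ^ 2 + 1) ∣ x := by
  simpa using H.prime_mul_dvd_iff 1 x

theorem dvd_ramEq_iff {a b c θ : A} {g : ℕ → A} {s' q : B} {α β x : κ}
    (hα : α ^ p = ρ a) (hβ : β ^ p = ρ b) (ha : ρ a ≠ 0) (hb : ρ b ≠ 0)
    (hϖ : (p : B) * ϖ ∣ ϖ ^ p ^ 2 + p * algebraMap A B b)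
    (hc : b * θ ^ p ^ 2 + a * θ ^ p = p * c)
    (h4 : ρ (g (p + 1)) ^ p = -ρ a ^ (p + 1))
    (h5 : ∀ k ∈ Ico 3 p, ρ a ^ p * ρ (g (p * k)) = ρ b * ρ (g k) ^ p)
    (h6 : 2 * (ρ a ^ p * ρ (g (p * 2)) - ρ b * ρ (g 2) ^ p) = ρ a ^ (p + 1) * (ρ a - β))
    (hq : tailPart p ϖ (algebraMap A B a) (algebraMap A B ∘ g) (algebraMap A B θ + ϖ * s') s' =
      ϖ ^ p * q)
    (hx : x = -(r q / ρ a) - α * ρ θ / ρ a + α ^ 2 * ρ θ ^ 2 / (2 * β)) :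
    (p : B) * ϖ ∣ ramEq p ϖ (algebraMap A B a) (algebraMap A B b) (algebraMap A B ∘ g)
      (algebraMap A B θ + ϖ * s') ↔ ρ b * x ^ p + ρ a * x - ρ c - ρ (g 1) * ρ θ = 0 := by
  have := H.charP
  have := Fact.mk H.prime
  have hodd : Odd p := H.prime.odd_of_ne_two (by have := H.two_lt; omega)
  have h20 : (2 : κ) ≠ 0 := by
    have : ((2 : ℕ) : κ) ≠ 0 := by
      rw [Ne, CharP.cast_eq_zero_iff κ p]
      exact Nat.not_dvd_of_pos_of_lt (by omega) H.two_lt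
    simpa using this
  obtain ⟨β', rfl⟩ := H.surjective β
  have h3 : ρ b * ρ θ ^ p ^ 2 + ρ a * ρ θ ^ p = 0 := by
    have := congrArg ρ hc
    simpa [H.map_prime] using this
  have hgθ : ρ (g (p + 1)) * ρ θ = ρ a * ρ β' * ρ θ ^ p := by
    apply frobenius_inj κ p
    simp only [frobenius_def]
    rw [mul_pow, mul_pow, mul_pow, h4, hβ, pow_succ, ← pow_mul, ← sq]
    linear_combination -ρ a ^ p * h3
  let φ := Ideal.Quotient.mk (Ideal.span {(p : B) * ϖ})
  have hφ (x : B) : φ x = 0 ↔ (p : B) * ϖ ∣ x := by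
    rw [Ideal.Quotient.eq_zero_iff_mem, Ideal.mem_span_singleton]
  have hφd {x : A} (h : ρ x = 0) : (p : B ⧸ Ideal.span {(p : B) * ϖ}) ∣ φ (algebraMap A B x) := by
    simpa using map_dvd φ (H.prime_dvd_of_map_eq_zero (B := B) h)
  have key := two_mul_pow_mul_ramEq (ϖ := φ ϖ) (a := φ (algebraMap A B a))
    (b := φ (algebraMap A B b)) (c := φ (algebraMap A B c)) (θ := φ (algebraMap A B θ))
    (s' := φ s') (q := φ q) (β := φ (algebraMap A B β')) (g := φ ∘ algebraMap A B ∘ g) H.prime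
    H.two_lt (by rw [← map_natCast φ, ← map_mul, hφ])
    (by
      rw [← map_natCast φ, ← map_mul, ← map_pow, eq_neg_iff_add_eq_zero, ← map_add, hφ]
      exact hϖ)
    (by simpa using congrArg (fun x => φ (algebraMap A B x)) hc)
    (by
      have := hφd (x := g (p + 1) ^ p + a ^ (p + 1)) (by simp [h4])
      simpa using this)
    (fun k hk => by
      have := hφd (x := a ^ p * g (p * k) - b * g k ^ p) (by simp [h5 k hk])
      simpa using this)
    (by
      have := hφd (x := 2 * (a ^ p * g (p * 2) - b * g 2 ^ p) - a ^ (p + 1) * (a - β'))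
        (by simp [h6, map_ofNat ρ 2])
      simpa [map_ofNat (algebraMap A B) 2, map_ofNat φ 2] using this)
    (by
      have := hφd (x := g (p + 1) * θ - a * β' * θ ^ p) (by simp [hgθ])
      simpa using this)
    (by
      have := congrArg φ hq
      rw [map_tailPart] at this
      simpa using this)
  have hs : ρ a * ρ θ + ρ (g (p + 1)) * r s' = 0 := by
    have h1 := sq_dvd_tailPart_sub (ϖ := ϖ) (a := algebraMap A B a) (g := algebraMap A B ∘ g)
      H.prime H.two_lt (algebraMap A B θ) s'
    have h2 : ϖ ^ 2 ∣ ϖ ^ p * q := (pow_dvd_pow _ H.two_lt.le).mul_right _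
    rw [hq, dvd_sub_right h2, sq, mul_dvd_mul_iff_left H.ne_zero, ← H.dvd_iff] at h1
    simpa [H.map_algebraMap] using h1
  have id := residue_identity (c := ρ c) (g₁ := ρ (g 1)) H.two_lt hα hβ ha hb h3 h4 hs hx
  set E : B := 2 * algebraMap A B a ^ p *
    (algebraMap A B c + algebraMap A B (g 1) * algebraMap A B θ -
      algebraMap A B b ^ 2 * s' ^ p ^ 2) -
    2 * algebraMap A B a ^ (p + 1) * algebraMap A B β' * s' ^ p -
    algebraMap A B a ^ (p + 1) * (algebraMap A B a + algebraMap A B β') *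
    algebraMap A B θ ^ (2 * p) +
    2 * algebraMap A B a ^ p * q + 2 * algebraMap A B b * q ^ p with hE
  have hrE : r E = -(2 * ρ a ^ p) * (ρ b * x ^ p + ρ a * x - ρ c - ρ (g 1) * ρ θ) := by
    rw [← id, hE]
    simp [H.map_algebraMap, map_ofNat r 2]
  have hu : r (2 * algebraMap A B a ^ p) ≠ 0 := by
    simp [H.map_algebraMap, map_ofNat r 2, h20, ha]
  have key2 : φ (2 * algebraMap A B a ^ p * ramEq p ϖ (algebraMap A B a) (algebraMap A B b)
      (algebraMap A B ∘ g) (algebraMap A B θ + ϖ * s')) = φ (ϖ ^ p ^ 2 * E) := by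
    rw [map_mul, map_ramEq]
    simpa [hE, map_ofNat φ 2] using key
  rw [Ideal.Quotient.eq, Ideal.mem_span_singleton] at key2
  rw [← (H.isUnit _ hu).dvd_mul_left, dvd_iff_dvd_of_dvd_sub key2,
    H.prime_mul_uniformizer_dvd_iff, H.pow_succ_dvd_iff, hrE]
  simp [h20, ha]

end IsTotRamified

/-- The normalized coefficients of an Eisenstein polynomial satisfying the first two conditions. -/
structure IsNormalized (p : ℕ) {A κ : Type*} [CommRing A] [Field κ] (ρ : A →+* κ)
    (f : ℕ → A) (a b : A) (g : ℕ → A) : Prop where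
  apply_prime : f p = p * a
  apply_sq : f (p ^ 2) = p * b
  apply_of_ne : ∀ i, 1 ≤ i → i < p ^ 2 → i ≠ p → f i = p ^ 2 * g i
  map_eq_zero : ∀ i ∈ highIndices p, ρ (g i) = 0
  map_a_ne_zero : ρ a ≠ 0
  map_b_ne_zero : ρ b ≠ 0

namespace IsTotRamified

variable {p : ℕ} {A B κ : Type*} [CommRing A] [CommRing B] [IsDomain B] [Algebra A B] [Field κ]
  {ρ : A →+* κ} {r : B →+* κ} {ϖ : B} (H : IsTotRamified p ρ r ϖ) {f : ℕ → A} {a b : A}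
  {g : ℕ → A} (hf : IsNormalized p ρ f a b g)

include H

theorem dvd_add_pow_sub_pow {m : ℕ} (hm : p + 1 ≤ m) (w y : B) (k : ℕ) :
    (p : B) * ϖ ^ (m + 1) ∣ (w + ϖ ^ (m + 1) * y) ^ (p * k) - w ^ (p * k) := by
  have h1 : (p : B) * ϖ ^ (m + 1) ∣ (w + ϖ ^ (m + 1) * y) ^ p - w ^ p := by
    obtain ⟨x, hx⟩ := exists_add_pow_prime_eq H.prime w (ϖ ^ (m + 1) * y)
    rw [hx, show w ^ p + (ϖ ^ (m + 1) * y) ^ p + p * w * (ϖ ^ (m + 1) * y) * x - w ^ p =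
      (ϖ ^ (m + 1)) ^ p * y ^ p + p * ϖ ^ (m + 1) * (w * y * x) by ring]
    refine dvd_add (Dvd.dvd.mul_right ?_ _) (dvd_mul_right _ _)
    rw [H.prime_mul_dvd_iff, ← pow_mul]
    refine pow_dvd_pow _ ?_
    obtain ⟨q, rfl⟩ := Nat.exists_eq_add_of_le hm
    have := H.two_lt
    nlinarith [Nat.zero_le (q * p), Nat.mul_le_mul_left q this.le]
  rw [pow_mul, pow_mul]
  exact h1.trans (sub_dvd_pow_sub_pow _ _ _)

theorem dvd_add_pow_sub_pow_sq {m : ℕ} (hm : p + 1 ≤ m) (w y : B) :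
    (p : B) ^ 2 * ϖ ^ (m + 1) ∣ (w + ϖ ^ (m + 1) * y) ^ p ^ 2 - w ^ p ^ 2 := by
  obtain ⟨d, hd⟩ := H.dvd_add_pow_sub_pow hm w y 1
  rw [mul_one, sub_eq_iff_eq_add'] at hd
  obtain ⟨x, hx⟩ := exists_add_pow_prime_eq H.prime (w ^ p) (p * ϖ ^ (m + 1) * d)
  have h2 := H.two_lt
  rw [sq p, pow_mul, pow_mul, hd, hx, add_assoc, add_sub_cancel_left]
  refine dvd_add ?_ ⟨w ^ p * d * x, by ring⟩
  obtain ⟨q, rfl⟩ := Nat.exists_eq_add_of_lt h2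
  refine Dvd.intro (((2 + q + 1 : ℕ) : B) ^ (q + 1) * (ϖ ^ (m + 1)) ^ (q + 2) * d ^ (q + 3)) ?_
  ring

include hf

theorem dvd_shiftSum_add {m : ℕ} (hm : p + 1 ≤ m) {z : B} (hz : ϖ ^ m ∣ z) (s : B) :
    (p : B) ^ 2 * ϖ ^ (p ^ 2 - p + m + 1) ∣ shiftSum p ϖ (algebraMap A B ∘ f) (s + z) -
      shiftSum p ϖ (algebraMap A B ∘ f) s -
      p ^ 2 * (algebraMap A B (g (p + 1)) * ϖ ^ (p ^ 2 - p) * z) := by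
  have hp2 := H.two_lt
  have h1 : p + 2 ≤ p ^ 2 := by nlinarith
  obtain ⟨y, rfl⟩ := hz
  set w := 1 + ϖ * s with hw
  have hw' : 1 + ϖ * (s + ϖ ^ m * y) = w + ϖ ^ (m + 1) * y := by rw [hw]; ring
  have hp1 (j : ℕ) (hj : p ^ 2 - p + m + 1 ≤ p ^ 2 + j) :
      ϖ ^ (p ^ 2 - p + m + 1) ∣ (p : B) * ϖ ^ j := by
    refine (pow_dvd_pow _ hj).trans ?_
    rw [← H.prime_mul_dvd_iff]
  have hd (i : ℕ) : ϖ ^ (m + 1) ∣ (w + ϖ ^ (m + 1) * y) ^ i - w ^ i := by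
    have := sub_dvd_pow_sub_pow (w + ϖ ^ (m + 1) * y) w i
    rw [add_sub_cancel_left] at this
    exact (dvd_mul_right _ _).trans this
  rw [shiftSum, shiftSum, ← sum_sub_distrib, sum_Icc_sq hp2, hw']
  simp only [← mul_sub, sub_sub_sub_cancel_right, Function.comp_apply]
  have e1 : (p : B) ^ 2 * ϖ ^ (p ^ 2 - p + m + 1) ∣ ∑ l ∈ Ico 1 p, algebraMap A B (f l) *
      ϖ ^ (p ^ 2 - l) * ((w + ϖ ^ (m + 1) * y) ^ l - w ^ l) := by
    refine dvd_sum fun l hl => ?_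
    rw [mem_Ico] at hl
    rw [hf.apply_of_ne l hl.1 (by omega) (by omega), map_mul, map_pow, map_natCast, mul_assoc,
      mul_assoc]
    refine mul_dvd_mul_left _ (Dvd.dvd.mul_left ?_ _)
    refine (pow_dvd_pow ϖ (show _ ≤ p ^ 2 - l + (m + 1) by omega)).trans ?_
    rw [pow_add]
    exact mul_dvd_mul_left _ (hd l)
  have e2 : (p : B) ^ 2 * ϖ ^ (p ^ 2 - p + m + 1) ∣ algebraMap A B (f p) *
      ϖ ^ (p ^ 2 - p) * ((w + ϖ ^ (m + 1) * y) ^ p - w ^ p) := by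
    obtain ⟨x, hx⟩ := H.dvd_add_pow_sub_pow hm w y 1
    rw [mul_one] at hx
    rw [hx, hf.apply_prime]
    refine ⟨algebraMap A B a * x, ?_⟩
    rw [map_mul, map_natCast]
    ring
  have e3 : (p : B) ^ 2 * ϖ ^ (p ^ 2 - p + m + 1) ∣ algebraMap A B (f (p + 1)) *
      ϖ ^ (p ^ 2 - (p + 1)) * ((w + ϖ ^ (m + 1) * y) ^ (p + 1) - w ^ (p + 1)) -
      p ^ 2 * (algebraMap A B (g (p + 1)) * ϖ ^ (p ^ 2 - p) * (ϖ ^ m * y)) := by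
    obtain ⟨x, hx⟩ := powAddExpansion w (ϖ ^ (m + 1) * y) (p + 1)
    rw [hf.apply_of_ne (p + 1) (by omega) (by omega) (by omega), hx, map_mul, map_pow, map_natCast]
    obtain ⟨e, he⟩ : ϖ ∣ (p + 1) * w ^ p - 1 := by
      rw [← H.dvd_iff]
      have : r p = 0 := by
        rw [← map_natCast (algebraMap A B), H.map_algebraMap, H.map_prime]
      simp [hw, this, H.map_uniformizer]
    have e5 : ϖ ^ (p ^ 2 - p) = ϖ ^ (p ^ 2 - (p + 1)) * ϖ := by
      rw [← pow_succ]; congr 1; omega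
    refine ⟨algebraMap A B (g (p + 1)) * (e * y + ϖ ^ m * y ^ 2 * x), ?_⟩
    simp only [Nat.add_sub_cancel]
    push_cast
    rw [add_assoc (p ^ 2 - p), pow_add ϖ (p ^ 2 - p) (m + 1), e5, pow_succ ϖ m]
    linear_combination (p ^ 2 * algebraMap A B (g (p + 1)) * ϖ ^ (p ^ 2 - (p + 1)) *
      (ϖ ^ m * ϖ * y)) * he
  have e4 : (p : B) ^ 2 * ϖ ^ (p ^ 2 - p + m + 1) ∣ ∑ k ∈ Ico 2 p, algebraMap A B (f (p * k)) *
      ϖ ^ (p ^ 2 - p * k) * ((w + ϖ ^ (m + 1) * y) ^ (p * k) - w ^ (p * k)) := by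
    refine dvd_sum fun k hk => ?_
    rw [mem_Ico] at hk
    rw [hf.apply_of_ne (p * k) (by nlinarith) (by nlinarith) (by nlinarith), map_mul, map_pow,
      map_natCast, mul_assoc, mul_assoc]
    refine mul_dvd_mul_left _ (Dvd.dvd.mul_left (Dvd.dvd.mul_left ?_ _) _)
    exact (hp1 (m + 1) (by omega)).trans (H.dvd_add_pow_sub_pow hm w y k)
  have e5 : (p : B) ^ 2 * ϖ ^ (p ^ 2 - p + m + 1) ∣ algebraMap A B (f (p ^ 2)) *
      ϖ ^ (p ^ 2 - p ^ 2) * ((w + ϖ ^ (m + 1) * y) ^ p ^ 2 - w ^ p ^ 2) := by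
    obtain ⟨x, hx⟩ := H.dvd_add_pow_sub_pow_sq hm w y
    rw [hf.apply_sq, hx, map_mul, map_natCast, Nat.sub_self, pow_zero]
    obtain ⟨v, hv⟩ := hp1 (m + 1) (by omega)
    refine ⟨algebraMap A B b * v * x, ?_⟩
    linear_combination p ^ 2 * algebraMap A B b * x * hv
  have e6 : (p : B) ^ 2 * ϖ ^ (p ^ 2 - p + m + 1) ∣ ∑ i ∈ highIndices p, algebraMap A B (f i) *
      ϖ ^ (p ^ 2 - i) * ((w + ϖ ^ (m + 1) * y) ^ i - w ^ i) := by
    refine dvd_sum fun i hi => ?_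
    have h2 := H.prime_dvd_of_map_eq_zero (B := B) (hf.map_eq_zero i hi)
    rw [mem_highIndices] at hi
    rw [hf.apply_of_ne i (by omega) (by omega) (by omega), map_mul, map_pow,
      map_natCast, mul_assoc, mul_assoc]
    refine mul_dvd_mul_left _ ((hp1 (m + 1) (by omega)).trans ?_)
    exact mul_dvd_mul h2 (Dvd.dvd.mul_left (hd i) _)
  convert dvd_add (dvd_add (dvd_add (dvd_add (dvd_add e1 e2) e3) e4) e5) e6 using 1
  ring

end IsTotRamified

theorem sub_dvd_shiftSum_sub {R : Type*} [CommRing R] (p : ℕ) (ϖ : R) (f : ℕ → R) (s t : R) :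
    s - t ∣ shiftSum p ϖ f s - shiftSum p ϖ f t := by
  rw [shiftSum, shiftSum, ← sum_sub_distrib]
  refine dvd_sum fun i _ => ?_
  have := sub_dvd_pow_sub_pow (1 + ϖ * s) (1 + ϖ * t) i
  rw [show 1 + ϖ * s - (1 + ϖ * t) = ϖ * (s - t) by ring] at this
  rw [← mul_sub, sub_sub_sub_cancel_right]
  exact ((dvd_mul_left _ _).trans this).mul_left _

namespace IsTotRamified

variable {p : ℕ} {A B κ : Type*} [CommRing A] [CommRing B] [IsDomain B] [Algebra A B] [Field κ]
  {ρ : A →+* κ} {r : B →+* κ} {ϖ : B} (H : IsTotRamified p ρ r ϖ) {f : ℕ → A} {a b : A}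
  {g : ℕ → A}

include H

theorem exists_mul_eq_one {x : A} (hx : ρ x ≠ 0) : ∃ u : B, algebraMap A B x * u = 1 :=
  (H.isUnit (algebraMap A B x) (by rwa [H.map_algebraMap])).exists_right_inv

theorem exists_tailPart_eq (hg : ρ (g (p + 1)) ≠ 0) (θ : A) (y : B) :
    ∃ s' q : B, r q = r y ∧ tailPart p ϖ (algebraMap A B a) (algebraMap A B ∘ g)
      (algebraMap A B θ + ϖ * s') s' = ϖ ^ p * q := by
  obtain ⟨u, hu⟩ := H.exists_mul_eq_one (B := B) hg
  have key (m : ℕ) : ∃ s' : B, ϖ ^ (m + 1) ∣ tailPart p ϖ (algebraMap A B a) (algebraMap A B ∘ g)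
      (algebraMap A B θ + ϖ * s') s' - ϖ ^ p * y := by
    induction m with
    | zero =>
      obtain ⟨w, hw⟩ := sq_dvd_tailPart_sub (a := algebraMap A B a) (ϖ := ϖ)
        (g := algebraMap A B ∘ g) H.prime H.two_lt (algebraMap A B θ) 0
      refine ⟨0, ?_⟩
      rw [sub_eq_iff_eq_add] at hw
      rw [hw, zero_add, pow_one]
      refine dvd_sub (dvd_add ⟨ϖ * w, by ring⟩ (dvd_mul_right _ _)) ?_
      exact (dvd_pow_self _ H.prime.ne_zero).mul_right _
    | succ m ih =>
      obtain ⟨s', w, hw⟩ := ih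
      obtain ⟨v, hv⟩ := dvd_tailPart_sub (a := algebraMap A B a) (ϖ := ϖ)
        (g := algebraMap A B ∘ g) H.two_lt (algebraMap A B θ) s' (-(ϖ ^ m * w * u))
      refine ⟨s' + -(ϖ ^ m * w * u), -(w * u * v), ?_⟩
      rw [Function.comp_apply] at hv
      linear_combination hv + hw - ϖ ^ (m + 1) * w * hu
  obtain ⟨s', w, hw⟩ := key p
  refine ⟨s', y + ϖ * w, by simp [H.map_uniformizer], ?_⟩
  linear_combination hw

theorem exists_shiftSum_eq_zero_of_dvd (hf : IsNormalized p ρ f a b g) (hg : ρ (g (p + 1)) ≠ 0)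
    (hcomp : ∀ s : ℕ → B, (∀ m, ϖ ^ m ∣ s (m + 1) - s m) → ∃ x, ∀ m, ϖ ^ m ∣ x - s m) {s₀ : B}
    (hs : (p : B) ^ 3 * ϖ ∣ shiftSum p ϖ (algebraMap A B ∘ f) s₀) :
    ∃ s, shiftSum p ϖ (algebraMap A B ∘ f) s = 0 ∧ r s = r s₀ := by
  have hp2 := H.two_lt
  have h1 : p + 2 ≤ p ^ 2 := by nlinarith
  obtain ⟨u, hu⟩ := H.exists_mul_eq_one (B := B) hg
  have key (m : ℕ) (s : B) : ∃ t : B,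
      (p : B) ^ 2 * ϖ ^ (p ^ 2 - p + (p + 1 + m)) ∣ shiftSum p ϖ (algebraMap A B ∘ f) s →
      (p : B) ^ 2 * ϖ ^ (p ^ 2 - p + (p + 1 + (m + 1))) ∣ shiftSum p ϖ (algebraMap A B ∘ f) t ∧
        ϖ ^ (m + 1) ∣ t - s := by
    by_cases hs : (p : B) ^ 2 * ϖ ^ (p ^ 2 - p + (p + 1 + m)) ∣ shiftSum p ϖ (algebraMap A B ∘ f) s
    swap
    · exact ⟨0, fun h => absurd h hs⟩
    obtain ⟨y, hy⟩ := hs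
    have hz : ϖ ^ (p + 1 + m) ∣ -(ϖ ^ (p + 1 + m) * y * u) := ⟨-(y * u), by ring⟩
    obtain ⟨v, hv⟩ := H.dvd_shiftSum_add hf (le_add_right le_rfl) hz s
    refine ⟨s + -(ϖ ^ (p + 1 + m) * y * u), fun _ => ⟨⟨v, ?_⟩, ?_⟩⟩
    · rw [show p ^ 2 - p + (p + 1 + (m + 1)) = p ^ 2 - p + (p + 1 + m) + 1 by ring]
      rw [pow_add ϖ (p ^ 2 - p)] at hy
      linear_combination hv + hy - p ^ 2 * ϖ ^ (p ^ 2 - p) * ϖ ^ (p + 1 + m) * y * hu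
    · rw [add_sub_cancel_left]
      exact (pow_dvd_pow _ (by omega)).trans hz
  choose F hF using key
  let S (m : ℕ) : B := Nat.rec s₀ F m
  have hS (m : ℕ) : (p : B) ^ 2 * ϖ ^ (p ^ 2 - p + (p + 1 + m)) ∣
      shiftSum p ϖ (algebraMap A B ∘ f) (S m) := by
    induction m with
    | zero =>
      change _ ∣ shiftSum p ϖ _ s₀
      rw [show p ^ 2 - p + (p + 1 + 0) = p ^ 2 + 1 by omega]
      refine (mul_dvd_mul_left _ ((H.prime_mul_dvd_iff 1 _).1 dvd_rfl)).trans ?_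
      convert hs using 1
      ring
    | succ m ih => exact (hF m (S m) ih).1
  have hS' (m : ℕ) : ϖ ^ (m + 1) ∣ S (m + 1) - S m := (hF m (S m) (hS m)).2
  obtain ⟨x, hx⟩ := hcomp S fun m => (pow_dvd_pow _ (by omega)).trans (hS' m)
  refine ⟨x, H.eq_zero_of_forall_dvd fun m => ?_, ?_⟩
  · have h2 := (hx m).trans (sub_dvd_shiftSum_sub p ϖ (algebraMap A B ∘ f) x (S m))
    refine (dvd_iff_dvd_of_dvd_sub h2).2 ?_
    exact ((pow_dvd_pow _ (by omega)).trans (dvd_mul_left _ _)).trans (hS m)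
  · have h2 := dvd_add (hx 1) (by simpa using hS' 0 : ϖ ^ 1 ∣ S 1 - S 0)
    rw [sub_add_sub_cancel, pow_one, ← H.dvd_iff, map_sub, sub_eq_zero] at h2
    exact h2

theorem exists_shiftSum_eq_zero (hf : IsNormalized p ρ f a b g)
    (hcomp : ∀ s : ℕ → B, (∀ m, ϖ ^ m ∣ s (m + 1) - s m) → ∃ x, ∀ m, ϖ ^ m ∣ x - s m)
    (hϖ : ϖ ^ p ^ 2 = -∑ i ∈ Icc 1 (p ^ 2), algebraMap A B (f i) * ϖ ^ (p ^ 2 - i))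
    (hfp : ∀ i, 1 ≤ i → i ≤ p ^ 2 → (p : A) ∣ f i) {c θ : A} {α β x : κ} (hα : α ^ p = ρ a)
    (hβ : β ^ p = ρ b) (hc : b * θ ^ p ^ 2 + a * θ ^ p = p * c)
    (h4 : ρ (g (p + 1)) ^ p = -ρ a ^ (p + 1))
    (h5 : ∀ k ∈ Ico 3 p, ρ a ^ p * ρ (g (p * k)) = ρ b * ρ (g k) ^ p)
    (h6 : 2 * (ρ a ^ p * ρ (g (p * 2)) - ρ b * ρ (g 2) ^ p) = ρ a ^ (p + 1) * (ρ a - β))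
    (hx : ρ b * x ^ p + ρ a * x - ρ c - ρ (g 1) * ρ θ = 0) :
    ∃ s, shiftSum p ϖ (algebraMap A B ∘ f) s = 0 ∧ r s = ρ θ := by
  have ha := hf.map_a_ne_zero
  have hg : ρ (g (p + 1)) ≠ 0 := by
    intro h
    rw [h, zero_pow H.prime.ne_zero, eq_comm, neg_eq_zero] at h4
    exact ha (eq_zero_of_pow_eq_zero h4)
  obtain ⟨y, hy⟩ := H.surjective (ρ a * (-x - α * ρ θ / ρ a + α ^ 2 * ρ θ ^ 2 / (2 * β)))
  obtain ⟨s', q, hq, hq'⟩ := H.exists_tailPart_eq (B := B) (a := a) hg θ (algebraMap A B y)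
  have hϖ' := dvd_pow_add_mul (b := algebraMap A B b) (f := algebraMap A B ∘ f) H.two_lt hϖ
    (fun i hi => natCast_dvd_algebraMap (hfp i (mem_Icc.1 hi).1 (mem_Icc.1 hi).2))
    (by simp [hf.apply_sq])
  have h7 := (H.dvd_ramEq_iff (x := x) hα hβ ha hf.map_b_ne_zero hϖ' hc h4 h5 h6 hq' (by
    rw [hq, H.map_algebraMap, hy]
    field_simp
    ring)).2 hx
  obtain ⟨s, hs, hs'⟩ := H.exists_shiftSum_eq_zero_of_dvd hf hg hcomp
    (s₀ := algebraMap A B θ + ϖ * s') <| by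
    refine (dvd_iff_dvd_of_dvd_sub (dvd_shiftSum_sub (a := algebraMap A B a)
      (b := algebraMap A B b) (g := algebraMap A B ∘ g) H.prime H.two_lt hϖ ?_ ?_ ?_ ?_ _)).2 ?_
    · simp [hf.apply_prime]
    · simp [hf.apply_sq]
    · intro i h1 h2 h3
      simp [hf.apply_of_ne i h1 h2 h3]
    · exact fun i hi => H.prime_dvd_of_map_eq_zero (hf.map_eq_zero i hi)
    · convert mul_dvd_mul_left ((p : B) ^ 2) h7 using 1
      ring
  exact ⟨s, hs, by simp [hs', H.map_algebraMap, H.map_uniformizer]⟩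

end IsTotRamified

namespace IsTotRamified

variable {p : ℕ} {A B κ : Type*} [CommRing A] [CommRing B] [IsDomain B] [Algebra A B] [Field κ]
  {ρ : A →+* κ} {r : B →+* κ} {ϖ : B} (H : IsTotRamified p ρ r ϖ) {f : ℕ → A} {a b : A}
  {g : ℕ → A}

include H

theorem prime_mul_dvd_sum_of_shiftSum_eq_zero {c : ℕ → A} {s : B}
    (hs : shiftSum p ϖ (algebraMap A B ∘ f) s = 0)
    (hlow : ∀ i, 1 ≤ i → i < p ^ 2 → ¬p ∣ i → (p : A) ^ 2 ∣ f i)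
    (hc : ∀ k, 1 ≤ k → k ≤ p → f (p * k) = p * c k) :
    (p : B) * ϖ ∣ ∑ k ∈ Ico 2 p, algebraMap A B (c k) * ϖ ^ (p * (p - k)) *
      ((1 + ϖ ^ p * s ^ p) ^ k - 1) +
      ϖ ^ p ^ 2 * (algebraMap A B (c 1) * s ^ p + algebraMap A B (c p) * s ^ p ^ 2) := by
  have hp2 := H.two_lt
  have h1 : p + 2 ≤ p ^ 2 := by nlinarith
  have h0 := H.natCast_ne_zero
  have hndvd (i : ℕ) (h0 : 0 < i) (hi : i < p) : ¬p ∣ i := Nat.not_dvd_of_pos_of_lt h0 hi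
  obtain ⟨y, hy⟩ := one_add_pow_mul_prime (ϖ := ϖ) H.prime s
  choose z hz using hy
  have hlow' (i : ℕ) (h1 : 1 ≤ i) (h2 : i < p ^ 2) (h3 : ¬p ∣ i) :
      (p : B) ^ 2 * ϖ ∣ algebraMap A B (f i) * ϖ ^ (p ^ 2 - i) * ((1 + ϖ * s) ^ i - 1) := by
    have h4 : (p : B) ^ 2 ∣ algebraMap A B (f i) := by
      simpa using map_dvd (algebraMap A B) (hlow i h1 h2 h3)
    exact (mul_dvd_mul h4 (pow_sub_mul_dvd h2)).mul_right _
  have hmul (k : ℕ) (h1 : 1 ≤ k) (h2 : k ≤ p) :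
      (p : B) ^ 2 * ϖ ∣ algebraMap A B (f (p * k)) * ϖ ^ (p ^ 2 - p * k) *
        ((1 + ϖ * s) ^ (p * k) - 1) - p * (algebraMap A B (c k) * ϖ ^ (p * (p - k)) *
          ((1 + ϖ ^ p * s ^ p) ^ k - 1)) := by
    rw [(hz k).2.1, hc k h1 h2, sq p, ← Nat.mul_sub, map_mul, map_natCast]
    exact ⟨algebraMap A B (c k) * ϖ ^ (p * (p - k)) * z k, by ring⟩
  have hp' : (p : B) ^ 2 * ϖ ∣ algebraMap A B (f (p ^ 2)) * ϖ ^ (p ^ 2 - p ^ 2) *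
        ((1 + ϖ * s) ^ p ^ 2 - 1) - p * (algebraMap A B (c p) * (ϖ ^ p ^ 2 * s ^ p ^ 2)) := by
    obtain ⟨w, hw⟩ := exists_add_pow_prime_eq H.prime 1 (ϖ ^ p * s ^ p)
    have h2 := hmul p H.prime.one_lt.le le_rfl
    rw [hw, ← sq, one_pow, Nat.sub_self p, mul_zero, pow_zero, mul_pow, ← pow_mul, ← pow_mul, ← sq]
      at h2
    obtain ⟨v, hv⟩ := dvd_pow_self ϖ H.prime.ne_zero
    refine (dvd_iff_dvd_of_dvd_sub ?_).1 h2
    refine ⟨-(algebraMap A B (c p) * ϖ ^ (p - 1) * s ^ p * w), ?_⟩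
    have h3 : ϖ ^ p = ϖ ^ (p - 1) * ϖ := by rw [← pow_succ]; congr 1; omega
    rw [h3]
    ring
  rw [shiftSum, sum_Icc_sq hp2] at hs
  simp only [Function.comp_apply] at hs
  rw [← mul_dvd_mul_iff_left h0, ← mul_assoc, ← sq]
  have e1 := dvd_sum fun i (hi : i ∈ Ico 1 p) => hlow' i (mem_Ico.1 hi).1
    (by have := mem_Ico.1 hi; omega) (hndvd i (mem_Ico.1 hi).1 (mem_Ico.1 hi).2)
  have e2 := hmul 1 le_rfl H.prime.one_lt.le
  have e3 := hlow' (p + 1) (by omega) (by omega) (by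
    rw [Nat.dvd_add_right dvd_rfl]; exact H.prime.not_dvd_one)
  have e4 := dvd_sum fun i (hi : i ∈ Ico 2 p) => hmul i (by have := mem_Ico.1 hi; omega)
    (mem_Ico.1 hi).2.le
  have e5 := dvd_sum fun i (hi : i ∈ highIndices p) => hlow' i
    (by have := mem_highIndices.1 hi; omega) (mem_highIndices.1 hi).2.1 (mem_highIndices.1 hi).2.2
  have h6 := dvd_add (dvd_add (dvd_add (dvd_add (dvd_add e1 e2) e3) e4) hp') e5
  rw [sum_sub_distrib, ← mul_sum, mul_one, pow_one, add_sub_cancel_left] at h6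
  rw [← dvd_neg]
  convert h6 using 1
  have h7 : ϖ ^ p ^ 2 = ϖ ^ (p * (p - 1)) * ϖ ^ p := by
    rw [← pow_add]; congr 1; obtain ⟨q, rfl⟩ := Nat.exists_eq_add_of_lt hp2; simp; ring
  rw [h7]
  linear_combination -hs

theorem sq_dvd_of_shiftSum_eq_zero {s : B} (hs : shiftSum p ϖ (algebraMap A B ∘ f) s = 0)
    (hs0 : r s ≠ 0) (hfp : ∀ i, 1 ≤ i → i ≤ p ^ 2 → (p : A) ∣ f i)
    (hf : ¬(p : A) ^ 2 ∣ f (p ^ 2))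
    (hlow : ∀ i, 1 ≤ i → i < p ^ 2 → ¬p ∣ i → (p : A) ^ 2 ∣ f i) :
    (∀ k, 2 ≤ k → k < p → (p : A) ^ 2 ∣ f (p * k)) ∧ ∀ a, f p = p * a → ρ a ≠ 0 := by
  have hp2 := H.two_lt
  choose! c hc using fun k (hk : 1 ≤ k ∧ k ≤ p) => hfp (p * k) (by nlinarith) (by nlinarith)
  have h1 := H.prime_mul_dvd_sum_of_shiftSum_eq_zero hs hlow fun k h1 h2 => hc k ⟨h1, h2⟩
  rw [H.prime_mul_uniformizer_dvd_iff] at h1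
  have hn : p ^ 2 = p * (p - 2) + p + p := by
    obtain ⟨q, rfl⟩ := Nat.exists_eq_add_of_lt hp2
    rw [show 2 + q + 1 - 2 = q + 1 by omega]
    ring
  have hy : r (s ^ p) ≠ 0 := by rw [map_pow]; exact pow_ne_zero _ hs0
  have h2 : ∀ k, 2 ≤ k → k < p → (p : A) ∣ c k := by
    refine H.prime_dvd_of_sum one_le_two hy ?_
    have h3 := (pow_dvd_pow ϖ (show p * (p - 2) + p + 1 ≤ p ^ 2 + 1 by omega)).trans h1
    refine (dvd_add_left (Dvd.dvd.mul_right (pow_dvd_pow ϖ ?_) _)).1 h3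
    omega
  have h3 : ϖ ^ (p ^ 2 + 1) ∣ ∑ k ∈ Ico 2 p, algebraMap A B (c k) * ϖ ^ (p * (p - k)) *
      ((1 + ϖ ^ p * s ^ p) ^ k - 1) := by
    refine dvd_sum fun k hk => ?_
    rw [mem_Ico] at hk
    rw [pow_succ, mul_assoc]
    refine mul_dvd_mul ((H.prime_dvd_iff _).1 (natCast_dvd_algebraMap (h2 k hk.1 hk.2))) ?_
    exact (dvd_pow_self _ (Nat.mul_ne_zero (by omega) (by omega))).mul_right _
  rw [dvd_add_right h3, H.pow_succ_dvd_iff] at h1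
  refine ⟨fun k hk hkp => ?_, fun a ha ha0 => ?_⟩
  · rw [hc k ⟨by omega, hkp.le⟩, sq]
    exact mul_dvd_mul_left _ (h2 k hk hkp)
  · have h4 : ρ (c 1) = 0 := by
      have h5 := hc 1 ⟨le_rfl, H.prime.one_lt.le⟩
      rw [mul_one, ha] at h5
      have h6 := congrArg (algebraMap A B) h5
      rw [map_mul, map_mul, map_natCast, mul_right_inj' H.natCast_ne_zero] at h6
      rw [← H.map_algebraMap, ← h6, H.map_algebraMap, ha0]
    simp only [map_add, map_mul, map_pow, H.map_algebraMap, h4, zero_mul, zero_add] at h1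
    rw [mul_eq_zero, or_iff_left (pow_ne_zero _ hs0), H.ker] at h1
    refine hf ?_
    have h5 := hc p ⟨H.prime.one_lt.le, le_rfl⟩
    rw [← sq] at h5
    rw [h5, sq]
    exact mul_dvd_mul_left _ h1


theorem prime_mul_uniformizer_dvd_ramEq (hf : IsNormalized p ρ f a b g)
    (hϖ : ϖ ^ p ^ 2 = -∑ i ∈ Icc 1 (p ^ 2), algebraMap A B (f i) * ϖ ^ (p ^ 2 - i)) (s : B) :
    (p : B) * ϖ ∣ ramEq p ϖ (algebraMap A B a) (algebraMap A B b) (algebraMap A B ∘ g) s ↔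
      (p : B) ^ 3 * ϖ ∣ shiftSum p ϖ (algebraMap A B ∘ f) s := by
  rw [dvd_iff_dvd_of_dvd_sub (dvd_shiftSum_sub (f := algebraMap A B ∘ f) (a := algebraMap A B a)
    (b := algebraMap A B b) (g := algebraMap A B ∘ g) H.prime H.two_lt hϖ ?_ ?_ ?_ ?_ s),
    ← mul_dvd_mul_iff_left (pow_ne_zero 2 H.natCast_ne_zero), ← mul_assoc, ← pow_succ]
  · simp [hf.apply_prime]
  · simp [hf.apply_sq]
  · intro i h1 h2 h3
    simp [hf.apply_of_ne i h1 h2 h3]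
  · exact fun i hi => H.prime_dvd_of_map_eq_zero (hf.map_eq_zero i hi)

theorem map_ramEq_eq (s : B) :
    r (ramEq p ϖ (algebraMap A B a) (algebraMap A B b) (algebraMap A B ∘ g) s) =
      -ρ b * (ρ b * r s ^ p ^ 2 + ρ a * r s ^ p) := by
  have h0 : truncLog p (0 : κ) = 0 := zero_dvd_iff.1 (dvd_truncLog _)
  have h1 : p * (p - 1) ≠ 0 := Nat.mul_ne_zero H.prime.ne_zero (by have := H.two_lt; omega)
  have h2 := H.prime.ne_zero
  rw [map_ramEq, ramEq, H.map_uniformizer]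
  simp [H.map_algebraMap, h0, h1, h2]

/-- Elements of `A` and truncated logarithms of `p`-th powers are `p`-th powers modulo `p`. -/
theorem exists_prime_dvd_frobPart_sub (hperf : ∀ x : κ, ∃ y, y ^ p = x) (s s' : B) (c : A) :
    ∃ y, (p : B) ∣ frobPart p ϖ (algebraMap A B a) (algebraMap A B b) (algebraMap A B ∘ g) s s' +
      ϖ ^ (p * (p - 1)) * algebraMap A B c - y ^ p := by
  have := Fact.mk H.prime
  have hp : (p : B) ∈ nonunits B := by
    intro h
    have := h.map r
    rw [map_natCast, ← map_natCast ρ, H.map_prime] at this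
    simp at this
  have : CharP (B ⧸ Ideal.span {(p : B)}) p := CharP.quotient B p hp
  let φ := Ideal.Quotient.mk (Ideal.span {(p : B)})
  let S := (frobenius (B ⧸ Ideal.span {(p : B)}) p).range
  have hS (x : B) : φ x ∈ S ↔ ∃ y, (p : B) ∣ x - y ^ p := by
    constructor
    · rintro ⟨y, hy⟩
      obtain ⟨y, rfl⟩ := Ideal.Quotient.mk_surjective y
      refine ⟨y, ?_⟩
      rw [frobenius_def, ← map_pow, eq_comm, Ideal.Quotient.eq, Ideal.mem_span_singleton] at hy
      exact hy
    · rintro ⟨y, hy⟩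
      refine ⟨φ y, ?_⟩
      rw [frobenius_def, ← map_pow, eq_comm, Ideal.Quotient.eq, Ideal.mem_span_singleton]
      exact hy
  have hA (x : A) : φ (algebraMap A B x) ∈ S := by
    obtain ⟨y, hy⟩ := hperf (ρ x)
    obtain ⟨y, rfl⟩ := H.surjective y
    refine (hS _).2 ⟨algebraMap A B y, ?_⟩
    rw [← map_pow, ← map_sub]
    exact H.prime_dvd_of_map_eq_zero (by simp [hy])
  have hpow (x : B ⧸ Ideal.span {(p : B)}) : x ^ p ∈ S := ⟨x, rfl⟩
  have hlog (x : B ⧸ Ideal.span {(p : B)}) : truncLog p (x ^ p) ∈ S :=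
    ⟨truncLog p x, by rw [map_truncLog, frobenius_def]⟩
  rw [← hS, map_add, map_frobPart, frobPart, map_mul, map_pow, pow_mul, ← mul_pow]
  refine add_mem (add_mem (add_mem (neg_mem ?_) ?_) (sum_mem fun k _ => ?_)) ?_
  · exact mul_mem (mul_mem (mul_mem (hA _) (hA _)) (hpow _)) (hpow _)
  · exact mul_mem (hA _) (hlog _)
  · rw [pow_mul]
    exact mul_mem (mul_mem (hA _) (pow_mem (hpow _) _))
      (sub_mem (pow_mem (add_mem (one_mem _) (hpow _)) _) (one_mem _))
  · exact mul_mem (pow_mem (hpow _) _) (hA _)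


theorem dvd_frobPart_and_dvd_tailPart (hperf : ∀ x : κ, ∃ y, y ^ p = x) {c θ : A} {s' : B}
    (hϖ : (p : B) * ϖ ∣ ϖ ^ p ^ 2 + p * algebraMap A B b)
    (hc : b * θ ^ p ^ 2 + a * θ ^ p = p * c)
    (h : (p : B) * ϖ ∣ ramEq p ϖ (algebraMap A B a) (algebraMap A B b) (algebraMap A B ∘ g)
      (algebraMap A B θ + ϖ * s')) :
    ϖ ^ p ^ 2 ∣ frobPart p ϖ (algebraMap A B a) (algebraMap A B b) (algebraMap A B ∘ g)
      (algebraMap A B θ + ϖ * s') s' + ϖ ^ (p * (p - 1)) * algebraMap A B (g (p + 1) * θ) ∧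
    ϖ ^ p ∣ tailPart p ϖ (algebraMap A B a) (algebraMap A B ∘ g)
      (algebraMap A B θ + ϖ * s') s' := by
  have hp2 := H.two_lt
  have hn : p ^ 2 = p * (p - 1) + p := by
    obtain ⟨q, rfl⟩ := Nat.exists_eq_add_of_lt hp2
    rw [show 2 + q + 1 - 1 = q + 2 by omega]
    ring
  set M := frobPart p ϖ (algebraMap A B a) (algebraMap A B b) (algebraMap A B ∘ g)
    (algebraMap A B θ + ϖ * s') s' + ϖ ^ (p * (p - 1)) * algebraMap A B (g (p + 1) * θ) with hM
  set Q := tailPart p ϖ (algebraMap A B a) (algebraMap A B ∘ g) (algebraMap A B θ + ϖ * s') s'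
    with hQ
  let φ := Ideal.Quotient.mk (Ideal.span {(p : B) * ϖ})
  have hφ (x : B) : φ x = 0 ↔ (p : B) * ϖ ∣ x := by
    rw [Ideal.Quotient.eq_zero_iff_mem, Ideal.mem_span_singleton]
  have key := ramEq_eq (ϖ := φ ϖ) (a := φ (algebraMap A B a)) (b := φ (algebraMap A B b))
    (c := φ (algebraMap A B c)) (θ := φ (algebraMap A B θ)) (s' := φ s')
    (g := φ ∘ algebraMap A B ∘ g) H.prime (by rw [← map_natCast φ, ← map_mul, hφ])
    (by
      rw [← map_natCast φ, ← map_mul, ← map_pow, eq_neg_iff_add_eq_zero, ← map_add, hφ]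
      exact hϖ)
    (by simpa using congrArg (fun x => φ (algebraMap A B x)) hc)
  rw [← map_mul, ← map_add, ← map_ramEq, ← map_frobPart, ← map_tailPart, (hφ _).2 h] at key
  have h1 : ϖ ^ p ^ 2 ∣ M + ϖ ^ (p * (p - 1)) * Q := by
    set E := algebraMap A B c + algebraMap A B (g 1) * algebraMap A B θ -
      algebraMap A B b ^ 2 * s' ^ p ^ 2 - algebraMap A B a ^ 2 * s' ^ p
    have h2 : φ (ϖ ^ p ^ 2 * E + (M + ϖ ^ (p * (p - 1)) * Q)) = 0 := by
      rw [key]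
      simp only [E, hM, map_add, map_sub, map_mul, map_pow, Function.comp_apply]
      ring
    rw [hφ] at h2
    have h3 := (H.prime_dvd_iff _).1 ((dvd_mul_right _ _).trans h2)
    exact (dvd_add_right (dvd_mul_right _ _)).1 h3
  have hQ1 : ϖ ∣ Q := by
    have h2 := sq_dvd_tailPart_sub (ϖ := ϖ) (a := algebraMap A B a) (g := algebraMap A B ∘ g)
      H.prime H.two_lt (algebraMap A B θ) s'
    have h3 := (dvd_pow_self ϖ two_ne_zero).trans h2
    exact (dvd_iff_dvd_of_dvd_sub h3).2 (dvd_mul_right _ _)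
  have hM1 : ϖ ^ p ^ 2 ∣ M := by
    obtain ⟨y, hy⟩ := H.exists_prime_dvd_frobPart_sub (ϖ := ϖ) (a := a) (b := b) (g := g) hperf
      (algebraMap A B θ + ϖ * s') s' (g (p + 1) * θ)
    rw [← H.prime_dvd_iff]
    refine H.prime_dvd_of_frobenius hy ?_
    have h2 := (pow_dvd_pow ϖ (show p * (p - 1) + 1 ≤ p ^ 2 by omega)).trans h1
    rw [pow_succ] at h2 ⊢
    exact (dvd_add_left (mul_dvd_mul_left _ hQ1)).1 h2
  refine ⟨hM1, ?_⟩
  rw [dvd_add_right hM1, hn, H.pow_add_dvd_iff] at h1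
  exact h1

theorem dvd_tail_sum {θ : A} {s' : B}
    (hM : ϖ ^ p ^ 2 ∣ frobPart p ϖ (algebraMap A B a) (algebraMap A B b) (algebraMap A B ∘ g)
      (algebraMap A B θ + ϖ * s') s' + ϖ ^ (p * (p - 1)) * algebraMap A B (g (p + 1) * θ))
    (hQ : ϖ ^ p ∣ tailPart p ϖ (algebraMap A B a) (algebraMap A B ∘ g)
      (algebraMap A B θ + ϖ * s') s') :
    ϖ ^ p ^ 2 ∣ -(algebraMap A B (b * (g (p + 1) ^ p + a ^ (p + 1))) * ϖ ^ p * s' ^ p) +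
      ∑ k ∈ Ico 2 p, algebraMap A B (a ^ p * g (p * k) - b * g k ^ p) * ϖ ^ (p * (p - k)) *
        ((1 + ϖ ^ p * (algebraMap A B θ + ϖ * s') ^ p) ^ k - 1) +
      ϖ ^ (p * (p - 1)) * (algebraMap A B (a ^ p * (g (p + 1) * θ)) -
        algebraMap A B (b * g (p + 1) ^ p) * (algebraMap A B θ + ϖ * s') ^ p ^ 2) := by
  have hp2 := H.two_lt
  have hn : p ^ 2 = p * (p - 1) + p := by
    obtain ⟨q, rfl⟩ := Nat.exists_eq_add_of_lt hp2
    rw [show 2 + q + 1 - 1 = q + 2 by omega]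
    ring
  set s := algebraMap A B θ + ϖ * s' with hs
  set M := frobPart p ϖ (algebraMap A B a) (algebraMap A B b) (algebraMap A B ∘ g)
    s s' with hM'
  set Q := tailPart p ϖ (algebraMap A B a) (algebraMap A B ∘ g) s s' with hQ'
  set S := ∑ k ∈ Ico 2 p, algebraMap A B (a ^ p * g (p * k) - b * g k ^ p) * ϖ ^ (p * (p - k)) *
        ((1 + ϖ ^ p * s ^ p) ^ k - 1) with hS
  let φ := Ideal.Quotient.mk (Ideal.span {(p : B) * ϖ})
  have hφ (x : B) : φ x = 0 ↔ (p : B) * ϖ ∣ x := by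
    rw [Ideal.Quotient.eq_zero_iff_mem, Ideal.mem_span_singleton]
  have key := pow_mul_frobPart (ϖ := φ ϖ) (a := φ (algebraMap A B a)) (b := φ (algebraMap A B b))
    (s' := φ s') (g := φ ∘ algebraMap A B ∘ g) H.prime hp2
    (by rw [← map_natCast φ, ← map_mul, hφ]) (φ s)
  rw [← map_frobPart, ← map_tailPart] at key
  have h2 : (p : B) * ϖ ∣ algebraMap A B a ^ p * M - (algebraMap A B b * Q ^ p -
      algebraMap A B (b * (g (p + 1) ^ p + a ^ (p + 1))) * ϖ ^ p * s' ^ p + S -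
      algebraMap A B (b * g (p + 1) ^ p) * s ^ p ^ 2 * ϖ ^ (p * (p - 1)) *
        (1 + ϖ ^ p * s ^ p)) := by
    rw [← hφ, map_sub, sub_eq_zero, map_mul, map_pow, key]
    simp [hS, ← hQ']
  have h3 := (H.prime_dvd_iff _).1 ((dvd_mul_right _ _).trans h2)
  have h4 : ϖ ^ p ^ 2 ∣ Q ^ p := by
    rw [sq, pow_mul]
    exact pow_dvd_pow_of_dvd hQ p
  have h5 := dvd_add (dvd_sub (hM.mul_left (algebraMap A B a ^ p)) h3)
    (dvd_add (h4.mul_left (-algebraMap A B b))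
      (dvd_mul_right (ϖ ^ p ^ 2) (algebraMap A B (b * g (p + 1) ^ p) * s ^ p ^ 2 * s ^ p)))
  convert h5 using 1
  rw [hn, pow_add ϖ (p * (p - 1)) p]
  simp only [map_mul, map_pow, map_add]
  ring


theorem eq_of_dvd_tail_sum {θ : A} {s' : B} {β : κ} (hβ : β ^ p = ρ b)
    (hb : ρ b ≠ 0) (hθ : ρ θ ≠ 0) (h3 : ρ b * ρ θ ^ p ^ 2 + ρ a * ρ θ ^ p = 0)
    (hs' : r s' ≠ 0)
    (h : ϖ ^ p ^ 2 ∣ -(algebraMap A B (b * (g (p + 1) ^ p + a ^ (p + 1))) * ϖ ^ p * s' ^ p) +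
      ∑ k ∈ Ico 2 p, algebraMap A B (a ^ p * g (p * k) - b * g k ^ p) * ϖ ^ (p * (p - k)) *
        ((1 + ϖ ^ p * (algebraMap A B θ + ϖ * s') ^ p) ^ k - 1) +
      ϖ ^ (p * (p - 1)) * (algebraMap A B (a ^ p * (g (p + 1) * θ)) -
        algebraMap A B (b * g (p + 1) ^ p) * (algebraMap A B θ + ϖ * s') ^ p ^ 2)) :
    ρ (g (p + 1)) ^ p = -ρ a ^ (p + 1) ∧
    (∀ k ∈ Ico 3 p, ρ a ^ p * ρ (g (p * k)) = ρ b * ρ (g k) ^ p) ∧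
    2 * (ρ a ^ p * ρ (g (p * 2)) - ρ b * ρ (g 2) ^ p) = ρ a ^ (p + 1) * (ρ a - β) := by
  have hp2 := H.two_lt
  have := H.charP
  have := Fact.mk H.prime
  have hn : p ^ 2 = p * (p - 1) + p := by
    obtain ⟨q, rfl⟩ := Nat.exists_eq_add_of_lt hp2
    rw [show 2 + q + 1 - 1 = q + 2 by omega]
    ring
  have hn2 : p * (p - 1) = p * (p - 2) + p := by
    obtain ⟨q, rfl⟩ := Nat.exists_eq_add_of_lt hp2
    rw [show 2 + q + 1 - 1 = q + 2 by omega, show 2 + q + 1 - 2 = q + 1 by omega]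
    ring
  have hn3 : p * (p - 2) = p * (p - 3) + p := by
    obtain ⟨q, rfl⟩ := Nat.exists_eq_add_of_lt hp2
    rw [show 2 + q + 1 - 3 = q by omega, show 2 + q + 1 - 2 = q + 1 by omega]
    ring
  set s := algebraMap A B θ + ϖ * s' with hs
  have hrs : r s = ρ θ := by simp [hs, H.map_algebraMap, H.map_uniformizer]
  set Y := s ^ p with hY
  have hrY : r Y = ρ θ ^ p := by rw [hY, map_pow, hrs]
  set d : ℕ → A := fun k => a ^ p * g (p * k) - b * g k ^ p with hd
  have hk (k : ℕ) : ϖ ^ p ∣ (1 + ϖ ^ p * Y) ^ k - 1 := by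
    have := sub_dvd_pow_sub_pow (1 + ϖ ^ p * Y) 1 k
    rw [one_pow, add_sub_cancel_left] at this
    exact (dvd_mul_right _ _).trans this
  have h4 : ρ (g (p + 1)) ^ p = -ρ a ^ (p + 1) := by
    have h5 := (pow_dvd_pow ϖ (show p + 1 ≤ p ^ 2 by nlinarith)).trans h
    have h6 : p + 1 ≤ p * (p - 1) := by
      obtain ⟨q, rfl⟩ := Nat.exists_eq_add_of_lt hp2
      rw [show 2 + q + 1 - 1 = q + 2 by omega]
      nlinarith
    rw [dvd_add_left ((pow_dvd_pow ϖ h6).mul_right _), dvd_add_left, dvd_neg, mul_right_comm,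
      mul_comm _ (ϖ ^ p), H.pow_succ_dvd_iff] at h5
    · simp only [map_mul, map_add, map_pow, H.map_algebraMap] at h5
      rw [mul_eq_zero, or_iff_left (pow_ne_zero _ hs'), mul_eq_zero, or_iff_right hb] at h5
      linear_combination h5
    · refine dvd_sum fun k hk' => ?_
      rw [mem_Ico] at hk'
      rw [add_comm p 1, pow_add]
      refine mul_dvd_mul (Dvd.dvd.mul_left ?_ _) (hk k)
      exact pow_dvd_pow _ (Nat.mul_pos H.prime.pos (by omega))
  have h0 : ϖ ^ p ^ 2 ∣ algebraMap A B (b * (g (p + 1) ^ p + a ^ (p + 1))) * ϖ ^ p * s' ^ p := by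
    rw [← H.prime_dvd_iff]
    exact ((H.prime_dvd_of_map_eq_zero (by simp [h4])).mul_right _).mul_right _
  rw [add_assoc, dvd_add_right ((dvd_neg).2 h0)] at h
  have h2' : algebraMap A B (d 2) * ϖ ^ (p * (p - 2)) * ((1 + ϖ ^ p * Y) ^ 2 - 1) =
      ϖ ^ (p * (p - 1)) * (algebraMap A B (d 2) * (2 * Y + ϖ ^ p * Y ^ 2)) := by
    rw [hn2, pow_add]
    ring
  rw [Finset.sum_eq_sum_Ico_succ_bot hp2] at h
  have h5 : ∀ k, 3 ≤ k → k < p → (p : A) ∣ d k := by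
    refine H.prime_dvd_of_sum (by norm_num) (y := Y) (by rw [hrY]; exact pow_ne_zero _ hθ) ?_
    have h6 := (pow_dvd_pow ϖ (show p * (p - 3) + p + 1 ≤ p ^ 2 by omega)).trans h
    have h7 : ϖ ^ (p * (p - 3) + p + 1) ∣ ϖ ^ (p * (p - 1)) := pow_dvd_pow _ (by omega)
    rw [dvd_add_left (h7.mul_right _)] at h6
    refine (dvd_add_right ?_).1 h6
    change _ ∣ algebraMap A B (d 2) * _ * _
    rw [h2']
    exact h7.mul_right _
  have h5' : ∀ k ∈ Ico 3 p, ρ a ^ p * ρ (g (p * k)) = ρ b * ρ (g k) ^ p := by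
    intro k hk
    rw [mem_Ico] at hk
    have h6 := (H.ker _).2 (h5 k hk.1 hk.2)
    simp only [hd, map_sub, map_mul, map_pow] at h6
    exact sub_eq_zero.1 h6
  refine ⟨h4, h5', ?_⟩
  have h6 : ϖ ^ p ^ 2 ∣ ∑ k ∈ Ico (2 + 1) p, algebraMap A B (d k) * ϖ ^ (p * (p - k)) *
      ((1 + ϖ ^ p * Y) ^ k - 1) := by
    refine dvd_sum fun k hk => ?_
    rw [mem_Ico] at hk
    rw [← H.prime_dvd_iff]
    exact ((natCast_dvd_algebraMap (h5 k hk.1 hk.2)).mul_right _).mul_right _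
  have h7 : ϖ ^ p ^ 2 ∣ ϖ ^ (p * (p - 1)) * (algebraMap A B (d 2) * (2 * Y + ϖ ^ p * Y ^ 2) +
      (algebraMap A B (a ^ p * (g (p + 1) * θ)) - algebraMap A B (b * g (p + 1) ^ p) *
        s ^ p ^ 2)) := by
    have h8 := dvd_sub h h6
    convert h8 using 1
    change _ = algebraMap A B (d 2) * _ * _ + _ + _ - _
    rw [h2']
    ring
  rw [hn, H.pow_add_dvd_iff] at h7
  have h8 := (H.dvd_iff _).2 ((dvd_pow_self ϖ H.prime.ne_zero).trans h7)
  have hgθ : ρ (g (p + 1)) * ρ θ = ρ a * β * ρ θ ^ p := by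
    apply frobenius_inj κ p
    simp only [frobenius_def]
    rw [mul_pow, mul_pow, mul_pow, h4, hβ, pow_succ, ← pow_mul, ← sq]
    linear_combination -ρ a ^ p * h3
  simp only [map_add, map_sub, map_mul, map_pow, H.map_algebraMap, H.map_uniformizer, hrY, hrs,
    zero_pow H.prime.ne_zero, zero_mul, add_zero, map_ofNat r 2, hd] at h8
  rw [← hn] at h8
  rw [← mul_left_inj' (pow_ne_zero p hθ)]
  linear_combination h8 - ρ a ^ p * hgθ + ρ b * ρ θ ^ p ^ 2 * h4 - ρ a ^ (p + 1) * h3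

theorem exists_conditions_of_shiftSum_eq_zero (hf : IsNormalized p ρ f a b g)
    (hperf : ∀ x : κ, ∃ y, y ^ p = x)
    (hϖ : ϖ ^ p ^ 2 = -∑ i ∈ Icc 1 (p ^ 2), algebraMap A B (f i) * ϖ ^ (p ^ 2 - i))
    (hfp : ∀ i, 1 ≤ i → i ≤ p ^ 2 → (p : A) ∣ f i) {β : κ} (hβ : β ^ p = ρ b) {s : B}
    (hs : shiftSum p ϖ (algebraMap A B ∘ f) s = 0) (hs0 : r s ≠ 0) :
    (ρ (g (p + 1)) ^ p = -ρ a ^ (p + 1) ∧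
    (∀ k ∈ Ico 3 p, ρ a ^ p * ρ (g (p * k)) = ρ b * ρ (g k) ^ p) ∧
    2 * (ρ a ^ p * ρ (g (p * 2)) - ρ b * ρ (g 2) ^ p) = ρ a ^ (p + 1) * (ρ a - β)) ∧
    ∃ (θ c : A) (x : κ), ρ θ ≠ 0 ∧ b * θ ^ p ^ 2 + a * θ ^ p = p * c ∧
      ρ b * x ^ p + ρ a * x - ρ c - ρ (g 1) * ρ θ = 0 := by
  have ha := hf.map_a_ne_zero
  have hb := hf.map_b_ne_zero
  have h1 := (H.prime_mul_uniformizer_dvd_ramEq hf hϖ s).2 (by rw [hs]; exact dvd_zero _)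
  obtain ⟨θ, s', rfl⟩ := H.exists_algebraMap s
  have hr : r (algebraMap A B θ + ϖ * s') = ρ θ := by
    simp [H.map_algebraMap, H.map_uniformizer]
  rw [hr] at hs0
  have h3 : ρ b * ρ θ ^ p ^ 2 + ρ a * ρ θ ^ p = 0 := by
    have h2 := (H.dvd_iff _).2 ((dvd_mul_left _ _).trans h1)
    rw [H.map_ramEq_eq, hr] at h2
    simpa [hb] using h2
  obtain ⟨c, hc⟩ := (H.ker (b * θ ^ p ^ 2 + a * θ ^ p)).1 (by simpa using h3)
  have hϖ' := dvd_pow_add_mul (b := algebraMap A B b) (f := algebraMap A B ∘ f) H.two_lt hϖ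
    (fun i hi => natCast_dvd_algebraMap (hfp i (mem_Icc.1 hi).1 (mem_Icc.1 hi).2))
    (by simp [hf.apply_sq])
  obtain ⟨hM, hQ⟩ := H.dvd_frobPart_and_dvd_tailPart hperf hϖ' hc h1
  have hs' : r s' ≠ 0 := by
    have h4 := sq_dvd_tailPart_sub (ϖ := ϖ) (a := algebraMap A B a) (g := algebraMap A B ∘ g)
      H.prime H.two_lt (algebraMap A B θ) s'
    have h5 := (pow_dvd_pow ϖ H.two_lt.le).trans hQ
    rw [dvd_sub_right h5, sq, mul_dvd_mul_iff_left H.ne_zero, ← H.dvd_iff] at h4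
    intro h6
    simp [H.map_algebraMap, h6, ha, hs0] at h4
  have h6 := H.eq_of_dvd_tail_sum hβ hb hs0 h3 hs' (H.dvd_tail_sum hM hQ)
  refine ⟨h6, θ, c, ?_⟩
  obtain ⟨α, hα⟩ := hperf (ρ a)
  obtain ⟨q, hq⟩ := hQ
  exact ⟨_, hs0, hc, (H.dvd_ramEq_iff hα hβ ha hb hϖ' hc h6.1 h6.2.1 h6.2.2 hq rfl).1 h1⟩

end IsTotRamified

namespace IsTotRamified

variable {p : ℕ} {A B κ : Type*} [CommRing A] [CommRing B] [IsDomain B] [Algebra A B] [Field κ]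
  {ρ : A →+* κ} {r : B →+* κ} {ϖ : B} (H : IsTotRamified p ρ r ϖ) {σ : B →ₐ[A] B}

include H

theorem dvd_map_uniformizer : ϖ ∣ σ ϖ := by
  have h : (p : B) ∣ σ ϖ ^ p ^ 2 := by
    rw [← map_pow, ← map_natCast σ]
    exact map_dvd σ ((H.prime_dvd_iff _).2 dvd_rfl)
  rw [H.prime_dvd_iff] at h
  have h2 := (H.dvd_iff _).2 ((dvd_pow_self ϖ (pow_ne_zero 2 H.prime.ne_zero)).trans h)
  rw [map_pow] at h2
  exact (H.dvd_iff _).1 (eq_zero_of_pow_eq_zero h2)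

theorem pow_dvd_map_sub {t : ℕ} (h : ϖ ^ t ∣ σ ϖ - ϖ) (x : B) : ϖ ^ t ∣ σ x - x := by
  suffices h' : ∀ m ≤ t, ∀ x, ϖ ^ m ∣ σ x - x from h' t le_rfl x
  intro m
  induction m with
  | zero => simp
  | succ m ih =>
    intro hm x
    obtain ⟨c, y, rfl⟩ := H.exists_algebraMap x
    have e : σ (algebraMap A B c + ϖ * y) - (algebraMap A B c + ϖ * y) =
        (σ ϖ - ϖ) * σ y + ϖ * (σ y - y) := by
      simp only [map_add, map_mul, AlgHom.commutes]
      ring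
    rw [e]
    refine dvd_add (((pow_dvd_pow _ hm).trans h).mul_right _) ?_
    rw [pow_succ']
    exact mul_dvd_mul_left _ (ih (by omega) y)

theorem map_map (x : B) : r (σ x) = r x := by
  have h1 : ϖ ^ 1 ∣ σ ϖ - ϖ := by
    rw [pow_one]
    exact dvd_sub H.dvd_map_uniformizer dvd_rfl
  have h2 := H.pow_dvd_map_sub h1 x
  rw [pow_one, ← H.dvd_iff, map_sub, sub_eq_zero] at h2
  exact h2

theorem exists_map_sub_eq {t : ℕ} (ht : 1 ≤ t) {e : B} (h : σ ϖ = ϖ + ϖ ^ (t + 1) * e) (k : ℕ)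
    (w : B) : ∃ w', σ (ϖ ^ k * w) = ϖ ^ k * w + ϖ ^ (k + t) * w' ∧ r w' = k * r e * r w := by
  obtain ⟨y, hy⟩ := powAddExpansion 1 (ϖ ^ t * e) k
  obtain ⟨z, hz⟩ := H.pow_dvd_map_sub (t := t + 1) (σ := σ) (by rw [h]; exact ⟨e, by ring⟩) w
  refine ⟨k * e * w + y * ϖ ^ t * e ^ 2 * w + (1 + ϖ ^ t * e) ^ k * ϖ * z, ?_, ?_⟩
  · have h1 : ϖ + ϖ ^ (t + 1) * e = ϖ * (1 + ϖ ^ t * e) := by ring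
    rw [map_mul, map_pow, h, h1, mul_pow, eq_add_of_sub_eq hz, hy]
    ring
  · simp [H.map_uniformizer, show t ≠ 0 by omega]

theorem exists_pow_map_eq {t : ℕ} (ht : 1 ≤ t) {e : B} (h : σ ϖ = ϖ + ϖ ^ (t + 1) * e) (j : ℕ) :
    ∃ w, (σ ^ j) ϖ = ϖ + ϖ ^ (t + 1) * w ∧ r w = j * r e := by
  induction j with
  | zero => exact ⟨0, by simp, by simp⟩
  | succ j ih =>
    obtain ⟨w, hw, hr⟩ := ih
    obtain ⟨w', hw', -⟩ := H.exists_map_sub_eq ht h (t + 1) w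
    refine ⟨e + w + ϖ ^ t * w', ?_, ?_⟩
    · rw [pow_succ', AlgHom.mul_apply, hw, map_add, hw', h]
      ring
    · simp [H.map_uniformizer, show t ≠ 0 by omega, hr]
      ring

theorem sq_dvd_map_sub (h : (σ ^ p ^ 2) ϖ = ϖ) : ϖ ^ 2 ∣ σ ϖ - ϖ := by
  obtain ⟨u, hu⟩ := H.dvd_map_uniformizer (σ := σ)
  have key : ∀ j : ℕ, ∃ v, (σ ^ j) ϖ = ϖ * v ∧ r v = r u ^ j := by
    intro j
    induction j with
    | zero => exact ⟨1, by simp, by simp⟩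
    | succ j ih =>
      obtain ⟨v, hv, hr⟩ := ih
      refine ⟨u * σ v, ?_, ?_⟩
      · rw [pow_succ', AlgHom.mul_apply, hv, map_mul, hu, mul_assoc]
      · rw [map_mul, H.map_map, hr, pow_succ']
  obtain ⟨v, hv, hr⟩ := key (p ^ 2)
  have h1 : v = 1 := mul_left_cancel₀ H.ne_zero (by rw [← hv, h, mul_one])
  have := H.charP
  have := Fact.mk H.prime
  have h2 : (r u - 1) ^ p ^ 2 = 0 := by
    rw [sub_pow_char_pow, ← hr, h1, map_one, one_pow, sub_self]
  have h3 := eq_zero_of_pow_eq_zero h2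
  rw [← map_one r, ← map_sub, H.dvd_iff] at h3
  rw [hu, sq, show ϖ * u - ϖ = ϖ * (u - 1) by ring]
  exact mul_dvd_mul_left _ h3

theorem pow_mul_dvd_of_dvd_algebraMap {k : ℕ} {c : A}
    (h : ϖ ^ (p ^ 2 * k + 1) ∣ algebraMap A B c) : (p : A) ^ (k + 1) ∣ c := by
  induction k generalizing c with
  | zero => simpa [H.dvd_algebraMap_iff] using h
  | succ k ih =>
    obtain ⟨c', rfl⟩ := (H.dvd_algebraMap_iff c).1
      ((dvd_pow_self ϖ (Nat.succ_ne_zero _)).trans h)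
    rw [pow_succ']
    refine mul_dvd_mul_left _ (ih ?_)
    rw [map_mul, map_natCast, mul_add, mul_one, add_comm _ (p ^ 2), add_assoc,
      ← H.prime_mul_dvd_iff, mul_dvd_mul_iff_left H.natCast_ne_zero] at h
    exact h

theorem pow_dvd_natCast_pow (k : ℕ) : ϖ ^ (p ^ 2 * k) ∣ (p : B) ^ k := by
  rw [pow_mul]
  exact pow_dvd_pow_of_dvd ((H.prime_dvd_iff _).1 dvd_rfl) k

theorem pow_dvd_algebraMap_of_dvd {k : ℕ} {c : A} (h : (p : A) ^ k ∣ c) :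
    ϖ ^ (p ^ 2 * k) ∣ algebraMap A B c := by
  have := map_dvd (algebraMap A B) h
  rw [map_pow, map_natCast] at this
  exact (H.pow_dvd_natCast_pow k).trans this

theorem pow_succ_dvd_of_mod_ne {m i : ℕ} {c : A} (hi : i < p ^ 2) (hm : m % p ^ 2 ≠ i)
    (h : ϖ ^ m ∣ algebraMap A B c * ϖ ^ i) : ϖ ^ (m + 1) ∣ algebraMap A B c * ϖ ^ i := by
  by_cases hmi : m < i
  · exact (pow_dvd_pow _ hmi).mul_left _
  obtain ⟨d, rfl⟩ := Nat.exists_eq_add_of_le (not_lt.1 hmi)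
  rw [mul_comm, H.pow_add_dvd_iff] at h
  rw [mul_comm, add_assoc, H.pow_add_dvd_iff]
  have hd : d % p ^ 2 ≠ 0 := by
    intro hd
    apply hm
    rw [Nat.add_mod, hd, add_zero, Nat.mod_mod, Nat.mod_eq_of_lt hi]
  have h1 : (p : A) ^ (d / p ^ 2 + 1) ∣ c := by
    apply H.pow_mul_dvd_of_dvd_algebraMap
    refine (pow_dvd_pow _ ?_).trans h
    have := Nat.div_add_mod d (p ^ 2)
    have := Nat.pos_of_ne_zero hd
    omega
  refine (pow_dvd_pow _ ?_).trans (H.pow_dvd_algebraMap_of_dvd h1)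
  have := Nat.div_add_mod d (p ^ 2)
  have := Nat.mod_lt d (pow_pos H.prime.pos 2)
  rw [mul_add]
  omega

theorem pow_dvd_of_pow_dvd_sum {M : ℕ} {c : ℕ → A}
    (h : ϖ ^ M ∣ ∑ i ∈ range (p ^ 2), algebraMap A B (c i) * ϖ ^ i) :
    ∀ i < p ^ 2, ϖ ^ M ∣ algebraMap A B (c i) * ϖ ^ i := by
  induction M with
  | zero => simp
  | succ M ih =>
    have h1 := ih ((pow_dvd_pow _ (Nat.le_succ M)).trans h)
    intro i hi
    by_cases hMi : M % p ^ 2 = i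
    · rw [← add_sum_erase _ _ (mem_range.2 hi)] at h
      refine (dvd_add_left (dvd_sum fun j hj => ?_)).1 h
      rw [mem_erase, mem_range] at hj
      exact H.pow_succ_dvd_of_mod_ne hj.2 (fun h => hj.1 (h.symm.trans hMi)) (h1 j hj.2)
    · exact H.pow_succ_dvd_of_mod_ne hi hMi (h1 i hi)

/-- If `σ` moves the uniformizer `ϖ` to first order, then so does each power of the difference
operator `σ - 1` below the `p`-th. -/
theorem exists_sum_pow_map_eq {e : B} (h : σ ϖ = ϖ + ϖ ^ 2 * e) (he : r e ≠ 0) :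
    ∃ w, ∑ j ∈ range p, (σ ^ j) ϖ = ϖ ^ p * w ∧ r w ≠ 0 := by
  have := Fact.mk H.prime
  have := H.charP
  obtain ⟨q, hq⟩ : (C (p : ℤ)) ∣ ∑ j ∈ range p, (X : ℤ[X]) ^ j - (X - 1) ^ (p - 1) := by
    rw [C_dvd_iff_dvd_coeff]
    intro i
    rw [← ZMod.intCast_zmod_eq_zero_iff_dvd, ← eq_intCast (Int.castRingHom (ZMod p)), ← coeff_map]
    convert coeff_zero i
    have h0 : (X - 1 : (ZMod p)[X]) ≠ 0 := X_sub_C_ne_zero 1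
    refine mul_right_cancel₀ h0 ?_
    simp only [Polynomial.map_sub, Polynomial.map_pow, Polynomial.map_sum, map_X,
      Polynomial.map_one]
    rw [sub_mul, geom_sum_mul, pow_sub_one_mul H.prime.ne_zero, sub_pow_char, one_pow, sub_self,
      zero_mul]
  have key : ∀ k : ℕ, k < p → ∃ w, ((σ.toLinearMap - 1) ^ k) ϖ = ϖ ^ (k + 1) * w ∧ r w ≠ 0 := by
    intro k
    induction k with
    | zero => exact fun _ => ⟨1, by simp, by simp⟩
    | succ k ih =>
      intro hk
      obtain ⟨w, hw, hr⟩ := ih (by omega)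
      obtain ⟨w', hw', hr'⟩ := H.exists_map_sub_eq le_rfl h (k + 1) w
      refine ⟨w', ?_, ?_⟩
      · rw [pow_succ', Module.End.mul_apply, hw, LinearMap.sub_apply, Module.End.one_apply,
          AlgHom.toLinearMap_apply, hw', add_sub_cancel_left]
      · rw [hr']
        refine mul_ne_zero (mul_ne_zero ?_ he) hr
        rw [Ne, CharP.cast_eq_zero_iff κ p]
        exact Nat.not_dvd_of_pos_of_lt (by omega) hk
  obtain ⟨w, hw, hr⟩ := key (p - 1) (Nat.sub_lt H.prime.pos one_pos)
  rw [Nat.sub_add_cancel H.prime.one_le] at hw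
  have h1 := congrArg (fun g => (aeval (σ.toLinearMap) g) ϖ) hq
  simp only [map_sub, map_sum, map_pow, aeval_X, map_one, map_mul, aeval_C] at h1
  rw [LinearMap.sub_apply, hw, LinearMap.sum_apply] at h1
  have h2 : ∀ j, (σ.toLinearMap ^ j) ϖ = (σ ^ j) ϖ := by
    intro j
    induction j with
    | zero => simp
    | succ j ih => rw [pow_succ', pow_succ', Module.End.mul_apply, ih]; rfl
  simp only [h2] at h1
  have h3 : (p : B) ∣ ∑ j ∈ range p, (σ ^ j) ϖ - ϖ ^ p * w := by
    rw [h1]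
    refine ⟨aeval σ.toLinearMap q ϖ, ?_⟩
    simp
  rw [H.prime_dvd_iff] at h3
  obtain ⟨z, hz⟩ := h3
  have hp := H.two_lt
  refine ⟨w + ϖ ^ (p ^ 2 - p) * z, ?_, ?_⟩
  · rw [mul_add, ← mul_assoc, ← pow_add, Nat.add_sub_cancel' (Nat.le_self_pow two_ne_zero p)]
    linear_combination hz
  · have : p ^ 2 - p ≠ 0 := by
      rw [sq]
      have := Nat.mul_lt_mul_of_pos_right hp (show 0 < p by omega)
      omega
    simpa [H.map_uniformizer, this] using hr

end IsTotRamified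

/-- The coefficients of the derivative of `X ^ n + ∑ f i * X ^ (n - i)`, where `n = p ^ 2`. -/
def derivCoeff {A : Type*} [CommRing A] (p : ℕ) (f : ℕ → A) (i : ℕ) : A :=
  ((i + 1 : ℕ) : A) * if i + 1 = p ^ 2 then 1 else f (p ^ 2 - (i + 1))

theorem derivCoeff_eq {A : Type*} [CommRing A] {p : ℕ} (f : ℕ → A) {m : ℕ} (hm : 1 ≤ m)
    (hm' : m < p ^ 2) :
    derivCoeff p f (p ^ 2 - m - 1) = ((p ^ 2 - m : ℕ) : A) * f m := by
  rw [derivCoeff, show p ^ 2 - m - 1 + 1 = p ^ 2 - m by omega, if_neg (by omega),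
    Nat.sub_sub_self hm'.le]

theorem not_dvd_sq_sub {p m : ℕ} (hm : ¬p ∣ m) (hm' : m < p ^ 2) : ¬p ∣ p ^ 2 - m := by
  intro h
  exact hm ((Nat.dvd_sub_iff_right hm'.le (dvd_pow_self p two_ne_zero)).1 h)

namespace IsTotRamified

variable {p : ℕ} {A B κ : Type*} [CommRing A] [CommRing B] [IsDomain B] [Algebra A B] [Field κ]
  {ρ : A →+* κ} {r : B →+* κ} {ϖ : B} (H : IsTotRamified p ρ r ϖ) {σ : B →ₐ[A] B}

include H

theorem exists_map_eq_of_ne {τ : B →ₐ[A] B} (h : τ ϖ ≠ ϖ) {m : ℕ} (hm : ϖ ^ m ∣ τ ϖ - ϖ) :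
    ∃ k e, m ≤ k ∧ r e ≠ 0 ∧ τ ϖ = ϖ + ϖ ^ k * e := by
  obtain ⟨k, e, he, hk⟩ := H.exists_eq (τ ϖ - ϖ) (sub_ne_zero.2 h)
  refine ⟨k, e, ?_, he, by rw [← hk]; ring⟩
  by_contra hkm
  rw [hk] at hm
  exact he ((H.pow_succ_dvd_iff k e).1 ((pow_dvd_pow _ (by omega)).trans hm))

/-- The two ramification breaks of an automorphism of order `p ^ 2` are congruent modulo `p`. -/
theorem exists_breaks (hσ : (σ ^ p ^ 2) ϖ = ϖ) (hne : ∀ j, 1 ≤ j → j < p ^ 2 → (σ ^ j) ϖ ≠ ϖ) :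
    ∃ t t' e e', 1 ≤ t ∧ t + p ≤ t' ∧ (p ∣ t' - t) ∧ r e ≠ 0 ∧ r e' ≠ 0 ∧
      σ ϖ = ϖ + ϖ ^ (t + 1) * e ∧ (σ ^ p) ϖ = ϖ + ϖ ^ (t' + 1) * e' := by
  have hp := H.two_lt
  have hpp : p < p ^ 2 := lt_self_pow₀ (by omega) (by omega)
  have := H.charP
  obtain ⟨k, e, hk, he, h1⟩ := H.exists_map_eq_of_ne (by simpa using hne 1 le_rfl (by omega))
    (H.sq_dvd_map_sub hσ)
  obtain ⟨t, rfl⟩ : ∃ t, k = t + 1 := ⟨k - 1, by omega⟩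
  have ht : 1 ≤ t := by omega
  obtain ⟨w, hw, hr⟩ := H.exists_pow_map_eq ht h1 p
  rw [CharP.cast_eq_zero, zero_mul] at hr
  obtain ⟨k', e', hk', he', h2⟩ := H.exists_map_eq_of_ne (hne p (by omega) hpp)
    (m := t + 1 + 1) (by
      rw [hw, add_sub_cancel_left, H.pow_succ_dvd_iff, hr])
  obtain ⟨t', rfl⟩ : ∃ t', k' = t' + 1 := ⟨k' - 1, by omega⟩
  obtain ⟨w₁, hw₁, hr₁⟩ := H.exists_map_sub_eq ht h1 (t' + 1) e'
  obtain ⟨w₂, hw₂, hr₂⟩ := H.exists_map_sub_eq (show 1 ≤ t' by omega) h2 (t + 1) e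
  have hcomm : σ ((σ ^ p) ϖ) = (σ ^ p) (σ ϖ) := by
    rw [← AlgHom.mul_apply, ← AlgHom.mul_apply, ← pow_succ', pow_succ]
  have h3 : ϖ ^ (t + t' + 1) * w₁ = ϖ ^ (t + t' + 1) * w₂ := by
    have h4 := hcomm
    rw [h2, map_add, hw₁, h1, map_add, hw₂, h2] at h4
    rw [show t' + 1 + t = t + t' + 1 by ring, show t + 1 + t' = t + t' + 1 by ring] at h4
    linear_combination h4
  have h4 : (t' : κ) = t := by
    have h5 : r w₁ = r w₂ := by rw [mul_left_cancel₀ (pow_ne_zero _ H.ne_zero) h3]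
    rw [hr₁, hr₂] at h5
    refine mul_right_cancel₀ (mul_ne_zero he he') ?_
    push_cast at h5
    linear_combination h5
  have h5 : p ∣ t' - t := by
    rw [← CharP.cast_eq_zero_iff κ p, Nat.cast_sub (by omega), h4, sub_self]
  refine ⟨t, t', e, e', ht, ?_, h5, he, he', h1, h2⟩
  have := Nat.le_of_dvd (by omega) h5
  omega

theorem exists_prod_eq {t t' : ℕ} {e e' : B} (ht : 1 ≤ t) (ht' : 1 ≤ t') (he : r e ≠ 0)
    (he' : r e' ≠ 0) (h1 : σ ϖ = ϖ + ϖ ^ (t + 1) * e)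
    (h2 : (σ ^ p) ϖ = ϖ + ϖ ^ (t' + 1) * e') :
    ∃ u, r u ≠ 0 ∧ ∏ j ∈ Ico 1 (p ^ 2), (ϖ - (σ ^ j) ϖ) =
      ϖ ^ ((p - 1) * (t' + 1) + (p ^ 2 - p) * (t + 1)) * u := by
  have := H.charP
  have hp := H.two_lt
  have key : ∀ j, ∃ u, j ∈ Ico 1 (p ^ 2) → r u ≠ 0 ∧
      ϖ - (σ ^ j) ϖ = ϖ ^ (if p ∣ j then t' + 1 else t + 1) * u := by
    intro j
    split_ifs with hj
    · obtain ⟨i, rfl⟩ := hj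
      obtain ⟨w, hw, hr⟩ := H.exists_pow_map_eq ht' h2 i
      refine ⟨-w, fun hi => ⟨?_, ?_⟩⟩
      · rw [map_neg, neg_ne_zero, hr]
        refine mul_ne_zero ?_ he'
        rw [Ne, CharP.cast_eq_zero_iff κ p]
        rw [mem_Ico, sq] at hi
        exact Nat.not_dvd_of_pos_of_lt (Nat.pos_of_mul_pos_left hi.1)
          (Nat.lt_of_mul_lt_mul_left hi.2)
      · rw [pow_mul, hw]
        ring
    · obtain ⟨w, hw, hr⟩ := H.exists_pow_map_eq ht h1 j
      refine ⟨-w, fun _ => ⟨?_, ?_⟩⟩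
      · rw [map_neg, neg_ne_zero, hr]
        refine mul_ne_zero ?_ he
        rwa [Ne, CharP.cast_eq_zero_iff κ p]
      · rw [hw]
        ring
  choose u hu using key
  refine ⟨∏ j ∈ Ico 1 (p ^ 2), u j, ?_, ?_⟩
  · rw [map_prod]
    exact prod_ne_zero_iff.2 fun j hj => (hu j hj).1
  · rw [prod_congr rfl fun j hj => (hu j hj).2, prod_mul_distrib, prod_pow_eq_pow_sum, sum_ite,
      sum_const, sum_const, smul_eq_mul, smul_eq_mul]
    have hc : #{j ∈ Ico 1 (p ^ 2) | p ∣ j} = p - 1 := by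
      have h := Nat.Ioc_filter_dvd_card_eq_div (p ^ 2 - 1) p
      have h3 : Ioc 0 (p ^ 2 - 1) = Ico 1 (p ^ 2) := by
        ext i
        rw [mem_Ioc, mem_Ico]
        have := pow_pos H.prime.pos 2
        omega
      rw [h3] at h
      rw [h]
      refine Nat.div_eq_of_lt_le ?_ ?_
      · rw [Nat.sub_mul, ← sq]
        omega
      · rw [Nat.sub_add_cancel (by omega), ← sq]
        have := pow_pos H.prime.pos 2
        omega
    have hc' : #{j ∈ Ico 1 (p ^ 2) | ¬p ∣ j} = p ^ 2 - p := by
      have h := card_filter_add_card_filter_not (s := Ico 1 (p ^ 2)) (p ∣ ·)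
      rw [hc, Nat.card_Ico] at h
      have : p ≤ p ^ 2 := Nat.le_self_pow two_ne_zero p
      omega
    rw [hc, hc']

theorem not_pow_dvd_algebraMap (k : ℕ) : ¬ϖ ^ (p ^ 2 * k + 1) ∣ algebraMap A B ((p : A) ^ k) := by
  intro h
  have h1 := natCast_dvd_algebraMap (B := B) (dvd_refl (p : A))
  have h2 := map_dvd (algebraMap A B) (H.pow_mul_dvd_of_dvd_algebraMap h)
  rw [map_pow, map_pow, map_natCast, pow_succ] at h2
  obtain ⟨y, hy⟩ := h2
  have h3 : (1 : B) = p * y := by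
    refine mul_left_cancel₀ (pow_ne_zero k H.natCast_ne_zero) ?_
    linear_combination hy
  have h4 := congrArg r h3
  rw [map_one, map_mul, ← map_natCast (algebraMap A B), H.map_algebraMap, H.map_prime,
    zero_mul] at h4
  exact one_ne_zero h4

theorem lt_of_pow_dvd_sum_derivCoeff {f : ℕ → A} {M : ℕ}
    (h : ϖ ^ M ∣ ∑ i ∈ range (p ^ 2), algebraMap A B (derivCoeff p f i) * ϖ ^ i) :
    M < 3 * p ^ 2 := by
  have hn := pow_pos H.prime.pos 2
  by_contra hM
  have h1 := H.pow_dvd_of_pow_dvd_sum h (p ^ 2 - 1) (by omega)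
  rw [derivCoeff, Nat.sub_add_cancel hn, if_pos rfl, mul_one, Nat.cast_pow, mul_comm] at h1
  refine H.not_pow_dvd_algebraMap 2 ?_
  rw [← H.pow_add_dvd_iff (p ^ 2 - 1)]
  exact (pow_dvd_pow _ (by omega)).trans h1

theorem sum_derivCoeff_ne_zero (f : ℕ → A) :
    ∑ i ∈ range (p ^ 2), algebraMap A B (derivCoeff p f i) * ϖ ^ i ≠ 0 := by
  intro h
  exact lt_irrefl _ (H.lt_of_pow_dvd_sum_derivCoeff (h ▸ dvd_zero (ϖ ^ (3 * p ^ 2))))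

theorem pow_dvd_of_pow_dvd_natCast_mul {k m : ℕ} (hm : ¬p ∣ m) {x : A}
    (h : (p : A) ^ k ∣ (m : A) * x) : (p : A) ^ k ∣ x := by
  have h1 : IsCoprime ((p : A) ^ k) (m : A) := by
    have h2 := (Nat.isCoprime_iff_coprime.2 ((H.prime.coprime_iff_not_dvd.2 hm).pow_left k)).map
      (Int.castRingHom A)
    simpa using h2
  exact h1.dvd_of_dvd_mul_left h

theorem valuation_conditions {f : ℕ → A} {u : B} (hu : r u ≠ 0)
    (h : ∑ i ∈ range (p ^ 2), algebraMap A B (derivCoeff p f i) * ϖ ^ i =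
      ϖ ^ (3 * p ^ 2 - p - 2) * u) :
    (∀ i, 1 ≤ i → i < p → (p : A) ^ 2 ∣ f i) ∧
      ((p : A) ^ 2 ∣ f (p + 1) ∧ ¬(p : A) ^ 3 ∣ f (p + 1)) ∧
      ∀ i, p + 2 ≤ i → i < p ^ 2 → ¬p ∣ i → (p : A) ^ 3 ∣ f i := by
  have hp := H.two_lt
  have hpp : p + 2 < p ^ 2 := by nlinarith
  have key := H.pow_dvd_of_pow_dvd_sum (h ▸ dvd_mul_right _ _)
  have key2 : ∀ k m, 1 ≤ m → m < p ^ 2 → ¬p ∣ m → p ^ 2 * k + p + 2 ≤ 2 * p ^ 2 + m →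
      (p : A) ^ (k + 1) ∣ f m := by
    intro k m hm1 hm hpm hk
    have h1 := key (p ^ 2 - m - 1) (by omega)
    rw [derivCoeff_eq f hm1 hm, mul_comm (algebraMap A B _)] at h1
    refine H.pow_dvd_of_pow_dvd_natCast_mul (not_dvd_sq_sub hpm hm) ?_
    apply H.pow_mul_dvd_of_dvd_algebraMap
    rw [← H.pow_add_dvd_iff (p ^ 2 - m - 1)]
    refine (pow_dvd_pow _ ?_).trans h1
    omega
  have hp1 : ¬p ∣ p + 1 := by
    rw [Nat.dvd_add_right dvd_rfl, Nat.dvd_one]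
    omega
  refine ⟨fun i hi hip => key2 1 i hi (by omega) (Nat.not_dvd_of_pos_of_lt hi hip) (by omega),
    ⟨key2 1 (p + 1) (by omega) (by omega) hp1 (by omega), fun h3 => ?_⟩,
    fun i hi hip hpi => key2 2 i (by omega) hip hpi (by omega)⟩
  apply hu
  rw [← H.pow_succ_dvd_iff, ← h]
  refine dvd_sum fun i hi => ?_
  rw [mem_range] at hi
  by_cases hi' : i = p ^ 2 - (p + 1) - 1
  · rw [hi', derivCoeff_eq f (by omega) (by omega), mul_comm (algebraMap A B _)]
    have h4 := mul_dvd_mul_left (ϖ ^ (p ^ 2 - (p + 1) - 1)) (H.pow_dvd_algebraMap_of_dvd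
      (h3.mul_left ((p ^ 2 - (p + 1) : ℕ) : A)))
    rw [← pow_add] at h4
    refine (pow_dvd_pow _ ?_).trans h4
    omega
  · refine H.pow_succ_dvd_of_mod_ne hi (fun h5 => hi' ?_) (key i hi)
    rw [← h5, show 3 * p ^ 2 - p - 2 = p ^ 2 - (p + 1) - 1 + p ^ 2 * 2 by omega,
      Nat.add_mul_mod_self_left, Nat.mod_eq_of_lt (by omega)]

theorem exists_shiftSum_eq_zero_of_map {f : ℕ → A}
    (hϖ : ϖ ^ p ^ 2 = -∑ i ∈ Icc 1 (p ^ 2), algebraMap A B (f i) * ϖ ^ (p ^ 2 - i)) {e : B}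
    (he : r e ≠ 0) (h : σ ϖ = ϖ + ϖ ^ 2 * e) :
    ∃ s, shiftSum p ϖ (algebraMap A B ∘ f) s = 0 ∧ r s ≠ 0 := by
  obtain ⟨v, hv⟩ := isUnit_iff_exists_inv.1 (H.isUnit (1 + ϖ * e) (by simp [H.map_uniformizer]))
  refine ⟨-(e * v), ?_, ?_⟩
  · have h1 : 1 + ϖ * -(e * v) = v := by linear_combination -hv
    have h2 := congrArg σ hϖ
    simp only [map_pow, map_neg, map_sum, map_mul, AlgHom.commutes] at h2
    rw [show σ ϖ = ϖ * (1 + ϖ * e) by rw [h]; ring] at h2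
    have h3 : ϖ ^ p ^ 2 =
        -∑ i ∈ Icc 1 (p ^ 2), algebraMap A B (f i) * ϖ ^ (p ^ 2 - i) * v ^ i := by
      have h4 := congrArg (· * v ^ p ^ 2) h2
      rw [mul_pow, mul_assoc, ← mul_pow, hv, one_pow, mul_one] at h4
      rw [h4, neg_mul, sum_mul]
      congr 1
      refine sum_congr rfl fun i hi => ?_
      rw [mem_Icc] at hi
      have h5 : v ^ p ^ 2 = v ^ (p ^ 2 - i) * v ^ i := by
        rw [← pow_add, Nat.sub_add_cancel hi.2]
      rw [h5, mul_pow]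
      have h6 : (1 + ϖ * e) ^ (p ^ 2 - i) * v ^ (p ^ 2 - i) = 1 := by
        rw [← mul_pow, hv, one_pow]
      linear_combination algebraMap A B (f i) * ϖ ^ (p ^ 2 - i) * v ^ i * h6
    rw [shiftSum, h1]
    simp only [Function.comp_apply, mul_sub, mul_one, sum_sub_distrib]
    linear_combination h3 - hϖ
  · rw [map_neg, neg_ne_zero, map_mul]
    refine mul_ne_zero he fun h0 => ?_
    have := congrArg r hv
    rw [map_mul, h0, mul_zero, map_one] at this
    exact zero_ne_one this

theorem exists_shiftSum_eq_zero_of_prod_eq {f : ℕ → A}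
    (hϖ : ϖ ^ p ^ 2 = -∑ i ∈ Icc 1 (p ^ 2), algebraMap A B (f i) * ϖ ^ (p ^ 2 - i))
    (hσ : (σ ^ p ^ 2) ϖ = ϖ) (hprod : ∏ j ∈ Ico 1 (p ^ 2), (ϖ - (σ ^ j) ϖ) =
      ∑ i ∈ range (p ^ 2), algebraMap A B (derivCoeff p f i) * ϖ ^ i) :
    ((∀ i, 1 ≤ i → i < p → (p : A) ^ 2 ∣ f i) ∧
      ((p : A) ^ 2 ∣ f (p + 1) ∧ ¬(p : A) ^ 3 ∣ f (p + 1)) ∧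
      ∀ i, p + 2 ≤ i → i < p ^ 2 → ¬p ∣ i → (p : A) ^ 3 ∣ f i) ∧
    ∃ s, shiftSum p ϖ (algebraMap A B ∘ f) s = 0 ∧ r s ≠ 0 := by
  have hp := H.two_lt
  have hne : ∀ j, 1 ≤ j → j < p ^ 2 → (σ ^ j) ϖ ≠ ϖ := by
    intro j hj hj' h
    refine H.sum_derivCoeff_ne_zero f ?_
    rw [← hprod]
    exact prod_eq_zero (mem_Ico.2 ⟨hj, hj'⟩) (by rw [h, sub_self])
  obtain ⟨t, t', e, e', ht, htt', hdvd, he, he', h1, h2⟩ := H.exists_breaks hσ hne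
  obtain ⟨u, hu, h3⟩ := H.exists_prod_eq ht (by omega) he he' h1 h2
  have hlt := H.lt_of_pow_dvd_sum_derivCoeff (f := f) (hprod ▸ h3 ▸ dvd_mul_right _ _)
  obtain ⟨q, hq⟩ := Nat.exists_eq_add_of_le hp
  obtain ⟨d, hd⟩ := hdvd
  have hd1 : 1 ≤ d := by
    by_contra hd0
    rw [show d = 0 by omega, mul_zero] at hd
    omega
  have hsub : p ^ 2 - p = (p - 1) * p := by rw [Nat.sub_mul, sq, one_mul]
  have ht1 : t = 1 ∧ d = 1 := by
    rw [hsub, show p - 1 = q + 2 by omega, show t' = t + p * d by omega] at hlt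
    subst hq
    obtain ⟨t, rfl⟩ := Nat.exists_eq_add_of_le ht
    obtain ⟨d, rfl⟩ := Nat.exists_eq_add_of_le hd1
    constructor
    · by_contra h0
      obtain ⟨t, rfl⟩ := Nat.exists_eq_add_of_le (show 1 ≤ t by omega)
      ring_nf at hlt
      have := Nat.zero_le (q * t)
      have := Nat.zero_le (q ^ 2 * t)
      have := Nat.zero_le (q * d)
      have := Nat.zero_le (q ^ 2 * d)
      omega
    · by_contra h0
      obtain ⟨d, rfl⟩ := Nat.exists_eq_add_of_le (show 1 ≤ d by omega)
      ring_nf at hlt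
      have := Nat.zero_le (q * t)
      have := Nat.zero_le (q ^ 2 * t)
      have := Nat.zero_le (q * d)
      have := Nat.zero_le (q ^ 2 * d)
      omega
  obtain ⟨rfl, rfl⟩ := ht1
  have hN : (p - 1) * (t' + 1) + (p ^ 2 - p) * (1 + 1) = 3 * p ^ 2 - p - 2 := by
    rw [hsub, show p - 1 = q + 2 by omega, show t' = 1 + p by omega]
    subst hq
    refine (Nat.sub_eq_of_eq_add (Nat.sub_eq_of_eq_add ?_)).symm
    ring
  rw [hN, hprod] at h3
  exact ⟨H.valuation_conditions hu h3, H.exists_shiftSum_eq_zero_of_map hϖ he h1⟩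

end IsTotRamified

namespace IsTotRamified

variable {p : ℕ} {A B κ : Type*} [CommRing A] [CommRing B] [IsDomain B] [Algebra A B] [Field κ]
  {ρ : A →+* κ} {r : B →+* κ} {ϖ : B} (H : IsTotRamified p ρ r ϖ) {σ : B →ₐ[A] B}

include H

theorem pow_dvd_sum_derivCoeff {f : ℕ → A} (hfp : ∀ i, 1 ≤ i → i ≤ p ^ 2 → (p : A) ∣ f i)
    (h1 : ∀ i, 1 ≤ i → i < p ^ 2 → i ≠ p → (p : A) ^ 2 ∣ f i)
    (h2 : ∀ i, p + 2 ≤ i → i < p ^ 2 → ¬p ∣ i → (p : A) ^ 3 ∣ f i) :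
    ϖ ^ (3 * p ^ 2 - p - 2) ∣
      ∑ i ∈ range (p ^ 2), algebraMap A B (derivCoeff p f i) * ϖ ^ i := by
  have hp := H.two_lt
  have hpp : p + 2 < p ^ 2 := by nlinarith
  refine dvd_sum fun i hi => ?_
  rw [mem_range] at hi
  have key : ∀ k, (p : A) ^ k ∣ derivCoeff p f i → 3 * p ^ 2 ≤ p ^ 2 * k + i + p + 2 →
      ϖ ^ (3 * p ^ 2 - p - 2) ∣ algebraMap A B (derivCoeff p f i) * ϖ ^ i := by
    intro k hk hle
    have h := mul_dvd_mul_right (H.pow_dvd_algebraMap_of_dvd hk) (ϖ ^ i)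
    rw [← pow_add] at h
    refine (pow_dvd_pow _ ?_).trans h
    omega
  by_cases hi' : i + 1 = p ^ 2
  · refine key 2 ?_ (by omega)
    rw [derivCoeff, hi', Nat.cast_pow]
    exact dvd_mul_right _ _
  obtain ⟨m, hm, hm', rfl⟩ : ∃ m, 1 ≤ m ∧ m < p ^ 2 ∧ i = p ^ 2 - m - 1 :=
    ⟨p ^ 2 - i - 1, by omega, by omega, by omega⟩
  rw [derivCoeff_eq f hm hm'] at key
  rw [derivCoeff_eq f hm hm']
  by_cases hpm : p ∣ m
  · have h3 : (p : A) ∣ ((p ^ 2 - m : ℕ) : A) :=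
      Nat.cast_dvd_cast ((Nat.dvd_sub_iff_left hm'.le hpm).2 (dvd_pow_self p two_ne_zero))
    by_cases hmp : m = p
    · refine key 2 ?_ (by omega)
      rw [sq]
      exact mul_dvd_mul h3 (hfp m hm hm'.le)
    · refine key 3 ?_ (by omega)
      rw [pow_succ']
      exact mul_dvd_mul h3 (h1 m hm hm' hmp)
  · have hmp : m ≠ p := fun h => hpm h.symm.dvd
    by_cases hm2 : p + 2 ≤ m
    · exact key 3 ((h2 m hm2 hm' hpm).mul_left _) (by omega)
    · exact key 2 ((h1 m hm hm' hmp).mul_left _) (by omega)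

theorem exists_sum_derivCoeff_eq {f : ℕ → A} (hfp : ∀ i, 1 ≤ i → i ≤ p ^ 2 → (p : A) ∣ f i)
    (h1 : ∀ i, 1 ≤ i → i < p ^ 2 → i ≠ p → (p : A) ^ 2 ∣ f i)
    (h2 : ∀ i, p + 2 ≤ i → i < p ^ 2 → ¬p ∣ i → (p : A) ^ 3 ∣ f i) {e : B}
    (h : σ ϖ = ϖ + ϖ ^ 2 * e) (he : r e ≠ 0) :
    ∑ j ∈ range p, (σ ^ j) ϖ ≠ 0 ∧ ∃ y : B,
      ∑ i ∈ range (p ^ 2), algebraMap A B (derivCoeff p f i) * ϖ ^ i =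
        p ^ 2 * (∑ j ∈ range p, (σ ^ j) ϖ) * y := by
  have hp := H.two_lt
  obtain ⟨w, hw, hr⟩ := H.exists_sum_pow_map_eq h he
  have hw0 : w ≠ 0 := fun h0 => hr (by rw [h0, map_zero])
  refine ⟨hw ▸ mul_ne_zero (pow_ne_zero _ H.ne_zero) hw0, ?_⟩
  rw [hw]
  have h3 : Associated ((p : B) ^ 2 * (ϖ ^ p * w)) (ϖ ^ (p ^ 2 * 2) * ϖ ^ p) := by
    rw [pow_mul]
    exact H.associated.pow_pow.mul_mul (associated_mul_unit_left _ _ (H.isUnit w hr))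
  rw [← pow_add] at h3
  refine h3.dvd_iff_dvd_left.2 ((pow_dvd_pow _ ?_).trans (H.pow_dvd_sum_derivCoeff hfp h1 h2))
  obtain ⟨q, rfl⟩ := Nat.exists_eq_add_of_le hp
  ring_nf
  have := Nat.zero_le (q ^ 2)
  omega

end IsTotRamified

section

variable {A : Type*} [CommRing A] {p : ℕ} {f : ℕ → A}

/-- The polynomial `X ^ n + ∑ f i * X ^ (n - i)`, where `n = p ^ 2`. -/
noncomputable def eisPoly (p : ℕ) (f : ℕ → A) : A[X] :=
  X ^ p ^ 2 + ∑ i ∈ range (p ^ 2), C (f (i + 1)) * X ^ (p ^ 2 - (i + 1))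

theorem coeff_eisPoly_of_lt {m : ℕ} (hm : m < p ^ 2) : (eisPoly p f).coeff m = f (p ^ 2 - m) := by
  rw [eisPoly, coeff_add, coeff_X_pow, if_neg hm.ne, zero_add, finsetSum_coeff,
    sum_eq_single (p ^ 2 - m - 1)]
  · rw [coeff_C_mul, coeff_X_pow, if_pos (by omega), mul_one]
    congr 1
    omega
  · intro i hi him
    rw [mem_range] at hi
    rw [coeff_C_mul, coeff_X_pow, if_neg (by omega), mul_zero]
  · intro h
    exact absurd (mem_range.2 (by omega)) h

theorem degree_eisPoly_tail (hp : p ≠ 0) :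
    (∑ i ∈ range (p ^ 2), C (f (i + 1)) * X ^ (p ^ 2 - (i + 1))).degree <
      ((p ^ 2 : ℕ) : WithBot ℕ) := by
  have := pow_pos (Nat.pos_of_ne_zero hp) 2
  refine (degree_sum_le _ _).trans_lt ?_
  rw [Finset.sup_lt_iff (WithBot.bot_lt_coe _)]
  intro i hi
  refine (degree_C_mul_X_pow_le _ _).trans_lt ?_
  exact_mod_cast show p ^ 2 - (i + 1) < p ^ 2 by omega

theorem monic_eisPoly (hp : p ≠ 0) : (eisPoly p f).Monic :=
  monic_X_pow_add (degree_eisPoly_tail hp)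

theorem natDegree_eisPoly [Nontrivial A] (hp : p ≠ 0) : (eisPoly p f).natDegree = p ^ 2 := by
  rw [eisPoly, natDegree_add_eq_left_of_degree_lt, natDegree_X_pow]
  rw [degree_X_pow]
  exact degree_eisPoly_tail hp

theorem coeff_eisPoly_sq [Nontrivial A] (hp : p ≠ 0) : (eisPoly p f).coeff (p ^ 2) = 1 := by
  have h := (monic_eisPoly (f := f) hp).coeff_natDegree
  rwa [natDegree_eisPoly hp] at h

theorem aeval_eisPoly {B : Type*} [CommRing B] [Algebra A B] (x : B) :
    aeval x (eisPoly p f) =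
      x ^ p ^ 2 + ∑ i ∈ Icc 1 (p ^ 2), algebraMap A B (f i) * x ^ (p ^ 2 - i) := by
  rw [eisPoly, ← Ico_add_one_right_eq_Icc, sum_Ico_eq_sum_range]
  simp [add_comm 1]

theorem aeval_derivative_eisPoly [Nontrivial A] (hp : p ≠ 0) {B : Type*} [CommRing B]
    [Algebra A B] (x : B) : aeval x (derivative (eisPoly p f)) =
      ∑ i ∈ range (p ^ 2), algebraMap A B (derivCoeff p f i) * x ^ i := by
  have := pow_pos (Nat.pos_of_ne_zero hp) 2
  rw [aeval_eq_sum_range' (n := p ^ 2)]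
  · refine sum_congr rfl fun i hi => ?_
    rw [mem_range] at hi
    rw [Algebra.smul_def, coeff_derivative, derivCoeff]
    split_ifs with h
    · rw [h, coeff_eisPoly_sq hp, ← h]
      push_cast
      ring
    · rw [coeff_eisPoly_of_lt (by omega)]
      push_cast
      ring
  · refine (natDegree_derivative_lt ?_).trans_eq (natDegree_eisPoly hp)
    rw [natDegree_eisPoly hp]
    exact this.ne'

theorem irreducible_eisPoly [IsDomain A] (hp : p ≠ 0) (hprime : Prime (p : A))
    (hfp : ∀ i, 1 ≤ i → i ≤ p ^ 2 → (p : A) ∣ f i) (hf : ¬(p : A) ^ 2 ∣ f (p ^ 2)) :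
    Irreducible (eisPoly p f) := by
  have h0 := pow_pos (Nat.pos_of_ne_zero hp) 2
  refine IsEisensteinAt.irreducible (𝓟 := Ideal.span {(p : A)}) ⟨?_, fun {m} hm => ?_, ?_⟩
    ((Ideal.span_singleton_prime hprime.ne_zero).2 hprime) (monic_eisPoly hp).isPrimitive ?_
  · rw [(monic_eisPoly hp).leadingCoeff, Ideal.mem_span_singleton]
    exact fun h => hprime.not_isUnit (isUnit_of_dvd_one h)
  · rw [natDegree_eisPoly hp] at hm
    rw [coeff_eisPoly_of_lt hm, Ideal.mem_span_singleton]
    exact hfp _ (by omega) (by omega)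
  · rwa [coeff_eisPoly_of_lt h0, Ideal.span_singleton_pow, Ideal.mem_span_singleton, Nat.sub_zero]
  · rwa [natDegree_eisPoly hp]

theorem minpoly_eq_eisPoly [IsDomain A] [IsIntegrallyClosed A] (hp : p ≠ 0)
    (hprime : Prime (p : A)) (hfp : ∀ i, 1 ≤ i → i ≤ p ^ 2 → (p : A) ∣ f i)
    (hf : ¬(p : A) ^ 2 ∣ f (p ^ 2)) {L : Type*} [CommRing L] [IsDomain L] [Algebra A L]
    [Module.IsTorsionFree A L] {x : L} (hx : aeval x (eisPoly p f) = 0) :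
    minpoly A x = eisPoly p f := by
  have hint : IsIntegral A x := ⟨_, monic_eisPoly hp, hx⟩
  refine eq_of_monic_of_associated (minpoly.monic hint) (monic_eisPoly hp) ?_
  obtain ⟨d, hd⟩ := minpoly.isIntegrallyClosed_dvd hint hx
  have hu := ((irreducible_eisPoly hp hprime hfp hf).isUnit_or_isUnit hd).resolve_left
    (minpoly.not_isUnit A x)
  exact ⟨hu.unit, hd.symm⟩

theorem exists_isTotRamified [IsDomain A] [IsNoetherianRing A] {B κ : Type*} [CommRing B]
    [IsDomain B] [Algebra A B] [Field κ] {ρ : A →+* κ} (hp : p.Prime) (hp2 : 2 < p)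
    (hloc : ∀ x : A, ¬IsUnit x → (p : A) ∣ x) (hρ : Function.Surjective ρ)
    (hker : ∀ x, ρ x = 0 ↔ (p : A) ∣ x) (h0 : (p : B) ≠ 0)
    (hfp : ∀ i, 1 ≤ i → i ≤ p ^ 2 → (p : A) ∣ f i) (hf : ¬(p : A) ^ 2 ∣ f (p ^ 2))
    (pb : PowerBasis A B) (hpb : minpoly A pb.gen = eisPoly p f) :
    ∃ r : B →+* κ, IsTotRamified p ρ r pb.gen := by
  have hn := pow_pos hp.pos 2
  have := pb.finite
  let := ρ.toAlgebra
  have hlift : aeval (0 : κ) (minpoly A pb.gen) = 0 := by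
    rw [hpb, ← coeff_zero_eq_aeval_zero', coeff_eisPoly_of_lt hn]
    exact (hker _).2 (hfp _ (by omega) le_rfl)
  set r := pb.lift (0 : κ) hlift with hr
  have hrϖ : r pb.gen = 0 := pb.lift_gen _ _
  have hrι : ∀ x, r (algebraMap A B x) = ρ x := fun x => r.commutes x
  have hdec : ∀ x : B, ∃ (c : A) (y : B), x = algebraMap A B c + pb.gen * y := by
    intro x
    obtain ⟨g, rfl⟩ := pb.exists_eq_aeval' x
    refine ⟨g.coeff 0, aeval pb.gen g.divX, ?_⟩
    conv_lhs => rw [← divX_mul_X_add g]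
    simp only [map_add, map_mul, aeval_X, aeval_C]
    ring
  have hunit : ∀ x, r x ≠ 0 → IsUnit x := by
    intro x hx
    obtain ⟨c, y, rfl⟩ := hdec x
    by_contra hnu
    obtain ⟨M, hM, hmem⟩ := exists_max_ideal_of_mem_nonunits hnu
    have hMA := Ideal.isMaximal_comap_of_isIntegral_of_isMaximal (R := A) M
    have hpM : (p : B) ∈ M := by
      have h1 : ¬IsUnit (p : A) := by
        intro hu
        have h2 := hu.map ρ
        rw [(hker _).2 dvd_rfl] at h2
        exact not_isUnit_zero h2
      by_contra hpM
      have h2 : (p : A) ∉ M.comap (algebraMap A B) := by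
        rwa [Ideal.mem_comap, map_natCast]
      obtain ⟨z, m, hm, hz⟩ := hMA.exists_inv h2
      have h3 : m ∈ Ideal.span {(p : A)} := by
        refine Ideal.mem_span_singleton.2 (hloc m fun hu => hMA.ne_top ?_)
        exact Ideal.eq_top_of_isUnit_mem _ hm hu
      refine h1 (isUnit_of_dvd_one ?_)
      rw [← hz]
      exact dvd_add (dvd_mul_left _ _) (Ideal.mem_span_singleton.1 h3)
    have hϖM : pb.gen ∈ M := by
      refine hM.isPrime.mem_of_pow_mem (p ^ 2) ?_
      have h1 := aeval_eisPoly (p := p) (f := f) pb.gen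
      rw [← hpb, minpoly.aeval] at h1
      rw [eq_neg_of_add_eq_zero_left h1.symm]
      refine M.neg_mem (M.sum_mem fun i hi => M.mul_mem_right _ ?_)
      rw [mem_Icc] at hi
      exact M.mem_of_dvd (natCast_dvd_algebraMap (hfp i hi.1 hi.2)) hpM
    have hc : algebraMap A B c ∈ M := (M.add_mem_iff_left (M.mul_mem_right _ hϖM)).1 hmem
    have hcu : IsUnit c := by
      by_contra hcu
      apply hx
      rw [map_add, map_mul, hrϖ, zero_mul, add_zero, hrι]
      exact (hker c).2 (hloc c hcu)
    exact hM.ne_top (Ideal.eq_top_of_isUnit_mem _ hc (hcu.map _))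
  have hass : Associated (p : B) (pb.gen ^ p ^ 2) := by
    have h1 := aeval_eisPoly (p := p) (f := f) pb.gen
    rw [← hpb, minpoly.aeval] at h1
    have h2 : ∀ i, ∃ b, 1 ≤ i ∧ i ≤ p ^ 2 → f i = p * b := by
      intro i
      by_cases hi : 1 ≤ i ∧ i ≤ p ^ 2
      · obtain ⟨b, hb⟩ := hfp i hi.1 hi.2
        exact ⟨b, fun _ => hb⟩
      · exact ⟨0, fun h => absurd h hi⟩
    choose b hb using h2
    have hu : IsUnit (-∑ i ∈ Icc 1 (p ^ 2), algebraMap A B (b i) * pb.gen ^ (p ^ 2 - i)) := by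
      apply hunit
      rw [map_neg, neg_ne_zero, map_sum, sum_eq_single (p ^ 2)]
      · rw [Nat.sub_self, pow_zero, mul_one, hrι, Ne, hker]
        intro h
        apply hf
        rw [hb (p ^ 2) ⟨hn, le_rfl⟩, sq]
        exact mul_dvd_mul_left _ h
      · intro i hi hi'
        rw [mem_Icc] at hi
        rw [map_mul, map_pow, hrϖ, zero_pow (by omega), mul_zero]
      · intro h
        exact absurd (mem_Icc.2 ⟨hn, le_rfl⟩) h
    refine ⟨hu.unit, ?_⟩
    rw [hu.unit_spec, eq_neg_of_add_eq_zero_left h1.symm, mul_neg, mul_sum]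
    congr 1
    refine sum_congr rfl fun i hi => ?_
    rw [mem_Icc] at hi
    rw [hb i hi, map_mul, map_natCast, mul_assoc]
  have hdvd : ∀ x, r x = 0 ↔ pb.gen ∣ x := by
    intro x
    constructor
    · intro h
      obtain ⟨c, y, rfl⟩ := hdec x
      rw [map_add, map_mul, hrϖ, zero_mul, add_zero, hrι, hker] at h
      refine dvd_add ?_ (dvd_mul_right _ _)
      exact ((dvd_pow_self _ hn.ne').trans hass.symm.dvd).trans (natCast_dvd_algebraMap h)
    · rintro ⟨y, rfl⟩
      rw [map_mul, hrϖ, zero_mul]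
  have hϖ0 : pb.gen ≠ 0 := by
    intro h
    rw [h, zero_pow hn.ne', associated_zero_iff_eq_zero] at hass
    exact h0 hass
  have : IsNoetherianRing B := IsNoetherianRing.of_finite A B
  refine ⟨r, hp, hp2, hrι, hρ, hker, hdvd, hunit, hass, hϖ0, fun x hx => ?_⟩
  obtain ⟨k, u, hu, h⟩ := WfDvdMonoid.max_power_factor' hx (x := pb.gen) (fun h => by
    have := h.map r
    rw [hrϖ] at this
    exact not_isUnit_zero this)
  exact ⟨k, u, fun h => hu ((hdvd u).1 h), h⟩

end

section Extension

variable {A K L : Type*} [CommRing A] [Field K] [Algebra A K] [Field L] [Algebra K L] [Algebra A L]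
  [IsScalarTower A K L] {π : L}

/-- The element `x` of the ring `A[x]`. -/
abbrev adjoinGen (A : Type*) {L : Type*} [CommRing A] [Field L] [Algebra A L] (x : L) :
    Algebra.adjoin A {x} :=
  ⟨x, Algebra.self_mem_adjoin_singleton A x⟩

theorem coe_pow_apply {σ : L ≃ₐ[K] L} {τ : Algebra.adjoin A {π} →ₐ[A] Algebra.adjoin A {π}}
    (h : (τ (adjoinGen A π) : L) = σ π) (j : ℕ) (x : Algebra.adjoin A {π}) :
    ((τ ^ j) x : L) = (σ ^ j) x := by
  have h1 : ∀ x, (τ x : L) = σ x := by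
    intro x
    obtain ⟨g, hg⟩ := (Algebra.adjoin_singleton_eq_range_aeval A π).le x.2
    rw [AlgHom.toRingHom_eq_coe, AlgHom.coe_toRingHom] at hg
    have h2 : x = aeval (adjoinGen A π) g := by
      apply Subtype.ext
      rw [← hg, ← Subalgebra.coe_val, ← aeval_algHom_apply]
      rfl
    have h3 : (x : L) = aeval π g := hg.symm
    rw [h3, h2, ← aeval_algHom_apply, ← Subalgebra.coe_val, ← aeval_algHom_apply,
      Subalgebra.coe_val, h]
    exact aeval_algHom_apply (σ.toAlgHom.restrictScalars A) π g
  induction j with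
  | zero => rfl
  | succ j ih => rw [pow_succ', pow_succ', AlgHom.mul_apply, h1, ih]; rfl

variable [IsDomain A] [IsIntegrallyClosed A] [IsFractionRing A K]

theorem map_minpoly_eq (hint : IsIntegral A π) :
    minpoly K π = (minpoly A π).map (algebraMap A K) :=
  minpoly.isIntegrallyClosed_eq_field_fractions' K hint

variable [CharZero K] [FiniteDimensional K L] {p : ℕ} {f : ℕ → A}

theorem exists_algEquiv (hint : IsIntegral A π) (hgen : Algebra.adjoin K {π} = ⊤) {y : L}
    (hy : aeval y (minpoly A π) = 0) : ∃ σ : L ≃ₐ[K] L, σ π = y := by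
  have hπ : IsIntegral K π := hint.tower_top
  let pb := PowerBasis.ofAdjoinEqTop hπ hgen
  have hg : pb.gen = π := PowerBasis.ofAdjoinEqTop_gen hπ hgen
  have h1 : aeval y (minpoly K pb.gen) = 0 := by
    rw [hg, map_minpoly_eq hint, aeval_map_algebraMap, hy]
  refine ⟨AlgEquiv.ofBijective (pb.lift y h1) (Algebra.IsAlgebraic.algHom_bijective _), ?_⟩
  rw [AlgEquiv.coe_ofBijective]
  conv_lhs => rw [← hg]
  exact pb.lift_gen y h1

theorem trace_div_mem (hint : IsIntegral A π) (hgen : Algebra.adjoin K {π} = ⊤)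
    (y : Algebra.adjoin A {π}) :
    ∃ c : A, Algebra.trace K L (y / aeval π (derivative (minpoly A π))) = algebraMap A K c := by
  have h := traceForm_dualSubmodule_adjoin A K hgen hint
  have h1 : (aeval π (derivative (minpoly K π)))⁻¹ • (y : L) ∈
      (Algebra.traceForm K L).dualSubmodule (Subalgebra.toSubmodule (Algebra.adjoin A {π})) := by
    rw [h]
    exact Submodule.smul_mem_pointwise_smul _ _ _ y.2
  rw [LinearMap.BilinForm.mem_dualSubmodule] at h1
  obtain ⟨c, hc⟩ := Submodule.mem_one.1 (h1 1 (one_mem (Algebra.adjoin A {π})))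
  refine ⟨c, ?_⟩
  rw [hc, Algebra.traceForm_apply, mul_one, map_minpoly_eq hint, derivative_map,
    aeval_map_algebraMap, smul_eq_mul, div_eq_inv_mul]

end Extension

section Extension

variable {A K L : Type*} [CommRing A] [Field K] [Algebra A K] [Field L] [Algebra K L] [Algebra A L]
  [IsScalarTower A K L] {π : L} {p : ℕ} {f : ℕ → A}

theorem minpoly_adjoinGen : minpoly A (adjoinGen A π) = minpoly A π :=
  (minpoly.algHom_eq (Algebra.adjoin A {π}).val Subtype.val_injective (adjoinGen A π)).symm

theorem coe_aeval_adjoinGen (g : A[X]) : (aeval (adjoinGen A π) g : L) = aeval π g :=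
  (aeval_algHom_apply (Algebra.adjoin A {π}).val (adjoinGen A π) g).symm

theorem exists_algHom_adjoin [IsDomain A] [IsIntegrallyClosed A] [Module.IsTorsionFree A L]
    (hint : IsIntegral A π) {y : Algebra.adjoin A {π}} (hy : aeval y (minpoly A π) = 0) :
    ∃ τ : Algebra.adjoin A {π} →ₐ[A] Algebra.adjoin A {π}, τ (adjoinGen A π) = y := by
  let pb := Algebra.adjoin.powerBasis' hint
  have hg : pb.gen = adjoinGen A π := Algebra.adjoin.powerBasis'_gen hint
  have h : aeval y (minpoly A pb.gen) = 0 := by rw [hg, minpoly_adjoinGen, hy]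
  exact ⟨pb.lift y h, by rw [← hg, pb.lift_gen]⟩

theorem isEisensteinAt_eisPoly [Nontrivial A] (hp : p ≠ 0) (hp1 : ¬IsUnit (p : A))
    (hfp : ∀ i, 1 ≤ i → i ≤ p ^ 2 → (p : A) ∣ f i) (hf : ¬(p : A) ^ 2 ∣ f (p ^ 2)) :
    (eisPoly p f).IsEisensteinAt (Ideal.span {(p : A)}) := by
  have hn := Nat.pos_of_ne_zero (pow_ne_zero 2 hp)
  refine ⟨?_, fun {m} hm => ?_, ?_⟩
  · rw [monic_eisPoly hp, ← Ideal.ne_top_iff_one, Ne, Ideal.span_singleton_eq_top]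
    exact hp1
  · rw [natDegree_eisPoly hp] at hm
    rw [Ideal.mem_span_singleton, coeff_eisPoly_of_lt hm]
    exact hfp _ (by omega) (by omega)
  · rwa [Ideal.span_singleton_pow, Ideal.mem_span_singleton, coeff_eisPoly_of_lt hn]

variable [IsDomain A] [IsIntegrallyClosed A] [IsFractionRing A K] [CharZero K]
  [FiniteDimensional K L]

theorem mem_adjoin_of_isIntegral (hp : Prime (p : A)) (hdvd : ∀ d : A, d ≠ 0 → ∃ m, d ∣ p ^ m)
    (hint : IsIntegral A π) (hgen : Algebra.adjoin K {π} = ⊤)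
    (hei : (minpoly A π).IsEisensteinAt (Ideal.span {(p : A)})) {z : L} (hz : IsIntegral A z) :
    z ∈ Algebra.adjoin A {π} := by
  let pb := PowerBasis.ofAdjoinEqTop (hint.tower_top (A := K)) hgen
  have hg : pb.gen = π := PowerBasis.ofAdjoinEqTop_gen _ hgen
  have hint' : IsIntegral A pb.gen := by rwa [hg]
  have hd : IsIntegral A (Algebra.discr K pb.basis) :=
    Algebra.discr_isIntegral K fun i => by
      rw [pb.basis_eq_pow]
      exact hint'.pow _
  obtain ⟨d, hd'⟩ := IsIntegrallyClosed.isIntegral_iff.1 hd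
  have hd0 : d ≠ 0 := by
    rintro rfl
    exact Algebra.discr_not_zero_of_basis K pb.basis (by rw [← hd', map_zero])
  obtain ⟨m, e, he⟩ := hdvd d hd0
  have h1 := Algebra.discr_mul_isIntegral_mem_adjoin K hint' hz
  have h2 : ((p : A) ^ m) • z ∈ Algebra.adjoin A {pb.gen} := by
    rw [he, mul_comm, mul_smul]
    refine Subalgebra.smul_mem _ ?_ e
    rwa [← hd', algebraMap_smul] at h1
  rw [← hg]
  exact mem_adjoin_of_smul_prime_pow_smul_of_minpoly_isEisensteinAt hp hint' hz h2 (by rwa [hg])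

end Extension

section Galois

variable {K L : Type*} [Field K] [Field L] [Algebra K L] {π : L}

theorem algEquiv_ext_of_adjoin_eq_top (hgen : Algebra.adjoin K {π} = ⊤) {σ τ : L ≃ₐ[K] L}
    (h : σ π = τ π) : σ = τ := by
  apply AlgEquiv.coe_toAlgHom_injective
  exact AlgHom.ext_of_adjoin_eq_top hgen fun x hx => by
    rw [Set.mem_singleton_iff.1 hx]
    exact h

theorem finrank_eq_natDegree_minpoly (hint : IsIntegral K π) (hgen : Algebra.adjoin K {π} = ⊤) :
    Module.finrank K L = (minpoly K π).natDegree := by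
  have h := (PowerBasis.ofAdjoinEqTop hint hgen).natDegree_minpoly
  rw [PowerBasis.ofAdjoinEqTop_gen] at h
  rw [h, PowerBasis.finrank]

theorem prod_sub_pow_apply (hint : IsIntegral K π) (hgen : Algebra.adjoin K {π} = ⊤)
    {σ : L ≃ₐ[K] L} (hσ : orderOf σ = Module.finrank K L) :
    ∏ j ∈ Ico 1 (orderOf σ), (π - (σ ^ j) π) = aeval π (derivative (minpoly K π)) := by
  have hpos : 0 < orderOf σ := by
    rw [hσ, finrank_eq_natDegree_minpoly hint hgen]
    exact minpoly.natDegree_pos hint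
  have h1 : (minpoly K π).map (algebraMap K L) =
      ∏ j ∈ range (orderOf σ), (X - C ((σ ^ j) π)) := by
    refine eq_of_monic_of_dvd_of_natDegree_le (monic_prod_of_monic _ _ fun j _ => monic_X_sub_C _)
      ((minpoly.monic hint).map _) ?_ ?_
    · refine prod_dvd_of_coprime (fun i hi j hj hij => ?_) fun j _ => ?_
      · refine isCoprime_X_sub_C_of_isUnit_sub (sub_ne_zero_of_ne fun h => hij ?_).isUnit
        exact pow_injOn_Iio_orderOf (by simpa using hi) (by simpa using hj)
          (algEquiv_ext_of_adjoin_eq_top hgen h)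
      · rw [dvd_iff_isRoot, IsRoot.def, eval_map_algebraMap]
        have := aeval_algHom_apply (σ ^ j : L ≃ₐ[K] L).toAlgHom π (minpoly K π)
        rw [minpoly.aeval, map_zero] at this
        exact this
    · rw [natDegree_map, natDegree_prod_of_monic _ _ fun j _ => monic_X_sub_C _]
      simp [hσ, finrank_eq_natDegree_minpoly hint hgen]
  rw [← eval_map_algebraMap, ← derivative_map, h1, range_eq_Ico, prod_eq_prod_Ico_succ_bot hpos]
  simp [eval_prod]

theorem isGalois_and_isCyclic_of_orderOf_eq [FiniteDimensional K L] {σ : L ≃ₐ[K] L}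
    (h : orderOf σ = Module.finrank K L) : IsGalois K L ∧ IsCyclic (L ≃ₐ[K] L) := by
  have h1 : Nat.card (L ≃ₐ[K] L) = Module.finrank K L := by
    apply le_antisymm
    · have := IntermediateField.finrank_fixedField_eq_card (⊤ : Subgroup (L ≃ₐ[K] L))
      rw [Subgroup.card_top] at this
      rw [← this]
      exact Nat.le_of_dvd Module.finrank_pos (Dvd.intro_left _ (Module.finrank_mul_finrank K _ L))
    · rw [← h]
      exact Nat.le_of_dvd Nat.card_pos (orderOf_dvd_natCard σ)
  exact ⟨IsGalois.of_card_aut_eq_finrank K L h1, isCyclic_of_orderOf_eq_card σ (h.trans h1.symm)⟩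

theorem pow_finrank_eq_one [FiniteDimensional K L] (σ : L ≃ₐ[K] L) :
    σ ^ Module.finrank K L = 1 := by
  have := IntermediateField.finrank_fixedField_eq_card (⊤ : Subgroup (L ≃ₐ[K] L))
  rw [Subgroup.card_top] at this
  obtain ⟨m, hm⟩ : Nat.card (L ≃ₐ[K] L) ∣ Module.finrank K L := by
    rw [← this]
    exact Dvd.intro_left _ (Module.finrank_mul_finrank K _ L)
  rw [hm, pow_mul, pow_card_eq_one', one_pow]

/-- If `σ ^ p = 1` then the elements `c / ∑ j < p, σ ^ j x` have small trace. -/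
theorem natCast_mul_trace_div_sum {p : ℕ} {σ : L ≃ₐ[K] L} (hσ : σ ^ p = 1) (x : L) (c : K)
    (h : ∑ j ∈ range p, (σ ^ j) x ≠ 0) :
    p * Algebra.trace K L (x / (algebraMap K L c * ∑ j ∈ range p, (σ ^ j) x)) =
      Module.finrank K L * c⁻¹ := by
  set ν := ∑ j ∈ range p, (σ ^ j) x with hν
  have hfix : σ ν = ν := by
    have : ∑ j ∈ range p, (σ ^ (j + 1)) x = ν := by
      have h1 := sum_range_succ (fun j => (σ ^ j) x) p
      rw [sum_range_succ', hσ, pow_zero] at h1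
      exact add_right_cancel h1
    conv_rhs => rw [← this]
    rw [hν, map_sum]
    exact sum_congr rfl fun j _ => by rw [pow_succ']; rfl
  have hfix' : ∀ j, (σ ^ j) ν = ν := by
    intro j
    induction j with
    | zero => rfl
    | succ j ih => rw [pow_succ, AlgEquiv.mul_apply, hfix, ih]
  have h1 : ∀ j, Algebra.trace K L ((σ ^ j) x / (algebraMap K L c * ν)) =
      Algebra.trace K L (x / (algebraMap K L c * ν)) := by
    intro j
    have h2 : (σ ^ j) (x / (algebraMap K L c * ν)) = (σ ^ j) x / (algebraMap K L c * ν) := by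
      rw [map_div₀, map_mul, hfix', AlgEquiv.commutes]
    rw [← h2, Algebra.trace_eq_of_algEquiv]
  have h2 : ∑ j ∈ range p, (σ ^ j) x / (algebraMap K L c * ν) = algebraMap K L c⁻¹ := by
    rw [← sum_div, ← hν, map_inv₀, mul_comm, div_mul_cancel_left₀ h]
  have h3 := congrArg (Algebra.trace K L) h2
  rw [map_sum, sum_congr rfl fun j _ => h1 j, Algebra.trace_algebraMap] at h3
  simpa using h3

end Galois

theorem aeval_mul_eisPoly_eq_zero {A B : Type*} [CommRing A] [CommRing B] [Algebra A B] {p : ℕ}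
    {f : ℕ → A} {ϖ s v : B} (hv : (1 + ϖ * s) * v = 1) (hϖ : aeval ϖ (eisPoly p f) = 0)
    (hs : shiftSum p ϖ (algebraMap A B ∘ f) s = 0) : aeval (ϖ * v) (eisPoly p f) = 0 := by
  rw [aeval_eisPoly] at hϖ ⊢
  simp only [shiftSum, mul_sub, mul_one, sum_sub_distrib, Function.comp_apply] at hs
  have h1 : ∑ i ∈ Icc 1 (p ^ 2), algebraMap A B (f i) * (ϖ * v) ^ (p ^ 2 - i) =
      v ^ p ^ 2 * ∑ i ∈ Icc 1 (p ^ 2),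
        algebraMap A B (f i) * ϖ ^ (p ^ 2 - i) * (1 + ϖ * s) ^ i := by
    rw [mul_sum]
    refine sum_congr rfl fun i hi => ?_
    have h2 : v ^ p ^ 2 * (1 + ϖ * s) ^ i = v ^ (p ^ 2 - i) := by
      rw [← pow_sub_mul_pow v (mem_Icc.1 hi).2, mul_assoc, ← mul_pow, mul_comm v, hv, one_pow,
        mul_one]
    rw [mul_pow, ← h2]
    ring
  rw [h1, mul_pow]
  linear_combination v ^ p ^ 2 * (hs + hϖ)

theorem isTorsionFree_of_tower {A : Type*} (K : Type*) {L : Type*} [CommRing A] [IsDomain A]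
    [Field K] [Algebra A K] [IsFractionRing A K] [Field L] [Algebra K L] [Algebra A L]
    [IsScalarTower A K L] : Module.IsTorsionFree A L := by
  rw [Module.isTorsionFree_iff_algebraMap_injective, IsScalarTower.algebraMap_eq A K L]
  exact (algebraMap K L).injective.comp (IsFractionRing.injective A K)

theorem aeval_adjoinGen_eisPoly {A L : Type*} [CommRing A] [Field L] [Algebra A L] {p : ℕ}
    {f : ℕ → A} {π : L} (hπ : aeval π (eisPoly p f) = 0) :
    aeval (adjoinGen A π) (eisPoly p f) = 0 := by
  apply Subtype.ext
  rw [coe_aeval_adjoinGen, hπ]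
  rfl

namespace IsTotRamified

variable {A K L κ : Type*} [CommRing A] [IsDomain A] [IsIntegrallyClosed A] [Field K] [CharZero K]
  [Algebra A K] [IsFractionRing A K] [Field L] [Algebra K L] [FiniteDimensional K L] [Algebra A L]
  [IsScalarTower A K L] [Field κ] {p : ℕ} {ρ : A →+* κ} {π : L}
  {r : Algebra.adjoin A {π} →+* κ} (H : IsTotRamified p ρ r (adjoinGen A π)) {f : ℕ → A}
include H

theorem exists_shiftSum_eq_zero_of_isCyclic [IsGalois K L] [IsCyclic (L ≃ₐ[K] L)]
    (hp : Prime (p : A)) (hdvd : ∀ d : A, d ≠ 0 → ∃ m, d ∣ p ^ m)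
    (hfp : ∀ i, 1 ≤ i → i ≤ p ^ 2 → (p : A) ∣ f i) (hf : ¬(p : A) ^ 2 ∣ f (p ^ 2))
    (hπ : aeval π (eisPoly p f) = 0) (hmin : minpoly A π = eisPoly p f)
    (hgen : Algebra.adjoin K {π} = ⊤) :
    ((∀ i, 1 ≤ i → i < p → (p : A) ^ 2 ∣ f i) ∧
      ((p : A) ^ 2 ∣ f (p + 1) ∧ ¬(p : A) ^ 3 ∣ f (p + 1)) ∧
      ∀ i, p + 2 ≤ i → i < p ^ 2 → ¬p ∣ i → (p : A) ^ 3 ∣ f i) ∧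
    ∃ s, shiftSum p (adjoinGen A π) (algebraMap A _ ∘ f) s = 0 ∧ r s ≠ 0 := by
  have hp0 := H.prime.ne_zero
  have hint : IsIntegral A π := ⟨_, monic_eisPoly hp0, hπ⟩
  have hintK : IsIntegral K π := hint.tower_top
  have hrank : Module.finrank K L = p ^ 2 := by
    rw [finrank_eq_natDegree_minpoly hintK hgen, map_minpoly_eq hint, hmin,
      (monic_eisPoly hp0).natDegree_map, natDegree_eisPoly hp0]
  obtain ⟨σ, hσ⟩ := IsCyclic.exists_generator (α := L ≃ₐ[K] L)
  have horder : orderOf σ = Module.finrank K L := by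
    rw [orderOf_eq_card_of_forall_mem_zpowers hσ, IsGalois.card_aut_eq_finrank]
  have hmem : σ π ∈ Algebra.adjoin A {π} := by
    refine mem_adjoin_of_isIntegral hp hdvd hint hgen ?_ ?_
    · rw [hmin]
      exact isEisensteinAt_eisPoly hp0 hp.not_isUnit hfp hf
    · exact hint.map (σ.toAlgHom.restrictScalars A)
  have hroot : aeval (⟨σ π, hmem⟩ : Algebra.adjoin A {π}) (minpoly A π) = 0 := by
    apply Subtype.ext
    have h1 := aeval_algHom_apply (σ.toAlgHom.restrictScalars A) π (minpoly A π)
    have h2 := aeval_algHom_apply (Algebra.adjoin A {π}).val ⟨σ π, hmem⟩ (minpoly A π)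
    rw [minpoly.aeval, map_zero] at h1
    exact h2.symm.trans h1
  have : Module.IsTorsionFree A L := isTorsionFree_of_tower K
  obtain ⟨τ, hτ⟩ := exists_algHom_adjoin hint hroot
  have hcoe := coe_pow_apply (σ := σ) (τ := τ) (by rw [hτ])
  have hϖ := aeval_adjoinGen_eisPoly hπ
  refine H.exists_shiftSum_eq_zero_of_prod_eq (σ := τ) ?_ ?_ ?_
  · rw [aeval_eisPoly] at hϖ
    exact eq_neg_of_add_eq_zero_left hϖ
  · apply Subtype.ext
    rw [hcoe, ← hrank, ← horder, pow_orderOf_eq_one]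
    rfl
  · apply Subtype.ext
    rw [← aeval_derivative_eisPoly hp0, coe_aeval_adjoinGen, ← hmin]
    have h := prod_sub_pow_apply hintK hgen horder
    rw [map_minpoly_eq hint, derivative_map, aeval_map_algebraMap, horder, hrank] at h
    rw [← h]
    push_cast
    simp only [hcoe]

theorem isGalois_and_isCyclic (hp : Prime (p : A))
    (hfp : ∀ i, 1 ≤ i → i ≤ p ^ 2 → (p : A) ∣ f i)
    (h1 : ∀ i, 1 ≤ i → i < p ^ 2 → i ≠ p → (p : A) ^ 2 ∣ f i)
    (h2 : ∀ i, p + 2 ≤ i → i < p ^ 2 → ¬p ∣ i → (p : A) ^ 3 ∣ f i)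
    (hπ : aeval π (eisPoly p f) = 0) (hmin : minpoly A π = eisPoly p f)
    (hgen : Algebra.adjoin K {π} = ⊤) {s : Algebra.adjoin A {π}}
    (hs : shiftSum p (adjoinGen A π) (algebraMap A _ ∘ f) s = 0) (hs0 : r s ≠ 0) :
    IsGalois K L ∧ IsCyclic (L ≃ₐ[K] L) := by
  have hp0 := H.prime.ne_zero
  have hint : IsIntegral A π := ⟨_, monic_eisPoly hp0, hπ⟩
  have hintK : IsIntegral K π := hint.tower_top
  have hrank : Module.finrank K L = p ^ 2 := by
    rw [finrank_eq_natDegree_minpoly hintK hgen, map_minpoly_eq hint, hmin,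
      (monic_eisPoly hp0).natDegree_map, natDegree_eisPoly hp0]
  have : Module.IsTorsionFree A L := isTorsionFree_of_tower K
  have hrϖ : r (adjoinGen A π) = 0 := H.map_uniformizer
  obtain ⟨v, hv⟩ : ∃ v, (1 + adjoinGen A π * s) * v = 1 :=
    (H.isUnit (1 + adjoinGen A π * s) (by simp [hrϖ])).exists_right_inv
  have hroot := aeval_mul_eisPoly_eq_zero hv (aeval_adjoinGen_eisPoly hπ) hs
  rw [← hmin] at hroot
  obtain ⟨τ, hτ⟩ := exists_algHom_adjoin hint hroot
  obtain ⟨σ, hσ⟩ := exists_algEquiv (y := ((adjoinGen A π * v : Algebra.adjoin A {π}) : L))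
    hint hgen (by
      rw [← Subalgebra.coe_val, aeval_algHom_apply, hroot, map_zero])
  have hcoe := coe_pow_apply (σ := σ) (τ := τ) (by rw [hτ, hσ])
  have hτe : τ (adjoinGen A π) = adjoinGen A π + adjoinGen A π ^ 2 * (-s * v) := by
    rw [hτ]
    linear_combination adjoinGen A π * hv
  have hrv : r v ≠ 0 := by
    intro h0
    have := congrArg r hv
    simp [h0] at this
  obtain ⟨hν, y, hy⟩ := H.exists_sum_derivCoeff_eq hfp h1 h2 hτe
    (by rw [map_mul, map_neg]; exact mul_ne_zero (neg_ne_zero.2 hs0) hrv)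
  refine isGalois_and_isCyclic_of_orderOf_eq (σ := σ) ?_
  have := Fact.mk H.prime
  rw [hrank]
  refine orderOf_eq_prime_pow (n := 1) (fun h => ?_) (by rw [← hrank, pow_finrank_eq_one])
  rw [pow_one] at h
  have hcoe' : ((∑ j ∈ range p, (τ ^ j) (adjoinGen A π) : Algebra.adjoin A {π}) : L) =
      ∑ j ∈ range p, (σ ^ j) π := by
    push_cast
    simp only [hcoe]
  have hderiv : aeval π (derivative (minpoly A π)) =
      p ^ 2 * (∑ j ∈ range p, (σ ^ j) π) * y := by
    rw [hmin, ← coe_aeval_adjoinGen, aeval_derivative_eisPoly hp0, hy, ← hcoe']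
    rfl
  have hderiv0 : aeval π (derivative (minpoly A π)) ≠ 0 := by
    have := (Algebra.IsSeparable.isSeparable K π).aeval_derivative_ne_zero (minpoly.aeval K π)
    rwa [map_minpoly_eq hint, derivative_map, aeval_map_algebraMap] at this
  rw [hderiv] at hderiv0
  have hν0 : ∑ j ∈ range p, (σ ^ j) π ≠ 0 := fun h0 => hderiv0 (by rw [h0]; ring)
  have hy0 : (y : L) ≠ 0 := right_ne_zero_of_mul hderiv0
  obtain ⟨c, hc⟩ := trace_div_mem hint hgen (adjoinGen A π * y)
  have htr := natCast_mul_trace_div_sum h π ((p : K) ^ 2) hν0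
  have hdiv : ((adjoinGen A π * y : Algebra.adjoin A {π}) : L) /
      aeval π (derivative (minpoly A π)) =
        π / (algebraMap K L ((p : K) ^ 2) * ∑ j ∈ range p, (σ ^ j) π) := by
    rw [hderiv, map_pow, map_natCast]
    exact mul_div_mul_right _ _ hy0
  rw [hdiv] at hc
  rw [hc, hrank, Nat.cast_pow, mul_inv_cancel₀ (pow_ne_zero 2 (Nat.cast_ne_zero.2 hp0)),
    ← map_natCast (algebraMap A K), ← map_mul, ← map_one (algebraMap A K)] at htr
  exact hp.not_isUnit (IsUnit.of_mul_eq_one _ (IsFractionRing.injective A K htr))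

end IsTotRamified

section Complete

variable {R B : Type*} [CommRing R] [CommRing B]

theorem pow_dvd_sub_of_le {ϖ : B} {s : ℕ → B} (hs : ∀ m, ϖ ^ m ∣ s (m + 1) - s m) {m n : ℕ}
    (h : m ≤ n) : ϖ ^ m ∣ s n - s m := by
  induction n, h using Nat.le_induction with
  | base => simp
  | succ n hn ih =>
    rw [← sub_add_sub_cancel _ (s n)]
    exact ((pow_dvd_pow _ hn).trans (hs n)).add ih

/-- Every `ϖ`-adic Cauchy sequence of `R` converges. -/
def IsCauchyComplete (ϖ : R) : Prop :=
  ∀ s : ℕ → R, (∀ m, ϖ ^ m ∣ s (m + 1) - s m) → ∃ x, ∀ m, ϖ ^ m ∣ x - s m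

theorem isCauchyComplete_padicInt (p : ℕ) [Fact p.Prime] : IsCauchyComplete (p : ℤ_[p]) := by
  intro s hs
  have hI (m : ℕ) (x y : ℤ_[p]) : x ≡ y [SMOD (IsLocalRing.maximalIdeal ℤ_[p] ^ m •
      ⊤ : Submodule ℤ_[p] ℤ_[p])] ↔ (p : ℤ_[p]) ^ m ∣ x - y := by
    rw [SModEq.sub_mem, PadicInt.maximalIdeal_eq_span_p, Ideal.span_singleton_pow,
      smul_eq_mul, Ideal.mul_top, Ideal.mem_span_singleton]
  obtain ⟨x, hx⟩ := IsPrecomplete.prec (I := IsLocalRing.maximalIdeal ℤ_[p]) inferInstance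
    (f := s) fun {m n} h => (hI _ _ _).2 (by
      rw [← neg_sub, dvd_neg]
      exact pow_dvd_sub_of_le hs h)
  exact ⟨x, fun m => by
    rw [← neg_sub, dvd_neg]
    exact (hI _ _ _).1 (hx m)⟩

theorem IsCauchyComplete.of_finite [Algebra R B] [Module.Finite R B] {q : R}
    (hq : IsCauchyComplete q) : IsCauchyComplete (algebraMap R B q) := by
  intro s hs
  obtain ⟨n, e, he⟩ := Module.Finite.exists_fin (R := R) (M := B)
  have hcoord : ∀ m, ∃ c : Fin n → R, s (m + 1) - s m = ∑ i, (q ^ m * c i) • e i := by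
    intro m
    obtain ⟨y, hy⟩ := hs m
    have hmem : y ∈ Submodule.span R (Set.range e) := he ▸ Submodule.mem_top
    obtain ⟨c, rfl⟩ := (Submodule.mem_span_range_iff_exists_fun R).1 hmem
    refine ⟨c, ?_⟩
    rw [hy, ← map_pow, ← Algebra.smul_def, smul_sum]
    simp only [mul_smul]
  choose c hc using hcoord
  have hlim : ∀ i, ∃ x, ∀ m, q ^ m ∣ x - ∑ k ∈ range m, q ^ k * c k i := fun i =>
    hq (fun m => ∑ k ∈ range m, q ^ k * c k i) fun m => by
      rw [sum_range_succ, add_sub_cancel_left]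
      exact dvd_mul_right _ _
  choose x hx using hlim
  choose d hd using hx
  refine ⟨s 0 + ∑ i, x i • e i, fun m => ⟨∑ i, d i m • e i, ?_⟩⟩
  have h1 : s m = s 0 + ∑ i, (∑ k ∈ range m, q ^ k * c k i) • e i := by
    simp only [sum_smul]
    rw [sum_comm, ← sum_congr rfl fun k _ => hc k, sum_range_sub]
    ring
  rw [h1, add_sub_add_left_eq_sub, ← sum_sub_distrib, ← map_pow, ← Algebra.smul_def, smul_sum]
  simp only [← sub_smul, hd, mul_smul]

theorem IsCauchyComplete.of_associated_pow {q ϖ : B} (hq : IsCauchyComplete q) {n : ℕ}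
    (hn : n ≠ 0) (h : Associated q (ϖ ^ n)) : IsCauchyComplete ϖ := by
  intro s hs
  have hdvd (m : ℕ) (y : B) : q ^ m ∣ y ↔ ϖ ^ (n * m) ∣ y := by
    rw [pow_mul, (h.pow_pow (n := m)).dvd_iff_dvd_left]
  obtain ⟨x, hx⟩ := hq (fun m => s (n * m)) fun m =>
    (hdvd _ _).2 (pow_dvd_sub_of_le hs (by gcongr; omega))
  have hle : ∀ m, m ≤ n * m := fun m => Nat.le_mul_of_pos_left _ (Nat.pos_of_ne_zero hn)
  refine ⟨x, fun m => ?_⟩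
  rw [← sub_add_sub_cancel _ (s (n * m))]
  exact ((pow_dvd_pow _ (hle m)).trans ((hdvd _ _).1 (hx m))).add (pow_dvd_sub_of_le hs (hle m))

end Complete

theorem exists_dvd_pow {A : Type*} [CommRing A] [IsDomain A] [IsNoetherianRing A] {q : A}
    (hq : ¬IsUnit q) (hloc : ∀ x : A, ¬IsUnit x → q ∣ x) {d : A} (hd : d ≠ 0) :
    ∃ m, d ∣ q ^ m := by
  obtain ⟨m, c, hc, rfl⟩ := WfDvdMonoid.max_power_factor' hd hq
  have hu : IsUnit c := by
    by_contra h
    exact hc (hloc c h)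
  exact ⟨m, hu.mul_right_dvd.2 dvd_rfl⟩

theorem sq_eq_mul_pred_add {p : ℕ} (hp : 0 < p) : p ^ 2 = p * (p - 1) + p := by
  obtain ⟨q, rfl⟩ := Nat.exists_eq_succ_of_ne_zero hp.ne'
  simp only [Nat.succ_eq_add_one, Nat.add_sub_cancel]
  ring

section Field

variable {A κ : Type*} [CommRing A] [Field κ] {p : ℕ} {ρ : A →+* κ}

theorem exists_isTotRamified_adjoinGen [IsDomain A] [IsNoetherianRing A] [IsIntegrallyClosed A]
    {L : Type*} [Field L] [Algebra A L] [Module.IsTorsionFree A L] {π : L} {f : ℕ → A}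
    (hp : p.Prime) (hp2 : 2 < p) (hloc : ∀ x : A, ¬IsUnit x → (p : A) ∣ x) (hprime : Prime (p : A))
    (hρ : Function.Surjective ρ) (hker : ∀ x, ρ x = 0 ↔ (p : A) ∣ x)
    (hfp : ∀ i, 1 ≤ i → i ≤ p ^ 2 → (p : A) ∣ f i) (hf : ¬(p : A) ^ 2 ∣ f (p ^ 2))
    (hπ : aeval π (eisPoly p f) = 0) :
    ∃ r : Algebra.adjoin A {π} →+* κ, IsTotRamified p ρ r (adjoinGen A π) := by
  have hint : IsIntegral A π := ⟨_, monic_eisPoly hp.ne_zero, hπ⟩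
  have hg : (Algebra.adjoin.powerBasis' hint).gen = adjoinGen A π :=
    Algebra.adjoin.powerBasis'_gen hint
  rw [← hg]
  refine exists_isTotRamified hp hp2 hloc hρ hker (fun h => hprime.ne_zero ?_) hfp hf _ ?_
  · apply Module.isTorsionFree_iff_algebraMap_injective.1 ‹Module.IsTorsionFree A L›
    simpa using congrArg Subtype.val h
  · rw [hg, minpoly_adjoinGen]
    exact minpoly_eq_eisPoly hp.ne_zero hprime hfp hf hπ

variable [CharP κ p] {a b c c₀ g θ θ₀ : A}

theorem pow_mul_pred_eq (hp : p.Prime) (hb : ρ b ≠ 0) (hθ₀ : ρ θ₀ ≠ 0)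
    (hc₀ : b * θ₀ ^ p ^ 2 + a * θ₀ ^ p = p * c₀) : ρ θ₀ ^ (p * (p - 1)) = -ρ a / ρ b := by
  have h := congrArg ρ hc₀
  simp only [map_add, map_mul, map_pow, map_natCast, CharP.cast_eq_zero, zero_mul] at h
  rw [sq_eq_mul_pred_add hp.pos, pow_add] at h
  rw [eq_div_iff hb]
  apply mul_left_cancel₀ (pow_ne_zero p hθ₀)
  linear_combination h

theorem exists_root_of_exists_root (hp : p.Prime) (hρ : Function.Surjective ρ)
    (hker : ∀ x, ρ x = 0 ↔ (p : A) ∣ x) (hp0 : IsLeftRegular (p : A)) (hb : ρ b ≠ 0)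
    (hθ₀ : ρ θ₀ ≠ 0) (hc₀ : b * θ₀ ^ p ^ 2 + a * θ₀ ^ p = p * c₀)
    (hθ : ρ θ ^ (p * (p - 1)) = -ρ a / ρ b) (hc : b * θ ^ p ^ 2 + a * θ ^ p = p * c)
    (h : ∃ x, ρ b * x ^ p + ρ a * x - ρ c₀ - ρ g * ρ θ₀ = 0) :
    ∃ x, ρ b * x ^ p + ρ a * x - ρ c - ρ g * ρ θ = 0 := by
  have := Fact.mk hp
  obtain ⟨x, hx⟩ := h
  obtain ⟨t, ht⟩ := hρ (ρ θ / ρ θ₀)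
  rw [eq_div_iff hθ₀] at ht
  have ht1 : ρ t ^ p = ρ t := by
    by_cases ht0 : ρ t = 0
    · rw [ht0, zero_pow hp.ne_zero]
    have h1 := pow_mul_pred_eq hp hb hθ₀ hc₀
    rw [← hθ, ← ht, mul_pow, eq_comm, mul_eq_right₀ (pow_ne_zero _ hθ₀), mul_comm p, pow_mul] at h1
    have h2 : ρ t ^ (p - 1) = 1 := by
      apply frobenius_inj κ p
      rw [frobenius_def, h1, map_one]
    rw [← Nat.sub_add_cancel hp.one_le, pow_succ, h2, one_mul]
  have h1 : (p : A) ∣ t ^ p - t := by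
    rw [← hker, map_sub, map_pow, ht1, sub_self]
  have h2 : (p : A) ∣ θ - t * θ₀ := by
    rw [← hker, map_sub, map_mul, ht, sub_self]
  obtain ⟨u, hu⟩ := dvd_sub_pow_of_dvd_sub h1 1
  obtain ⟨v, hv⟩ := dvd_sub_pow_of_dvd_sub h2 1
  obtain ⟨w, hw⟩ := dvd_sub_pow_of_dvd_sub h2 2
  have h3 : c = t ^ p * c₀ + p * (b * (p * w + u * θ₀ ^ p ^ 2) + a * v) := by
    apply hp0
    simp only [pow_one, ← pow_mul, ← sq, mul_pow] at hu hv hw ⊢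
    linear_combination -hc + t ^ p * hc₀ + b * hw + b * θ₀ ^ p ^ 2 * hu + a * hv
  refine ⟨ρ t * x, ?_⟩
  rw [h3, map_add, map_mul ρ (p : A), map_natCast, CharP.cast_eq_zero, zero_mul, add_zero, ← ht,
    map_mul, map_pow, mul_pow, ht1]
  linear_combination ρ t * hx

end Field

section Conditions

variable {A κ : Type*} [CommRing A] [Field κ] {p : ℕ} {ρ : A →+* κ} {a b : A} {f g : ℕ → A}

theorem coprime_iff_not_dvd (hp : p.Prime) {i : ℕ} : Nat.Coprime i p ↔ ¬p ∣ i := by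
  rw [Nat.coprime_comm, hp.coprime_iff_not_dvd]

theorem sq_dvd_of_ne (hp : p.Prime)
    (h1 : ∀ i, 2 ≤ i → i ≤ p - 1 → Nat.Coprime i p → (p : A) ^ 2 ∣ f (p * i))
    (h2 : ∀ i, 1 ≤ i → i ≤ p - 1 → Nat.Coprime i p → (p : A) ^ 2 ∣ f i)
    (h3 : (p : A) ^ 2 ∣ f (p + 1))
    (h4 : ∀ i, p + 2 ≤ i → i ≤ p ^ 2 - 1 → Nat.Coprime i p → (p : A) ^ 3 ∣ f i) :
    ∀ i, 1 ≤ i → i < p ^ 2 → i ≠ p → (p : A) ^ 2 ∣ f i := by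
  intro i hi hi' hip
  by_cases hpi : p ∣ i
  · obtain ⟨k, rfl⟩ := hpi
    have hk0 : k ≠ 0 := by
      rintro rfl
      simp at hi
    have hk1 : k ≠ 1 := by
      rintro rfl
      simp at hip
    have hk : k < p := by
      rw [sq] at hi'
      exact lt_of_mul_lt_mul_left' hi'
    exact h1 k (by omega) (by omega)
      ((coprime_iff_not_dvd hp).2 (Nat.not_dvd_of_pos_of_lt (by omega) hk))
  · have hcop := (coprime_iff_not_dvd hp).2 hpi
    rcases lt_trichotomy i (p + 1) with h | rfl | h
    · exact h2 i hi (by omega) hcop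
    · exact h3
    · exact (pow_dvd_pow _ (by norm_num)).trans (h4 i h (by omega) hcop)

theorem isNormalized [IsDomain A] (hp : p.Prime) (hp0 : (p : A) ≠ 0)
    (hker : ∀ x, ρ x = 0 ↔ (p : A) ∣ x) (hfp : ¬(p : A) ^ 2 ∣ f p)
    (hf : ¬(p : A) ^ 2 ∣ f (p ^ 2))
    (h3 : ∀ i, p + 2 ≤ i → i ≤ p ^ 2 - 1 → Nat.Coprime i p → (p : A) ^ 3 ∣ f i)
    (ha : f p = p * a) (hb : f (p ^ 2) = p * b)
    (hg : ∀ i, 1 ≤ i → i < p ^ 2 → i ≠ p → f i = p ^ 2 * g i) : IsNormalized p ρ f a b g := by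
  refine ⟨ha, hb, hg, fun i hi => ?_, fun h => hfp ?_, fun h => hf ?_⟩
  · obtain ⟨h1, h2, h4⟩ := mem_highIndices.1 hi
    have h := h3 i h1 (by omega) ((coprime_iff_not_dvd hp).2 h4)
    rw [hg i (by omega) h2 (by omega), pow_succ] at h
    exact (hker _).2 ((mul_dvd_mul_iff_left (pow_ne_zero 2 hp0)).1 h)
  · rw [ha, sq]
    exact mul_dvd_mul_left _ ((hker a).1 h)
  · rw [hb, sq]
    exact mul_dvd_mul_left _ ((hker b).1 h)

variable {x y u v β : κ}

theorem eq_mul_div_pow_iff (hu : u ≠ 0) : x = v * (y / u) ^ p ↔ u ^ p * x = v * y ^ p := by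
  rw [div_pow, mul_div_assoc', eq_div_iff (pow_ne_zero p hu), mul_comm x]

theorem eq_mul_div_pow_add_iff (hu : u ≠ 0) (h2 : (2 : κ) ≠ 0) :
    x = v * (y / u) ^ p + 1 / 2 * u * (u - β) ↔
      2 * (u ^ p * x - v * y ^ p) = u ^ (p + 1) * (u - β) := by
  have h : u ^ p * x - v * y ^ p = u ^ p * (x - v * (y / u) ^ p) := by
    rw [div_pow]
    field_simp
  rw [← sub_eq_iff_eq_add', h, ← mul_right_inj' (mul_ne_zero h2 (pow_ne_zero p hu)), eq_comm]
  have h3 : 2 * u ^ p * (1 / 2 * u * (u - β)) = u ^ (p + 1) * (u - β) := by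
    field_simp
    ring
  rw [h3, mul_assoc, eq_comm]

end Conditions

section Main

variable {A K L κ : Type*} [CommRing A] [IsDomain A] [IsNoetherianRing A] [IsIntegrallyClosed A]
  [Field K] [CharZero K] [Algebra A K] [IsFractionRing A K] [Field L] [Algebra K L] [Algebra A L]
  [IsScalarTower A K L] [Field κ] [Finite κ] {p : ℕ} [Fact p.Prime] [CharP κ p] {ρ : A →+* κ}
  {π : L} {f : ℕ → A}

theorem isGalois_and_isCyclic_iff (hp2 : 2 < p) (hloc : ∀ x : A, ¬IsUnit x → (p : A) ∣ x)
    (hprime : Prime (p : A)) (hcomp : IsCauchyComplete (p : A)) (hρ : Function.Surjective ρ)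
    (hker : ∀ x, ρ x = 0 ↔ (p : A) ∣ x) (hfp : ∀ i, 1 ≤ i → i ≤ p ^ 2 → (p : A) ∣ f i)
    (hf : ¬(p : A) ^ 2 ∣ f (p ^ 2)) (hπ : aeval π (eisPoly p f) = 0)
    (hgen : Algebra.adjoin K {π} = ⊤) :
    (IsGalois K L ∧ IsCyclic (L ≃ₐ[K] L)) ↔
      (((p : A) ∣ f p ∧ ¬(p : A) ^ 2 ∣ f p) ∧
        (∀ i, 2 ≤ i → i ≤ p - 1 → Nat.Coprime i p → (p : A) ^ 2 ∣ f (p * i))) ∧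
      ((∀ i, 1 ≤ i → i ≤ p - 1 → Nat.Coprime i p → (p : A) ^ 2 ∣ f i) ∧
        ((p : A) ^ 2 ∣ f (p + 1) ∧ ¬(p : A) ^ 3 ∣ f (p + 1)) ∧
        (∀ i, p + 2 ≤ i → i ≤ p ^ 2 - 1 → Nat.Coprime i p → (p : A) ^ 3 ∣ f i)) ∧
      (∀ (a b : A) (g : ℕ → A),
        f p = p * a → f (p ^ 2) = p * b →
        (∀ i, 1 ≤ i → i < p ^ 2 → i ≠ p → f i = p ^ 2 * g i) →
        (∃ c : κ, c ≠ 0 ∧ c ^ (p - 1) = -ρ a / ρ b) ∧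
        (ρ (g (p + 1)) ^ p = -ρ a ^ (p + 1)) ∧
        (∀ l, 3 ≤ l → l ≤ p - 1 → Nat.Coprime l p →
          ρ (g (p * l)) = ρ b * (ρ (g l) / ρ a) ^ p) ∧
        (ρ (g (2 * p)) = ρ b * (ρ (g 2) / ρ a) ^ p +
          (1 / 2 : κ) * ρ a * (ρ a - (frobeniusEquiv κ p).symm (ρ b))) ∧
        (∀ θ : A, ρ θ ^ (p * (p - 1)) = -ρ a / ρ b →
          ∀ c : A, f (p ^ 2) * θ ^ p ^ 2 + f p * θ ^ p = p ^ 2 * c →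
            ∃ x : κ, ρ b * x ^ p + ρ a * x - ρ c - ρ (g 1) * ρ θ = 0)) := by
  have hp : p.Prime := Fact.out
  have h2 : (2 : κ) ≠ 0 := Ring.two_ne_zero (by
    rw [ringChar.eq κ p]
    omega)
  have : Module.IsTorsionFree A L := isTorsionFree_of_tower K
  have hint : IsIntegral A π := ⟨_, monic_eisPoly hp.ne_zero, hπ⟩
  have : FiniteDimensional K L := by
    have := (PowerBasis.ofAdjoinEqTop (hint.tower_top (A := K)) hgen).finite
    exact this
  have hmin := minpoly_eq_eisPoly hp.ne_zero hprime hfp hf hπ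
  obtain ⟨r, H⟩ := exists_isTotRamified_adjoinGen hp hp2 hloc hprime hρ hker hfp hf hπ
  have hϖ := eq_neg_of_add_eq_zero_left ((aeval_eisPoly _).symm.trans (aeval_adjoinGen_eisPoly hπ))
  have hβ (b : A) : (frobeniusEquiv κ p).symm (ρ b) ^ p = ρ b := frobeniusEquiv_symm_pow_p κ p _
  have hroot (x : κ) : ∃ y, y ^ p = x := ⟨_, frobeniusEquiv_symm_pow_p κ p x⟩
  have hcop {i : ℕ} : Nat.Coprime i p ↔ ¬p ∣ i := coprime_iff_not_dvd hp
  have hp_lt : p < p ^ 2 := by nlinarith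
  constructor
  · rintro ⟨hgal, hcyc⟩
    obtain ⟨⟨h1, h3, h4⟩, s, hs, hs0⟩ := H.exists_shiftSum_eq_zero_of_isCyclic hprime
      (fun d hd => exists_dvd_pow hprime.not_isUnit hloc hd) hfp hf hπ hmin hgen
    obtain ⟨h5, h6⟩ := H.sq_dvd_of_shiftSum_eq_zero hs hs0 hfp hf fun i hi hi' hpi => by
      rcases lt_trichotomy i (p + 1) with h | rfl | h
      · exact h1 i hi (lt_of_le_of_ne (by omega) fun h => hpi h.symm.dvd)
      · exact h3.1
      · exact (pow_dvd_pow _ (by norm_num)).trans (h4 i h hi' hpi)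
    have hfp1 : ¬(p : A) ^ 2 ∣ f p := by
      rintro ⟨d, hd⟩
      exact h6 (p * d) (by rw [hd]; ring) (by simp)
    have h4' : ∀ i, p + 2 ≤ i → i ≤ p ^ 2 - 1 → Nat.Coprime i p → (p : A) ^ 3 ∣ f i :=
      fun i hi hi' hi'' => h4 i hi (by omega) (hcop.1 hi'')
    refine ⟨⟨⟨hfp p hp.one_le hp_lt.le, hfp1⟩, fun i hi hi' _ => h5 i hi (by omega)⟩,
      ⟨fun i hi hi' _ => h1 i hi (by omega), h3, h4'⟩, fun a b g ha hb hg => ?_⟩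
    have hnorm := isNormalized hp hprime.ne_zero hker hfp1 hf h4' ha hb hg
    have ha0 := hnorm.map_a_ne_zero
    have hb0 := hnorm.map_b_ne_zero
    obtain ⟨⟨e4, e5, e6⟩, θ₀, c₀, x, hθ₀, hc₀, hx⟩ :=
      H.exists_conditions_of_shiftSum_eq_zero hnorm hroot hϖ hfp (hβ b) hs hs0
    refine ⟨⟨ρ θ₀ ^ p, pow_ne_zero p hθ₀, ?_⟩, e4, fun l hl hl' _ => ?_, ?_, fun θ hθ c hc => ?_⟩
    · rw [← pow_mul, pow_mul_pred_eq hp hb0 hθ₀ hc₀]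
    · exact (eq_mul_div_pow_iff ha0).2 (e5 l (mem_Ico.2 ⟨hl, by omega⟩))
    · rw [mul_comm 2 p]
      exact (eq_mul_div_pow_add_iff ha0 h2).2 e6
    · refine exists_root_of_exists_root hp hρ hker (mul_right_injective₀ hprime.ne_zero) hb0 hθ₀
        hc₀ hθ ?_ ⟨x, hx⟩
      apply mul_left_cancel₀ hprime.ne_zero
      rw [ha, hb] at hc
      linear_combination hc
  · rintro ⟨⟨⟨hfp0, hfp1⟩, h1⟩, ⟨h2', h3, h4⟩, h⟩
    have hsq := sq_dvd_of_ne hp h1 h2' h3.1 h4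
    obtain ⟨a, ha⟩ := hfp0
    obtain ⟨b, hb⟩ := hfp (p ^ 2) (pow_pos hp.pos 2) le_rfl
    choose! g hg using fun i h1 h2 h3 => hsq i h1 h2 h3
    obtain ⟨⟨c, hc0, hc⟩, e4, e5, e6, e7⟩ := h a b g ha hb hg
    have hnorm := isNormalized hp hprime.ne_zero hker hfp1 hf h4 ha hb hg
    have ha0 := hnorm.map_a_ne_zero
    have hb0 := hnorm.map_b_ne_zero
    obtain ⟨y, hy⟩ := hroot c
    obtain ⟨θ, rfl⟩ := hρ y
    have hθ0 : ρ θ ≠ 0 := by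
      rintro h0
      exact hc0 (by rw [← hy, h0, zero_pow hp.ne_zero])
    have hθ : ρ θ ^ (p * (p - 1)) = -ρ a / ρ b := by rw [pow_mul, hy, hc]
    obtain ⟨d, hd⟩ : (p : A) ∣ b * θ ^ p ^ 2 + a * θ ^ p := by
      rw [← hker]
      rw [sq_eq_mul_pred_add hp.pos, pow_add, map_add, map_mul, map_mul, map_mul,
        map_pow ρ θ (p * (p - 1)), hθ]
      field_simp
      ring
    obtain ⟨x, hx⟩ := e7 θ hθ d (by
      rw [ha, hb]
      linear_combination (p : A) * hd)
    have : Module.Finite A (Algebra.adjoin A {π}) := (Algebra.adjoin.powerBasis' hint).finite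
    have hcomp' := hcomp.of_finite (B := Algebra.adjoin A {π})
    rw [map_natCast] at hcomp'
    obtain ⟨s, hs, hs'⟩ := H.exists_shiftSum_eq_zero hnorm
      (hcomp'.of_associated_pow (pow_ne_zero 2 hp.ne_zero) H.associated) hϖ hfp (hβ a) (hβ b) hd e4
      (fun k hk => (eq_mul_div_pow_iff ha0).1 (e5 k (mem_Ico.1 hk).1
        (Nat.le_sub_one_of_lt (mem_Ico.1 hk).2) (hcop.2 (Nat.not_dvd_of_pos_of_lt
          (by have := (mem_Ico.1 hk).1; omega) (mem_Ico.1 hk).2))))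
      ((eq_mul_div_pow_add_iff ha0 h2).1 (by rw [mul_comm p 2]; exact e6)) hx
    exact H.isGalois_and_isCyclic hprime hfp hsq
      (fun i hi hi' hpi => h4 i hi (by omega) (hcop.2 hpi)) hπ hmin hgen hs (by rwa [hs'])

end Main

end CyclicEisenstein

/-- Characterization of the Eisenstein polynomials
`f(X) = X^{p²} + f_1X^{p²−1} + ⋯ + f_{p²}` over a finite unramified extension `K/ℚ_p` (`p` odd)
which generate a cyclic Galois extension of degree `p²`.  Here `𝒪_K` is the ring of integers of
`K` (with `p` generating its maximal ideal), `κ_K = 𝒪_K/p𝒪_K` is the residue field (presented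
as a finite field `κ` with a surjection `ρ : 𝒪_K → κ` of kernel `p𝒪_K`), the elements
`F_p = ρ(f_p/p)`, `F_{p²} = ρ(f_{p²}/p)`, `G_i = ρ(f_i/p²)` are introduced through witnesses
`a`, `b`, `g i` of the relevant divisibilities, and `x^{1/p}` is the inverse of Frobenius. -/
theorem stmt10 (p : ℕ) [Fact (Nat.Prime p)] (hodd : Odd p)
    (K : Type) [Field K] [Algebra ℚ_[p] K] [FiniteDimensional ℚ_[p] K]
    (hKloc : ∀ x : integralClosure ℤ_[p] K, ¬IsUnit x → (p : integralClosure ℤ_[p] K) ∣ x)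
    (hKp : ¬IsUnit (p : integralClosure ℤ_[p] K))
    -- the residue field
    (κ : Type) [Field κ] [Finite κ] [CharP κ p]
    (ρ : integralClosure ℤ_[p] K →+* κ) (hρ : Function.Surjective ρ)
    (hker : RingHom.ker ρ = Ideal.span {(p : integralClosure ℤ_[p] K)})
    -- an Eisenstein polynomial of degree `p²`
    (f : ℕ → integralClosure ℤ_[p] K)
    (hfE : ∀ i, 1 ≤ i → i ≤ p ^ 2 → (p : integralClosure ℤ_[p] K) ∣ f i)
    (hfE' : ¬(p : integralClosure ℤ_[p] K) ^ 2 ∣ f (p ^ 2))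
    -- the extension `L = K(π)` generated by a root of `f`
    (L : Type) [Field L] [Algebra K L] (π : L)
    (hπ : aeval π (X ^ p ^ 2 + ∑ i ∈ Finset.range (p ^ 2),
        C ((f (i + 1) : K)) * X ^ (p ^ 2 - (i + 1))) = 0)
    (hgen : adjoin K {π} = ⊤) :
    (IsGalois K L ∧ IsCyclic (L ≃ₐ[K] L)) ↔
      -- (1)  v_p(f_p) = 1 and v_p(f_{pi}) ≥ 2 for i ∈ 𝕀(2,p−1)
      (((p : integralClosure ℤ_[p] K) ∣ f p ∧ ¬(p : integralClosure ℤ_[p] K) ^ 2 ∣ f p) ∧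
        (∀ i, 2 ≤ i → i ≤ p - 1 → Nat.Coprime i p →
          (p : integralClosure ℤ_[p] K) ^ 2 ∣ f (p * i))) ∧
      -- (2)  v_p(f_i) ≥ 2 for i ∈ 𝕀(1,p−1), v_p(f_{p+1}) = 2, v_p(f_i) ≥ 3 for i ∈ 𝕀(p+2,p²−1)
      ((∀ i, 1 ≤ i → i ≤ p - 1 → Nat.Coprime i p →
          (p : integralClosure ℤ_[p] K) ^ 2 ∣ f i) ∧
        ((p : integralClosure ℤ_[p] K) ^ 2 ∣ f (p + 1) ∧
          ¬(p : integralClosure ℤ_[p] K) ^ 3 ∣ f (p + 1)) ∧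
        (∀ i, p + 2 ≤ i → i ≤ p ^ 2 - 1 → Nat.Coprime i p →
          (p : integralClosure ℤ_[p] K) ^ 3 ∣ f i)) ∧
      -- (3)–(7), in terms of F_p = ρ a, F_{p²} = ρ b, G_i = ρ (g i)
      (∀ (a b : integralClosure ℤ_[p] K) (g : ℕ → integralClosure ℤ_[p] K),
        f p = p * a → f (p ^ 2) = p * b →
        (∀ i, 1 ≤ i → i < p ^ 2 → i ≠ p → f i = p ^ 2 * g i) →
        -- (3)  −F_p/F_{p²} ∈ (κ^×)^{p−1}
        (∃ c : κ, c ≠ 0 ∧ c ^ (p - 1) = -ρ a / ρ b) ∧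
        -- (4)  G_{p+1}^p = −F_p^{p+1}
        (ρ (g (p + 1)) ^ p = -ρ a ^ (p + 1)) ∧
        -- (5)  G_{pℓ} = F_{p²}·(G_ℓ/F_p)^p for ℓ ∈ 𝕀(3,p−1)
        (∀ l, 3 ≤ l → l ≤ p - 1 → Nat.Coprime l p →
          ρ (g (p * l)) = ρ b * (ρ (g l) / ρ a) ^ p) ∧
        -- (6)  G_{2p} = F_{p²}·(G_2/F_p)^p + (1/2)·F_p·(F_p − F_{p²}^{1/p})
        (ρ (g (2 * p)) = ρ b * (ρ (g 2) / ρ a) ^ p +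
          (1 / 2 : κ) * ρ a * (ρ a - (frobeniusEquiv κ p).symm (ρ b))) ∧
        -- (7)  for any θ with θ̄^{p(p−1)} = −F_p/F_{p²}, the polynomial
        --      F_{p²}X^p + F_pX − ((f_{p²}θ^{p²}+f_pθ^p)/p²)‾ − G_1·θ̄ has a root in κ
        (∀ θ : integralClosure ℤ_[p] K, ρ θ ^ (p * (p - 1)) = -ρ a / ρ b →
          ∀ c : integralClosure ℤ_[p] K,
            f (p ^ 2) * θ ^ p ^ 2 + f p * θ ^ p = p ^ 2 * c →
            ∃ x : κ, ρ b * x ^ p + ρ a * x - ρ c - ρ (g 1) * ρ θ = 0)) := by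
  have hp : p.Prime := Fact.out
  have hp2 : 2 < p := lt_of_le_of_ne hp.two_le (by
    rintro rfl
    exact absurd hodd (by decide))
  have : IsScalarTower ℤ_[p] ℚ_[p] K := IsScalarTower.of_algebraMap_eq' rfl
  have : CharZero K := charZero_of_injective_algebraMap (algebraMap ℚ_[p] K).injective
  have : IsFractionRing (integralClosure ℤ_[p] K) K :=
    integralClosure.isFractionRing_of_finite_extension ℚ_[p] K
  have : IsNoetherianRing (integralClosure ℤ_[p] K) :=
    IsIntegralClosure.isNoetherianRing ℤ_[p] ℚ_[p] K _
  have : Module.Finite ℤ_[p] (integralClosure ℤ_[p] K) :=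
    IsIntegralClosure.finite ℤ_[p] ℚ_[p] K _
  have : IsIntegrallyClosed (integralClosure ℤ_[p] K) :=
    integralClosure.isIntegrallyClosedOfFiniteExtension ℚ_[p]
  have hker' (x : integralClosure ℤ_[p] K) : ρ x = 0 ↔ (p : integralClosure ℤ_[p] K) ∣ x := by
    rw [← Ideal.mem_span_singleton, ← hker, RingHom.mem_ker]
  have hprime : Prime (p : integralClosure ℤ_[p] K) := by
    refine ⟨Nat.cast_ne_zero.2 hp.ne_zero, hKp, fun x y hxy => ?_⟩
    rwa [← hker', map_mul, mul_eq_zero, hker', hker'] at hxy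
  have hcomp := (CyclicEisenstein.isCauchyComplete_padicInt p).of_finite
    (B := integralClosure ℤ_[p] K)
  rw [map_natCast] at hcomp
  have hroot : aeval π (CyclicEisenstein.eisPoly p f) = 0 := by
    rw [← aeval_map_algebraMap K, ← hπ]
    simp [CyclicEisenstein.eisPoly, Polynomial.map_sum]
  have hint : IsIntegral K π := by
    have : IsIntegral (integralClosure ℤ_[p] K) π :=
      ⟨_, CyclicEisenstein.monic_eisPoly hp.ne_zero, hroot⟩
    exact this.tower_top
  have hgen' : Algebra.adjoin K {π} = ⊤ := by
    rw [← adjoin_simple_toSubalgebra_of_isAlgebraic hint.isAlgebraic, hgen, top_toSubalgebra]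
  exact CyclicEisenstein.isGalois_and_isCyclic_iff hp2 hKloc hprime hcomp hρ hker' hfE hfE' hroot
    hgen'
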